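/- Fix τ > 2 and α ∈ DC_τ. Let ψ : ℝ/ℤ → ℝ satisfy condition (V) and sup ψ − inf ψ < π, and for λ > 0, θ ∈ ℝ let B^{(θ,λ)}(x) = diag(λ, λ⁻¹)·R_{ψ(x)}·R_θ. Then lim_{λ→∞} Leb{θ ∈ [0, π) : (α, B^{(θ,λ)}) is not uniformly hyperbolic} = Leb(ψ(ℝ/ℤ)) = sup ψ − inf ψ, where Leb denotes Lebesgue measure. -/

import Mathlib

open scoped Real
open Matrix

noncomputable section

/-- 2×2 real matrices. -/
abbrev M2 : Type := Matrix (Fin 2) (Fin 2) ℝ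

/-- Rotation matrix by angle θ. -/
def rot (θ : ℝ) : M2 := !![Real.cos θ, -Real.sin θ; Real.sin θ, Real.cos θ]

/-- Euclidean norm of a vector in ℝ². -/
def vnorm (w : Fin 2 → ℝ) : ℝ := ‖(WithLp.equiv 2 (Fin 2 → ℝ)).symm w‖

/-- Operator norm of a 2×2 real matrix acting on Euclidean ℝ². -/
def opNorm (A : M2) : ℝ := ‖Matrix.toEuclideanCLM (𝕜 := ℝ) A‖

/-- Forward iterates B_n(x) = B(x+(n-1)β)⋯B(x+β)B(x). -/
def fwdIter (β : ℝ) (B : ℝ → M2) : ℕ → ℝ → M2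
  | 0, _ => 1
  | n + 1, x => B (x + n * β) * fwdIter β B n x

/-- Cocycle iterates indexed by ℤ: B₀ = Id, B_n for n ≥ 1 as above, and
B_n(x) = [B_{-n}(x+nβ)]⁻¹ for n ≤ -1. -/
def cocycleIter (β : ℝ) (B : ℝ → M2) (n : ℤ) (x : ℝ) : M2 :=
  if 0 ≤ n then fwdIter β B n.toNat x else (fwdIter β B (-n).toNat (x + (n : ℝ) * β))⁻¹

/-- Uniform hyperbolicity of the cocycle (β, B) over the circle ℝ/ℤ
(B is understood as a 1-periodic function of x): there are invariant 1-periodic line fields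
s̄ (stable) and ū (unstable) with uniform exponential contraction forwards resp. backwards. -/
def IsUH (β : ℝ) (B : ℝ → M2) : Prop :=
  ∃ (s u : ℝ → Submodule ℝ (Fin 2 → ℝ)) (c ρ : ℝ),
    0 < c ∧ 1 < ρ ∧
    (∀ x, Module.finrank ℝ (s x) = 1 ∧ Module.finrank ℝ (u x) = 1) ∧
    (∀ x, s (x + 1) = s x ∧ u (x + 1) = u x) ∧
    (∀ x, (s x).map (Matrix.toLin' (B x)) = s (x + β) ∧
          (u x).map (Matrix.toLin' (B x)) = u (x + β)) ∧
    (∀ x, ∀ n : ℕ, 1 ≤ n →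
      (∀ w : Fin 2 → ℝ, w ∈ s x → vnorm w = 1 →
        vnorm ((cocycleIter β B n x) *ᵥ w) < c / ρ ^ n) ∧
      (∀ w : Fin 2 → ℝ, w ∈ u x → vnorm w = 1 →
        vnorm ((cocycleIter β B (-(n : ℤ)) x) *ᵥ w) < c / ρ ^ n))

/-- The Diophantine condition DC_{τ,γ}. -/
def DCwith (τ γ α : ℝ) : Prop :=
  ∀ p q : ℤ, q ≠ 0 → γ / |(q : ℝ)| ^ τ ≤ |α - (p : ℝ) / (q : ℝ)|

/-- The Diophantine condition DC_τ = ∪_{γ>0} DC_{τ,γ}. -/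
def DC (τ α : ℝ) : Prop := ∃ γ > 0, DCwith τ γ α

/-- Condition (V) for a 1-periodic potential: C², the derivative vanishes at exactly two
points of the circle, one a global minimum and the other a global maximum, both
non-degenerate. -/
def ConditionV (v : ℝ → ℝ) : Prop :=
  ContDiff ℝ 2 v ∧
  ∃ z₁ z₂ : ℝ, z₁ ∈ Set.Ico (0 : ℝ) 1 ∧ z₂ ∈ Set.Ico (0 : ℝ) 1 ∧ z₁ ≠ z₂ ∧
    (∀ x ∈ Set.Ico (0 : ℝ) 1, deriv v x = 0 ↔ x = z₁ ∨ x = z₂) ∧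
    (∀ x, v z₁ ≤ v x) ∧ (∀ x, v x ≤ v z₂) ∧
    iteratedDeriv 2 v z₁ ≠ 0 ∧ iteratedDeriv 2 v z₂ ≠ 0

/-- The Schrödinger cocycle map A^{(E-λv)}. -/
def schCocycle (lam : ℝ) (v : ℝ → ℝ) (E : ℝ) (x : ℝ) : M2 :=
  !![E - lam * v x, -1; 1, 0]

/-- The one-parameter family of cocycle maps B^{(θ,λ)}(x) = diag(λ, λ⁻¹)·R_{ψ(x)}·R_θ. -/
def rotFamily (lam θ : ℝ) (ψ : ℝ → ℝ) (x : ℝ) : M2 :=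
  Matrix.diagonal ![lam, lam⁻¹] * rot (ψ x) * rot θ


/-- Lift to angles of the projective action of `diag(l, l⁻¹)`. -/
def dl (l t : ℝ) : ℝ :=
  t + Real.arctan (((l⁻¹ - l) * (Real.sin t * Real.cos t)) /
    (l * Real.cos t ^ 2 + l⁻¹ * Real.sin t ^ 2))

/-- Length of the image under `diag(l, l⁻¹)` of the unit vector of angle `t`. -/
def dr (l t : ℝ) : ℝ := Real.sqrt ((l * Real.cos t) ^ 2 + (l⁻¹ * Real.sin t) ^ 2)

lemma dl_den_pos {l : ℝ} (hl : 0 < l) (t : ℝ) :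
    0 < l * Real.cos t ^ 2 + l⁻¹ * Real.sin t ^ 2 := by
  have h1 : 0 < l⁻¹ := inv_pos.mpr hl
  rcases eq_or_ne (Real.cos t) 0 with h | h
  · have : Real.sin t ^ 2 = 1 := by nlinarith [Real.sin_sq_add_cos_sq t]
    rw [h, this]; simpa using hl
  · have := sq_nonneg (Real.sin t)
    have : 0 < Real.cos t ^ 2 := by positivity
    positivity

lemma dr_sq {l : ℝ} (t : ℝ) :
    dr l t ^ 2 = (l * Real.cos t) ^ 2 + (l⁻¹ * Real.sin t) ^ 2 :=
  Real.sq_sqrt (by positivity)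

lemma dr_pos {l : ℝ} (hl : 0 < l) (t : ℝ) : 0 < dr l t := by
  unfold dr
  apply Real.sqrt_pos.mpr
  have h1 : 0 < l⁻¹ := inv_pos.mpr hl
  rcases eq_or_ne (Real.cos t) 0 with h | h
  · have : Real.sin t ≠ 0 := by
      intro h2; nlinarith [Real.sin_sq_add_cos_sq t]
    have := sq_nonneg (l * Real.cos t)
    positivity
  · have : 0 < (l * Real.cos t) ^ 2 := by positivity
    positivity

lemma dl_sub_abs_lt (l t : ℝ) : |dl l t - t| < π / 2 := by
  unfold dl
  rw [add_sub_cancel_left, abs_lt]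
  exact ⟨Real.neg_pi_div_two_lt_arctan _, Real.arctan_lt_pi_div_two _⟩

lemma dl_add_pi (l t : ℝ) : dl l (t + π) = dl l t + π := by
  unfold dl
  rw [Real.sin_add_pi, Real.cos_add_pi]
  simp only [neg_mul_neg, neg_sq]
  ring

lemma dl_zero (l : ℝ) : dl l 0 = 0 := by simp [dl]

lemma dl_pi_div_two (l : ℝ) : dl l (π / 2) = π / 2 := by simp [dl]

lemma continuous_dl {l : ℝ} (hl : 0 < l) : Continuous (dl l) := by
  unfold dl
  refine continuous_id.add (Real.continuous_arctan.comp ?_)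
  refine Continuous.div (by fun_prop) (by fun_prop) fun t => (dl_den_pos hl t).ne'

lemma dr_mul_trig {l : ℝ} (hl : 0 < l) (t : ℝ) :
    dr l t * Real.cos (dl l t) = l * Real.cos t ∧
    dr l t * Real.sin (dl l t) = l⁻¹ * Real.sin t := by
  set D := l * Real.cos t ^ 2 + l⁻¹ * Real.sin t ^ 2 with hD
  set E := (l⁻¹ - l) * (Real.sin t * Real.cos t) with hE
  have hDp : 0 < D := dl_den_pos hl t
  have hsq : dr l t ^ 2 = D ^ 2 + E ^ 2 := by
    rw [dr_sq, hD, hE]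
    have : l * l⁻¹ = 1 := mul_inv_cancel₀ hl.ne'
    linear_combination (-(l * Real.cos t) ^ 2 - (l⁻¹ * Real.sin t) ^ 2) *
      Real.sin_sq_add_cos_sq t
  have hr := dr_pos hl t
  have hsqrt : Real.sqrt (1 + (E / D) ^ 2) = dr l t / D := by
    rw [Real.sqrt_eq_iff_mul_self_eq (by positivity) (by positivity)]
    field_simp
    linarith
  have hc : dr l t * Real.cos (Real.arctan (E / D)) = D := by
    rw [Real.cos_arctan, hsqrt]; field_simp
  have hs : dr l t * Real.sin (Real.arctan (E / D)) = E := by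
    rw [Real.sin_arctan, hsqrt]; field_simp
  have hdl : dl l t = t + Real.arctan (E / D) := rfl
  rw [hdl, Real.cos_add, Real.sin_add]
  constructor
  · calc _ = Real.cos t * (dr l t * Real.cos (Real.arctan (E / D))) -
        Real.sin t * (dr l t * Real.sin (Real.arctan (E / D))) := by ring
      _ = _ := by
        rw [hc, hs, hD, hE]
        linear_combination (l * Real.cos t) * Real.sin_sq_add_cos_sq t
  · calc _ = Real.sin t * (dr l t * Real.cos (Real.arctan (E / D))) +
        Real.cos t * (dr l t * Real.sin (Real.arctan (E / D))) := by ring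
      _ = _ := by
        rw [hc, hs, hD, hE]
        linear_combination (l⁻¹ * Real.sin t) * Real.sin_sq_add_cos_sq t

lemma dr_mul_sin_sub {l : ℝ} (hl : 0 < l) (s t : ℝ) :
    dr l s * dr l t * Real.sin (dl l t - dl l s) = Real.sin (t - s) := by
  obtain ⟨h1, h2⟩ := dr_mul_trig hl s
  obtain ⟨h3, h4⟩ := dr_mul_trig hl t
  have hh : l * l⁻¹ = 1 := mul_inv_cancel₀ hl.ne'
  rw [Real.sin_sub, Real.sin_sub]
  calc _ = (dr l t * Real.sin (dl l t)) * (dr l s * Real.cos (dl l s)) -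
      (dr l t * Real.cos (dl l t)) * (dr l s * Real.sin (dl l s)) := by ring
    _ = _ := by
      rw [h1, h2, h3, h4]
      linear_combination
        (Real.sin t * Real.cos s - Real.cos t * Real.sin s) * hh

lemma dl_strictMono {l : ℝ} (hl : 0 < l) : StrictMono (dl l) := by
  intro s t hst
  have h1 := abs_lt.mp (dl_sub_abs_lt l s)
  have h2 := abs_lt.mp (dl_sub_abs_lt l t)
  by_cases h : t - s < π
  · have hs : 0 < Real.sin (t - s) := Real.sin_pos_of_pos_of_lt_pi (by linarith) h
    rw [← dr_mul_sin_sub hl] at hs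
    have hp : 0 < dr l s * dr l t := mul_pos (dr_pos hl s) (dr_pos hl t)
    have hs' : 0 < Real.sin (dl l t - dl l s) := (mul_pos_iff_of_pos_left hp).mp hs
    by_contra hcon
    have := Real.sin_nonpos_of_nonpos_of_neg_pi_le (x := dl l t - dl l s) (by linarith)
      (by linarith [h1.2, h2.1])
    linarith
  · push Not at h; linarith [h1.2, h2.1]

lemma dr_le {l : ℝ} (hl : 1 ≤ l) (t : ℝ) : dr l t ≤ l := by
  have h0 : 0 < l := by linarith
  have hi : l⁻¹ ≤ l := (inv_le_one_of_one_le₀ hl).trans hl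
  have hi0 : 0 < l⁻¹ := inv_pos.mpr h0
  apply Real.sqrt_le_iff.mpr ⟨h0.le, ?_⟩
  have : (l⁻¹) ^ 2 ≤ l ^ 2 := by gcongr
  nlinarith [Real.sin_sq_add_cos_sq t, sq_nonneg (Real.sin t), sq_nonneg (Real.cos t)]

/-- Angle after `n` steps of the product of `diag(l, l⁻¹) R_{φ k}`, starting at angle `t`. -/
def ang (l : ℝ) (φ : ℕ → ℝ) : ℕ → ℝ → ℝ
  | 0, t => t
  | n + 1, t => dl l (φ n + ang l φ n t)

/-- Norm after `n` steps of the product, starting at the unit vector of angle `t`. -/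
def rad (l : ℝ) (φ : ℕ → ℝ) : ℕ → ℝ → ℝ
  | 0, _ => 1
  | n + 1, t => dr l (φ n + ang l φ n t) * rad l φ n t

section
variable {l : ℝ} (hl : 0 < l) (φ : ℕ → ℝ)

@[simp] lemma ang_zero (t : ℝ) : ang l φ 0 t = t := rfl
lemma ang_succ (n : ℕ) (t : ℝ) : ang l φ (n + 1) t = dl l (φ n + ang l φ n t) := rfl
@[simp] lemma rad_zero (t : ℝ) : rad l φ 0 t = 1 := rfl
lemma rad_succ (n : ℕ) (t : ℝ) :
    rad l φ (n + 1) t = dr l (φ n + ang l φ n t) * rad l φ n t := rfl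

include hl in
lemma rad_pos (n : ℕ) (t : ℝ) : 0 < rad l φ n t := by
  induction n with
  | zero => simp
  | succ n ih => rw [rad_succ]; exact mul_pos (dr_pos hl _) ih

lemma ang_add_pi (n : ℕ) (t : ℝ) : ang l φ n (t + π) = ang l φ n t + π := by
  induction n with
  | zero => simp
  | succ n ih => rw [ang_succ, ang_succ, ih, ← add_assoc, dl_add_pi]

lemma dl_add_int_mul_pi (l t : ℝ) (j : ℤ) : dl l (t + j * π) = dl l t + j * π := by
  induction j with
  | zero => simp
  | succ i ih =>
    push_cast at ih ⊢
    rw [add_mul, one_mul, ← add_assoc, dl_add_pi, ih]; ring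
  | pred i ih =>
    push_cast at ih ⊢
    have := dl_add_pi l (t + (-(i : ℝ) - 1) * π)
    rw [show t + (-(i : ℝ) - 1) * π + π = t + -(i : ℝ) * π by ring, ih] at this
    linarith

lemma ang_add_int_mul_pi (n : ℕ) (t : ℝ) (j : ℤ) :
    ang l φ n (t + j * π) = ang l φ n t + j * π := by
  induction n with
  | zero => simp
  | succ n ih => rw [ang_succ, ang_succ, ih, ← add_assoc, dl_add_int_mul_pi]

include hl in
lemma ang_strictMono (n : ℕ) : StrictMono (ang l φ n) := by
  induction n with
  | zero => intro a b h; simpa using h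
  | succ n ih => intro a b h; exact dl_strictMono hl (by have := ih h; linarith)

include hl in
lemma rad_mul_sin_sub (n : ℕ) (s t : ℝ) :
    rad l φ n s * rad l φ n t * Real.sin (ang l φ n t - ang l φ n s) = Real.sin (t - s) := by
  induction n with
  | zero => simp
  | succ n ih =>
    rw [ang_succ, ang_succ, rad_succ, rad_succ, ← ih]
    have := dr_mul_sin_sub hl (φ n + ang l φ n s) (φ n + ang l φ n t)
    rw [add_sub_add_left_eq_sub] at this
    rw [← this]; ring

include hl in
lemma rad_trig_succ (n : ℕ) (t : ℝ) :
    rad l φ (n + 1) t * Real.cos (ang l φ (n + 1) t) =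
      l * (Real.cos (φ n) * (rad l φ n t * Real.cos (ang l φ n t)) -
        Real.sin (φ n) * (rad l φ n t * Real.sin (ang l φ n t))) ∧
    rad l φ (n + 1) t * Real.sin (ang l φ (n + 1) t) =
      l⁻¹ * (Real.sin (φ n) * (rad l φ n t * Real.cos (ang l φ n t)) +
        Real.cos (φ n) * (rad l φ n t * Real.sin (ang l φ n t))) := by
  obtain ⟨h1, h2⟩ := dr_mul_trig hl (φ n + ang l φ n t)
  rw [rad_succ, ang_succ]
  rw [Real.cos_add] at h1
  rw [Real.sin_add] at h2
  constructor
  · linear_combination rad l φ n t * h1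
  · linear_combination rad l φ n t * h2

include hl in
lemma rad_trig_linear (n : ℕ) (t : ℝ) :
    rad l φ n t * Real.cos (ang l φ n t) =
      Real.cos t * (rad l φ n 0 * Real.cos (ang l φ n 0)) +
      Real.sin t * (rad l φ n (π / 2) * Real.cos (ang l φ n (π / 2))) ∧
    rad l φ n t * Real.sin (ang l φ n t) =
      Real.cos t * (rad l φ n 0 * Real.sin (ang l φ n 0)) +
      Real.sin t * (rad l φ n (π / 2) * Real.sin (ang l φ n (π / 2))) := by
  induction n with
  | zero => simp
  | succ n ih =>
    obtain ⟨i1, i2⟩ := ih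
    obtain ⟨h1, h2⟩ := rad_trig_succ hl φ n t
    obtain ⟨h3, h4⟩ := rad_trig_succ hl φ n 0
    obtain ⟨h5, h6⟩ := rad_trig_succ hl φ n (π / 2)
    rw [h1, h2, h3, h4, h5, h6, i1, i2]
    constructor <;> ring

lemma ang_add_index (i n : ℕ) (t : ℝ) :
    ang l φ (i + n) t = ang l (fun k => φ (i + k)) n (ang l φ i t) := by
  induction n with
  | zero => simp
  | succ n ih => rw [← add_assoc, ang_succ, ang_succ, ih]

lemma rad_add_index (i n : ℕ) (t : ℝ) :
    rad l φ (i + n) t = rad l (fun k => φ (i + k)) n (ang l φ i t) * rad l φ i t := by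
  induction n with
  | zero => simp
  | succ n ih => rw [← add_assoc, rad_succ, rad_succ, ih, ang_add_index]; ring

variable {φ}

include hl in
lemma ang_mono {φ' : ℕ → ℝ} (n : ℕ) (h : ∀ k < n, φ k ≤ φ' k) {s t : ℝ} (hst : s ≤ t) :
    ang l φ n s ≤ ang l φ' n t := by
  induction n with
  | zero => simpa
  | succ n ih =>
    rw [ang_succ, ang_succ]
    exact (dl_strictMono hl).monotone
      (add_le_add (h n (by omega)) (ih fun k hk => h k (by omega)))

include hl in
lemma ang_lt_of_lt {φ' : ℕ → ℝ} {n : ℕ} (hn : 1 ≤ n) (h : ∀ k < n, φ k < φ' k) {s t : ℝ}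
    (hst : s ≤ t) : ang l φ n s < ang l φ' n t := by
  obtain ⟨n, rfl⟩ : ∃ m, n = m + 1 := ⟨n - 1, by omega⟩
  rw [ang_succ, ang_succ]
  exact dl_strictMono hl
    (add_lt_add_of_lt_of_le (h n (by omega))
      (ang_mono hl n (fun k hk => (h k (by omega)).le) hst))

include hl in
/-- Rotating the initial vector by `g` is dominated by adding `g` to the angle at every site. -/
lemma ang_rotate_le {φ' : ℕ → ℝ} {n : ℕ} (hn : 1 ≤ n) (t : ℝ) (g : ℝ) (h0 : φ 0 + g ≤ φ' 0)
    (h : ∀ k < n, φ k ≤ φ' k) : ang l φ n (t + g) ≤ ang l φ' n t := by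
  obtain ⟨n, rfl⟩ : ∃ m, n = 1 + m := ⟨n - 1, by omega⟩
  rw [ang_add_index, ang_add_index]
  refine ang_mono hl n (fun k hk => h _ (by omega)) ?_
  rw [ang_succ, ang_succ, ang_zero, ang_zero]
  exact (dl_strictMono hl).monotone (by linarith)

include hl in
lemma le_ang_rotate {φ' : ℕ → ℝ} {n : ℕ} (hn : 1 ≤ n) (t : ℝ) (g : ℝ) (h0 : φ' 0 ≤ φ 0 - g)
    (h : ∀ k < n, φ' k ≤ φ k) : ang l φ' n t ≤ ang l φ n (t - g) := by
  obtain ⟨n, rfl⟩ : ∃ m, n = 1 + m := ⟨n - 1, by omega⟩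
  rw [ang_add_index, ang_add_index]
  refine ang_mono hl n (fun k hk => h _ (by omega)) ?_
  rw [ang_succ, ang_succ, ang_zero, ang_zero]
  exact (dl_strictMono hl).monotone (by linarith)

lemma ang_add_pi_sites (φ : ℕ → ℝ) (n : ℕ) (t : ℝ) :
    ang l (fun k => φ k + π) n t = ang l φ n t + n * π := by
  induction n with
  | zero => simp
  | succ n ih =>
    rw [ang_succ, ang_succ, ih]
    have := dl_add_int_mul_pi l (φ n + ang l φ n t) (n + 1)
    push_cast at this ⊢
    rw [← this]
    congr 1; ring

lemma rad_le (hl1 : 1 ≤ l) (φ : ℕ → ℝ) (n : ℕ) (t : ℝ) : rad l φ n t ≤ l ^ n := by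
  induction n with
  | zero => simp
  | succ n ih =>
    rw [rad_succ, pow_succ, mul_comm (l ^ n)]
    exact mul_le_mul (dr_le hl1 _) ih (rad_pos (by linarith) φ n t).le (by linarith)

lemma ang_sub_abs_lt (φ : ℕ → ℝ) (n : ℕ) (t : ℝ) :
    |ang l φ n t - t - ∑ k ∈ Finset.range n, φ k| ≤ n * (π / 2) := by
  induction n with
  | zero => simp
  | succ n ih =>
    rw [ang_succ, Finset.sum_range_succ]
    have h := abs_le.mp (dl_sub_abs_lt l (φ n + ang l φ n t)).le
    have ih := abs_le.mp ih
    rw [abs_le]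
    push_cast
    constructor <;> linarith [h.1, h.2, ih.1, ih.2]

end

/-- A matrix-norm proxy for the `n`-step product. -/
def nr (l : ℝ) (φ : ℕ → ℝ) (n : ℕ) : ℝ := rad l φ n 0 + rad l φ n (π / 2)

section
variable {l : ℝ} (hl : 0 < l) (φ : ℕ → ℝ)

include hl in
/-- A contracted direction is separated from its neighbours. -/
lemma pi_div_two_le_ang_sub (n : ℕ) {t g : ℝ} (hg : 0 < g) (hg' : g < π / 2)
    (hr : rad l φ n t ^ 2 ≤ Real.tan g) :
    π / 2 ≤ ang l φ n (t + g) - ang l φ n (t - g) := by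
  by_contra! hcon
  have hA : 0 < ang l φ n (t + g) - ang l φ n t :=
    sub_pos.mpr (ang_strictMono hl φ n (by linarith))
  have hB : 0 < ang l φ n t - ang l φ n (t - g) :=
    sub_pos.mpr (ang_strictMono hl φ n (by linarith))
  have e1 := rad_mul_sin_sub hl φ n t (t + g)
  have e2 := rad_mul_sin_sub hl φ n (t - g) t
  have e3 := rad_mul_sin_sub hl φ n (t - g) (t + g)
  rw [show t + g - t = g by ring] at e1
  rw [show t - (t - g) = g by ring] at e2
  rw [show t + g - (t - g) = 2 * g by ring, Real.sin_two_mul] at e3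
  set A := ang l φ n (t + g) - ang l φ n t with hAd
  set B := ang l φ n t - ang l φ n (t - g) with hBd
  have hAB : ang l φ n (t + g) - ang l φ n (t - g) = A + B := by rw [hAd, hBd]; ring
  rw [hAB] at e3 hcon
  set r := rad l φ n t
  set rp := rad l φ n (t + g)
  set rm := rad l φ n (t - g)
  have hrp : 0 < rp := rad_pos hl φ n _
  have hrm : 0 < rm := rad_pos hl φ n _
  have hsA : 0 < Real.sin A := Real.sin_pos_of_pos_of_lt_pi hA (by linarith)
  have hsB : 0 < Real.sin B := Real.sin_pos_of_pos_of_lt_pi hB (by linarith)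
  have h1 : Real.sin A < Real.cos B := by
    rw [← Real.sin_pi_div_two_sub]
    exact Real.sin_lt_sin_of_lt_of_le_pi_div_two (by linarith) (by linarith) (by linarith)
  have h2 : Real.sin B < Real.cos A := by
    rw [← Real.sin_pi_div_two_sub]
    exact Real.sin_lt_sin_of_lt_of_le_pi_div_two (by linarith) (by linarith) (by linarith)
  have hsg : 0 < Real.sin g := Real.sin_pos_of_pos_of_lt_pi hg (by linarith)
  have hcg : 0 < Real.cos g := Real.cos_pos_of_mem_Ioo ⟨by linarith, hg'⟩
  have key : 2 * (Real.sin A * Real.sin B) < Real.sin (A + B) := by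
    rw [Real.sin_add]
    nlinarith [mul_lt_mul_of_pos_left h1 hsA, mul_lt_mul_of_pos_left h2 hsB,
      sq_nonneg (Real.sin A - Real.sin B)]
  have e4 : r ^ 2 * (2 * Real.sin g * Real.cos g) * (Real.sin A * Real.sin B) =
      Real.sin g ^ 2 * Real.sin (A + B) := by
    rw [← e3]
    linear_combination
      Real.sin (A + B) * (r * rm * Real.sin B) * e1 + Real.sin (A + B) * Real.sin g * e2
  rw [Real.tan_eq_sin_div_cos, le_div_iff₀ hcg] at hr
  have hp : 0 < Real.sin A * Real.sin B := mul_pos hsA hsB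
  have h5 : r ^ 2 * (2 * Real.sin g * Real.cos g) * (Real.sin A * Real.sin B) ≤
      2 * Real.sin g ^ 2 * (Real.sin A * Real.sin B) := by
    have : 0 ≤ 2 * Real.sin g * (Real.sin A * Real.sin B) := by positivity
    nlinarith
  have : 0 < Real.sin g ^ 2 := by positivity
  nlinarith

lemma sin_two_mul_mul_sin_mul_sin_le {p q g : ℝ} (hp : 0 < p) (hq : 0 < q) (hg : 0 < g)
    (hg' : g ≤ π / 4) (h : p + q ≤ π - 2 * g) :
    Real.sin (2 * g) * (Real.sin p * Real.sin q) ≤ Real.sin (p + q) := by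
  have hsp : 0 < Real.sin p := Real.sin_pos_of_pos_of_lt_pi hp (by linarith)
  have hsq : 0 < Real.sin q := Real.sin_pos_of_pos_of_lt_pi hq (by linarith)
  have hs2 : 0 ≤ Real.sin (2 * g) :=
    (Real.sin_pos_of_pos_of_lt_pi (by linarith) (by linarith [Real.pi_pos])).le
  have hp1 := Real.sin_le_one p
  have hq1 := Real.sin_le_one q
  have hprod : Real.sin p * Real.sin q ≤ 1 := by nlinarith
  by_cases hc : p + q ≤ π / 2
  · have h1 : Real.sin p ≤ Real.cos q := by
      rw [← Real.sin_pi_div_two_sub]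
      exact Real.sin_le_sin_of_le_of_le_pi_div_two (by linarith) (by linarith) (by linarith)
    have h2 : Real.sin q ≤ Real.cos p := by
      rw [← Real.sin_pi_div_two_sub]
      exact Real.sin_le_sin_of_le_of_le_pi_div_two (by linarith) (by linarith) (by linarith)
    rw [Real.sin_add]
    have := Real.sin_le_one (2 * g)
    nlinarith [mul_pos hsp hsq, sq_nonneg (Real.sin p - Real.sin q)]
  · have : Real.sin (2 * g) ≤ Real.sin (p + q) := by
      rw [← Real.sin_pi_sub (p + q)]
      exact Real.sin_le_sin_of_le_of_le_pi_div_two (by linarith) (by linarith) (by linarith)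
    nlinarith

include hl in
/-- If two neighbours at total distance at most `π - 2g` stay at distance at least `g`, then the
direction in between is not much expanded. -/
lemma rad_le_inv_sin (n : ℕ) {t t₁ t₂ g : ℝ} (hg : 0 < g) (hg' : g ≤ π / 4)
    (h1 : t < t₁) (h2 : t₂ < t) (h12 : t₁ - t₂ ≤ π - 2 * g)
    (ha1 : ang l φ n t + g ≤ ang l φ n t₁) (ha2 : ang l φ n t₂ ≤ ang l φ n t - g) :
    rad l φ n t ≤ 1 / Real.sin g := by
  have e1 := rad_mul_sin_sub hl φ n t t₁
  have e2 := rad_mul_sin_sub hl φ n t₂ t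
  have e3 := rad_mul_sin_sub hl φ n t₂ t₁
  have hlt : ang l φ n t₁ < ang l φ n t₂ + π := by
    rw [← ang_add_pi]; exact ang_strictMono hl φ n (by linarith)
  set A := ang l φ n t₁ - ang l φ n t with hAd
  set B := ang l φ n t - ang l φ n t₂ with hBd
  have hAB : ang l φ n t₁ - ang l φ n t₂ = A + B := by rw [hAd, hBd]; ring
  rw [hAB] at e3
  obtain ⟨p, rfl⟩ : ∃ p, t₁ = t + p := ⟨t₁ - t, by ring⟩
  obtain ⟨q, rfl⟩ : ∃ q, t₂ = t - q := ⟨t - t₂, by ring⟩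
  rw [show t + p - t = p by ring] at e1
  rw [show t - (t - q) = q by ring] at e2
  rw [show t + p - (t - q) = p + q by ring] at e3
  have hp : 0 < p := by linarith
  have hq : 0 < q := by linarith
  have hR : 0 < rad l φ n t := rad_pos hl φ n t
  have hRp : 0 < rad l φ n (t + p) := rad_pos hl φ n _
  have hRq : 0 < rad l φ n (t - q) := rad_pos hl φ n _
  set R := rad l φ n t
  set rp := rad l φ n (t + p)
  set rm := rad l φ n (t - q)
  have hA : g ≤ A := by rw [hAd]; linarith
  have hB : g ≤ B := by rw [hBd]; linarith
  have hABl : A + B < π := by rw [hAd, hBd]; linarith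
  have hsA : 0 < Real.sin A := Real.sin_pos_of_pos_of_lt_pi (by linarith) (by linarith)
  have hsB : 0 < Real.sin B := Real.sin_pos_of_pos_of_lt_pi (by linarith) (by linarith)
  have hsp : 0 < Real.sin p := Real.sin_pos_of_pos_of_lt_pi hp (by linarith)
  have hsq : 0 < Real.sin q := Real.sin_pos_of_pos_of_lt_pi hq (by linarith)
  have hsg : 0 < Real.sin g := Real.sin_pos_of_pos_of_lt_pi hg (by linarith [Real.pi_pos])
  have hcg : 0 < Real.cos g := Real.cos_pos_of_mem_Ioo ⟨by linarith, by linarith [Real.pi_pos]⟩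
  have hBg : 0 ≤ Real.sin (B - g) :=
    Real.sin_nonneg_of_nonneg_of_le_pi (by linarith) (by linarith)
  have hAg : 0 ≤ Real.sin (A - g) :=
    Real.sin_nonneg_of_nonneg_of_le_pi (by linarith) (by linarith)
  rw [Real.sin_sub] at hBg hAg
  have e4 : R ^ 2 * Real.sin (p + q) * (Real.sin A * Real.sin B) =
      Real.sin p * Real.sin q * Real.sin (A + B) := by
    rw [← e3]
    linear_combination
      Real.sin (A + B) * (rm * R * Real.sin B) * e1 + Real.sin (A + B) * Real.sin p * e2
  have h6 : Real.sin (A + B) * Real.sin g ≤ 2 * Real.cos g * (Real.sin A * Real.sin B) := by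
    rw [Real.sin_add]
    nlinarith
  have h7 : R ^ 2 * Real.sin (p + q) * Real.sin g ≤
      2 * Real.cos g * (Real.sin p * Real.sin q) := by
    have hpos : 0 < Real.sin A * Real.sin B := mul_pos hsA hsB
    have hpq : 0 < Real.sin p * Real.sin q := mul_pos hsp hsq
    refine le_of_mul_le_mul_right ?_ hpos
    calc R ^ 2 * Real.sin (p + q) * Real.sin g * (Real.sin A * Real.sin B)
        = Real.sin p * Real.sin q * (Real.sin (A + B) * Real.sin g) := by
          linear_combination Real.sin g * e4
      _ ≤ Real.sin p * Real.sin q * (2 * Real.cos g * (Real.sin A * Real.sin B)) := by gcongr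
      _ = _ := by ring
  have h8 := sin_two_mul_mul_sin_mul_sin_le hp hq hg hg' (by linarith)
  rw [Real.sin_two_mul] at h8
  have hpq : 0 < Real.sin p * Real.sin q := mul_pos hsp hsq
  have h9 : R ^ 2 * Real.sin g ^ 2 ≤ 1 := by
    have hpos : 0 < 2 * Real.cos g * (Real.sin p * Real.sin q) := by positivity
    refine le_of_mul_le_mul_right ?_ hpos
    calc R ^ 2 * Real.sin g ^ 2 * (2 * Real.cos g * (Real.sin p * Real.sin q))
        = R ^ 2 * Real.sin g * (2 * Real.sin g * Real.cos g * (Real.sin p * Real.sin q)) := by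
          ring
      _ ≤ R ^ 2 * Real.sin g * Real.sin (p + q) := by gcongr
      _ ≤ 1 * (2 * Real.cos g * (Real.sin p * Real.sin q)) := by linarith
  rw [le_div_iff₀ hsg]
  rw [← mul_pow] at h9
  exact (pow_le_one_iff_of_nonneg (by positivity) (by norm_num)).mp h9

include hl in
lemma rad_add_le (n : ℕ) (t h : ℝ) :
    rad l φ n (t + h) ≤ rad l φ n t + rad l φ n (t + π / 2) := by
  obtain ⟨a1, a2⟩ := rad_trig_linear hl φ n t
  obtain ⟨b1, b2⟩ := rad_trig_linear hl φ n (t + π / 2)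
  obtain ⟨c1, c2⟩ := rad_trig_linear hl φ n (t + h)
  rw [Real.cos_add_pi_div_two, Real.sin_add_pi_div_two] at b1 b2
  rw [Real.cos_add, Real.sin_add] at c1 c2
  have k1 : rad l φ n (t + h) * Real.cos (ang l φ n (t + h)) =
      Real.cos h * (rad l φ n t * Real.cos (ang l φ n t)) +
      Real.sin h * (rad l φ n (t + π / 2) * Real.cos (ang l φ n (t + π / 2))) := by
    rw [a1, b1, c1]; ring
  have k2 : rad l φ n (t + h) * Real.sin (ang l φ n (t + h)) =
      Real.cos h * (rad l φ n t * Real.sin (ang l φ n t)) +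
      Real.sin h * (rad l φ n (t + π / 2) * Real.sin (ang l φ n (t + π / 2))) := by
    rw [a2, b2, c2]; ring
  set T := ang l φ n (t + h)
  have hr1 : 0 < rad l φ n t := rad_pos hl φ n t
  have hr2 : 0 < rad l φ n (t + π / 2) := rad_pos hl φ n _
  have k3 : rad l φ n (t + h) =
      (Real.cos h * Real.cos (ang l φ n t - T)) * rad l φ n t +
      (Real.sin h * Real.cos (ang l φ n (t + π / 2) - T)) * rad l φ n (t + π / 2) := by
    rw [Real.cos_sub, Real.cos_sub]
    linear_combination Real.cos T * k1 + Real.sin T * k2 -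
      rad l φ n (t + h) * Real.sin_sq_add_cos_sq T
  have hb : ∀ x y : ℝ, |x| ≤ 1 → |y| ≤ 1 → x * y ≤ 1 := fun x y hx hy =>
    (le_abs_self _).trans (by rw [abs_mul]; exact mul_le_one₀ hx (abs_nonneg _) hy)
  have m1 := hb _ _ (Real.abs_cos_le_one h) (Real.abs_cos_le_one (ang l φ n t - T))
  have m2 := hb _ _ (Real.abs_sin_le_one h) (Real.abs_cos_le_one (ang l φ n (t + π / 2) - T))
  rw [k3]
  nlinarith

include hl in
lemma rad_le_nr (n : ℕ) (t : ℝ) : rad l φ n t ≤ nr l φ n := by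
  have := rad_add_le hl φ n 0 t
  simpa [nr] using this

include hl in
lemma nr_le (n : ℕ) (t : ℝ) : nr l φ n ≤ 2 * (rad l φ n t + rad l φ n (t + π / 2)) := by
  have h1 := rad_add_le hl φ n t (0 - t)
  have h2 := rad_add_le hl φ n t (π / 2 - t)
  rw [add_sub_cancel] at h1 h2
  unfold nr
  linarith

include hl in
lemma two_le_nr (n : ℕ) : 2 ≤ nr l φ n := by
  have h := rad_mul_sin_sub hl φ n 0 (π / 2)
  simp only [sub_zero, Real.sin_pi_div_two] at h
  have h1 := rad_pos hl φ n 0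
  have h2 := rad_pos hl φ n (π / 2)
  have h3 := Real.sin_le_one (ang l φ n (π / 2) - ang l φ n 0)
  unfold nr
  have : 1 ≤ rad l φ n 0 * rad l φ n (π / 2) := by
    have := mul_pos h1 h2
    nlinarith
  nlinarith [sq_nonneg (rad l φ n 0 - rad l φ n (π / 2))]

include hl in
lemma nr_add_le (i n : ℕ) :
    nr l φ (i + n) ≤ nr l (fun k => φ (i + k)) n * nr l φ i := by
  have h1 := rad_le_nr hl (fun k => φ (i + k)) n (ang l φ i 0)
  have h2 := rad_le_nr hl (fun k => φ (i + k)) n (ang l φ i (π / 2))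
  have h3 := rad_pos hl φ i 0
  have h4 := rad_pos hl φ i (π / 2)
  have h5 : nr l φ i = rad l φ i 0 + rad l φ i (π / 2) := rfl
  rw [nr, rad_add_index, rad_add_index, h5]
  nlinarith

lemma nr_le_two_mul_pow (hl1 : 1 ≤ l) (n : ℕ) : nr l φ n ≤ 2 * l ^ n := by
  have h1 := rad_le hl1 φ n 0
  have h2 := rad_le hl1 φ n (π / 2)
  unfold nr; linarith

/-- If a direction is never much contracted along a block and not much expanded at its end, then
the whole block is bounded. -/
lemma nr_le_of_rad (hl1 : 1 ≤ l) (N : ℕ) {t c C : ℝ} (hc : 0 < c)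
    (h : ∀ k ≤ N, c ≤ rad l φ k t) (hC : rad l φ N t ≤ C) :
    nr l φ N ≤ 2 * (C + (C * (N * l ^ 2 / c ^ 2) + 1 / c)) := by
  have hl : 0 < l := by linarith
  set Δ : ℕ → ℝ := fun n => ang l φ n (t + π / 2) - ang l φ n t with hΔ
  set w : ℕ → ℝ := fun n => rad l φ n (t + π / 2) * Real.cos (Δ n) / rad l φ n t with hw
  have hdet : ∀ n, rad l φ n t * rad l φ n (t + π / 2) * Real.sin (Δ n) = 1 := by
    intro n
    have := rad_mul_sin_sub hl φ n t (t + π / 2)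
    rw [add_sub_cancel_left, Real.sin_pi_div_two] at this
    exact this
  have hstep : ∀ n, w (n + 1) = w n + ((l⁻¹) ^ 2 - l ^ 2) *
      (Real.sin (φ n + ang l φ n t) * Real.cos (φ n + ang l φ n t)) / rad l φ (n + 1) t ^ 2 := by
    intro n
    have hd := hdet n
    have hr := rad_pos hl φ n t
    have hr2 := rad_pos hl φ n (t + π / 2)
    have hda := dr_pos hl (φ n + ang l φ n t)
    have hdb := dr_pos hl (φ n + ang l φ n (t + π / 2))
    have e1 := dr_mul_trig hl (φ n + ang l φ n t)
    have e2 := dr_mul_trig hl (φ n + ang l φ n (t + π / 2))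
    have e3 := dr_sq (l := l) (φ n + ang l φ n t)
    have eb : φ n + ang l φ n (t + π / 2) = (φ n + ang l φ n t) + Δ n := by
      simp only [hΔ]; ring
    have hcos : dr l (φ n + ang l φ n t) * dr l (φ n + ang l φ n (t + π / 2)) *
        Real.cos (Δ (n + 1)) = dr l (φ n + ang l φ n t) ^ 2 * Real.cos (Δ n) +
        ((l⁻¹) ^ 2 - l ^ 2) * (Real.sin (φ n + ang l φ n t) * Real.cos (φ n + ang l φ n t)) *
          Real.sin (Δ n) := by
      have : Δ (n + 1) = dl l (φ n + ang l φ n (t + π / 2)) - dl l (φ n + ang l φ n t) := by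
        simp only [hΔ, ang_succ]
      rw [this, Real.cos_sub]
      calc _ = (dr l (φ n + ang l φ n (t + π / 2)) *
              Real.cos (dl l (φ n + ang l φ n (t + π / 2)))) *
            (dr l (φ n + ang l φ n t) * Real.cos (dl l (φ n + ang l φ n t))) +
            (dr l (φ n + ang l φ n (t + π / 2)) *
              Real.sin (dl l (φ n + ang l φ n (t + π / 2)))) *
            (dr l (φ n + ang l φ n t) * Real.sin (dl l (φ n + ang l φ n t))) := by ring
        _ = _ := by
          rw [e1.1, e1.2, e2.1, e2.2, e3, eb]
          generalize φ n + ang l φ n t = x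
          rw [Real.cos_add, Real.sin_add]
          ring
    simp only [hw, rad_succ]
    set a := dr l (φ n + ang l φ n t)
    set b := dr l (φ n + ang l φ n (t + π / 2))
    set r := rad l φ n t
    set s := rad l φ n (t + π / 2)
    set E := ((l⁻¹) ^ 2 - l ^ 2) * (Real.sin (φ n + ang l φ n t) * Real.cos (φ n + ang l φ n t))
    rw [div_add_div _ _ hr.ne' (by positivity), div_eq_div_iff (by positivity) (by positivity)]
    linear_combination s * r ^ 3 * a * hcos + E * r ^ 2 * a * hd
  have hw0 : w 0 = 0 := by simp [hw, hΔ]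
  have hwb : ∀ n ≤ N, |w n| ≤ n * (l ^ 2 / c ^ 2) := by
    intro n
    induction n with
    | zero => intro _; simp [hw0]
    | succ n ih =>
      intro hn
      have hr := h (n + 1) hn
      rw [hstep]
      refine (abs_add_le _ _).trans ?_
      push_cast
      rw [add_mul, one_mul]
      refine add_le_add (ih (by omega)) ?_
      rw [abs_div, abs_of_nonneg (sq_nonneg (rad l φ (n + 1) t))]
      have hli : (l⁻¹) ^ 2 ≤ l ^ 2 := by
        have hi : l⁻¹ ≤ l := (inv_le_one_of_one_le₀ hl1).trans hl1
        gcongr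
      refine div_le_div₀ (by positivity) ?_ (by positivity) (by gcongr)
      rw [abs_mul, abs_mul]
      have h1 : |(l⁻¹) ^ 2 - l ^ 2| ≤ l ^ 2 := by
        rw [abs_le]; constructor <;> nlinarith [sq_nonneg (l⁻¹), sq_nonneg l]
      have h2 := mul_le_one₀ (Real.abs_sin_le_one (φ n + ang l φ n t)) (abs_nonneg _)
        (Real.abs_cos_le_one (φ n + ang l φ n t))
      calc _ ≤ l ^ 2 * 1 := by gcongr
        _ = _ := by ring
  have hr := rad_pos hl φ N t
  have hs := rad_pos hl φ N (t + π / 2)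
  have hcr := h N le_rfl
  have hfin : rad l φ N (t + π / 2) ≤ C * (N * l ^ 2 / c ^ 2) + 1 / c := by
    have hwN := hwb N le_rfl
    have hd := hdet N
    have h1 : rad l φ N (t + π / 2) * |Real.cos (Δ N)| = rad l φ N t * |w N| := by
      simp only [hw, abs_div, abs_mul, abs_of_pos hr, abs_of_pos hs]
      field_simp
    have h2 : rad l φ N (t + π / 2) * |Real.sin (Δ N)| = 1 / rad l φ N t := by
      have : |Real.sin (Δ N)| * (rad l φ N t * rad l φ N (t + π / 2)) = 1 := by
        rw [← abs_of_pos (mul_pos hr hs), ← abs_mul, mul_comm, hd, abs_one]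
      rw [eq_div_iff hr.ne']; linarith
    have h3 : (1 : ℝ) ≤ |Real.cos (Δ N)| + |Real.sin (Δ N)| := by
      have hc1 := Real.abs_cos_le_one (Δ N)
      have hs1 := Real.abs_sin_le_one (Δ N)
      have := Real.sin_sq_add_cos_sq (Δ N)
      rw [← sq_abs (Real.sin _), ← sq_abs (Real.cos _)] at this
      nlinarith [abs_nonneg (Real.cos (Δ N)), abs_nonneg (Real.sin (Δ N))]
    have h4 : rad l φ N (t + π / 2) ≤ rad l φ N t * |w N| + 1 / rad l φ N t := by
      rw [← h1, ← h2]; nlinarith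
    refine h4.trans (add_le_add ?_ (one_div_le_one_div_of_le hc hcr))
    calc rad l φ N t * |w N| ≤ C * (N * (l ^ 2 / c ^ 2)) :=
          mul_le_mul hC hwN (abs_nonneg _) (hr.le.trans hC)
      _ = _ := by ring
  refine (nr_le hl φ N t).trans ?_
  linarith

end

lemma exists_orbit_near {α : ℝ} {p : ℤ} {q : ℕ} (hq : 0 < q) (hpq : IsCoprime p (q : ℤ))
    (h : |α - p / q| ≤ 1 / (q : ℝ) ^ 2) (x y : ℝ) :
    ∃ i : ℕ, i < q ∧ ∃ j : ℤ, |x + i * α + j - y| ≤ 2 / q := by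
  have hq' : (0 : ℝ) < q := by exact_mod_cast hq
  set r : ℤ := ⌊(y - x) * q⌋ with hr
  obtain ⟨u, v, huv⟩ := hpq
  set i : ℤ := (r * u) % q with hi
  have hi0 : 0 ≤ i := Int.emod_nonneg _ (by positivity)
  have hiq : i < q := Int.emod_lt_of_pos _ (by exact_mod_cast hq)
  have hdiv : (q : ℤ) ∣ i * p - r := by
    have h1 : (q : ℤ) ∣ r * u - i := by
      rw [hi]; exact Int.dvd_self_sub_emod
    have h2 : i * p - r = -(r * u - i) * p - r * v * q := by
      linear_combination r * huv
    rw [h2]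
    exact dvd_sub (Dvd.dvd.mul_right (h1.neg_right) _) (dvd_mul_left _ _)
  obtain ⟨w, hw⟩ := hdiv
  refine ⟨i.toNat, by omega, -w, ?_⟩
  have hcast : ((i.toNat : ℕ) : ℝ) = (i : ℝ) := by
    rw [← Int.cast_natCast, Int.toNat_of_nonneg hi0]
  have hwR : (i : ℝ) * p - r = q * w := by exact_mod_cast hw
  have hi0' : (0 : ℝ) ≤ i := by exact_mod_cast hi0
  have hiq' : (i : ℝ) ≤ q := by exact_mod_cast hiq.le
  have e : x + i.toNat * α + ((-w : ℤ) : ℝ) - y =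
      i * (α - p / q) + (r / q - (y - x)) := by
    rw [hcast]; push_cast
    field_simp
    linear_combination hwR
  rw [e]
  have b1 : |(i : ℝ) * (α - p / q)| ≤ 1 / q := by
    rw [abs_mul, abs_of_nonneg hi0']
    calc (i : ℝ) * |α - p / q| ≤ q * (1 / (q : ℝ) ^ 2) := by gcongr
      _ = 1 / q := by field_simp
  have b2 : |(r : ℝ) / q - (y - x)| ≤ 1 / q := by
    have f1 := Int.floor_le ((y - x) * q)
    have f2 := Int.lt_floor_add_one ((y - x) * q)
    rw [← hr] at f1 f2
    have : (r : ℝ) / q - (y - x) = (r - (y - x) * q) / q := by field_simp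
    rw [this, abs_div, abs_of_pos hq']
    gcongr
    rw [abs_le]; constructor <;> linarith
  exact (abs_add_le _ _).trans ((add_le_add b1 b2).trans (le_of_eq (by ring)))

/-- Forward orbits of the rotation by `α` are dense in the circle. -/
def FwdDense (α : ℝ) : Prop :=
  ∀ ε > 0, ∀ x y : ℝ, ∃ i : ℕ, ∃ j : ℤ, |x + i * α + j - y| < ε

lemma FwdDense.forall_of_isClosed {α : ℝ} (hα : FwdDense α) {P : ℝ → Prop}
    (hc : IsClosed {x | P x}) (hstep : ∀ x, P x → P (x + α)) (hint : ∀ x (j : ℤ), P x → P (x + j))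
    {x₀ : ℝ} (h0 : P x₀) (y : ℝ) : P y := by
  have hit : ∀ i : ℕ, P (x₀ + i * α) := by
    intro i
    induction i with
    | zero => simpa
    | succ i ih =>
      have := hstep _ ih
      push_cast
      rwa [add_mul, one_mul, ← add_assoc]
  have : y ∈ closure {x | P x} := by
    rw [Metric.mem_closure_iff]
    intro ε hε
    obtain ⟨i, j, hij⟩ := hα ε hε x₀ y
    refine ⟨x₀ + i * α + j, hint _ _ (hit i), ?_⟩
    rw [dist_comm, Real.dist_eq]
    exact hij
  rwa [hc.closure_eq] at this

lemma periodic_add_int {β : Type*} {f : ℝ → β} (hf : Function.Periodic f 1) (x : ℝ) (j : ℤ) :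
    f (x + j) = f x := by
  have := hf.int_mul j x
  simpa using this

lemma exists_pos_le_of_periodic {f : ℝ → ℝ} (hf : Continuous f) (hp : Function.Periodic f 1)
    (hpos : ∀ x, 0 < f x) : ∃ ε > 0, ∀ x, ε ≤ f x := by
  obtain ⟨x₀, -, hx₀⟩ := isCompact_Icc.exists_isMinOn
    (Set.nonempty_Icc.mpr (zero_le_one (α := ℝ))) hf.continuousOn
  refine ⟨f x₀, hpos _, fun x => ?_⟩
  obtain ⟨y, hy, hxy⟩ := hp.exists_mem_Ico₀ one_pos x
  rw [hxy]
  exact hx₀ ⟨hy.1, hy.2.le⟩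

lemma exists_abs_le_of_periodic {f : ℝ → ℝ} (hf : Continuous f) (hp : Function.Periodic f 1) :
    ∃ C, ∀ x, |f x| ≤ C := by
  obtain ⟨x₀, -, hx₀⟩ := isCompact_Icc.exists_isMaxOn
    (Set.nonempty_Icc.mpr (zero_le_one (α := ℝ))) hf.abs.continuousOn
  refine ⟨|f x₀|, fun x => ?_⟩
  obtain ⟨y, hy, hxy⟩ := hp.exists_mem_Ico₀ one_pos x
  rw [hxy]
  exact hx₀ ⟨hy.1, hy.2.le⟩

/-- The angles of the rotations along the orbit of `x`. -/
def site (α : ℝ) (φ : ℝ → ℝ) (x : ℝ) (k : ℕ) : ℝ := φ (x + k * α)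

/-- `S` is a lift of an invariant direction, of homotopy class `(m, k)`, all other directions being
attracted to each other. -/
structure Sec (l α : ℝ) (φ : ℝ → ℝ) (m k : ℤ) (S : ℝ → ℝ) : Prop where
  cont : Continuous S
  per : ∀ x, S (x + 1) = S x + m * π
  inv : ∀ x, dl l (φ x + S x) = S (x + α) + k * π
  conv : ∀ x a b, S x < a → a < S x + π → S x < b → b < S x + π →
    Filter.Tendsto (fun n => ang l (site α φ x) n a - ang l (site α φ x) n b)
      Filter.atTop (nhds 0)

namespace Sec
variable {l α : ℝ} {φ : ℝ → ℝ} {m k : ℤ} {S : ℝ → ℝ}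

lemma ang_eq (h : Sec l α φ m k S) (x : ℝ) (n : ℕ) :
    ang l (site α φ x) n (S x) = S (x + n * α) + n * k * π := by
  induction n with
  | zero => simp
  | succ n ih =>
    rw [ang_succ, ih, site, ← add_assoc]
    have e := dl_add_int_mul_pi l (φ (x + n * α) + S (x + n * α)) (n * k)
    push_cast at e ⊢
    rw [e, h.inv]
    rw [show x + (n + 1) * α = x + n * α + α by ring]
    ring

lemma shift (h : Sec l α φ m k S) (j : ℤ) : Sec l α φ m k (fun x => S x + j * π) where
  cont := h.cont.add continuous_const
  per x := by rw [h.per]; ring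
  inv x := by rw [← add_assoc, dl_add_int_mul_pi, h.inv]; ring
  conv x a b h1 h2 h3 h4 := by
    have := h.conv x (a + (-j : ℤ) * π) (b + (-j : ℤ) * π)
      (by push_cast; linarith) (by push_cast; linarith) (by push_cast; linarith)
      (by push_cast; linarith)
    simp only [ang_add_int_mul_pi] at this
    simpa only [add_sub_add_right_eq_sub] using this

lemma site_add (x h : ℝ) : site α (fun y => φ (y + h)) x = site α φ (x + h) := by
  funext k; simp only [site]; congr 1; ring

lemma translate (h : Sec l α φ m k S) (c : ℝ) :
    Sec l α (fun x => φ (x + c)) m k (fun x => S (x + c)) where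
  cont := h.cont.comp (continuous_id.add continuous_const)
  per x := by rw [show x + 1 + c = x + c + 1 by ring, h.per]
  inv x := by rw [h.inv, show x + α + c = x + c + α by ring]
  conv x a b h1 h2 h3 h4 := by
    rw [site_add]; exact h.conv (x + c) a b h1 h2 h3 h4

lemma bdd (h : Sec l α φ m k S) : ∃ C, ∀ x, |S x - m * π * x| ≤ C := by
  refine exists_abs_le_of_periodic (h.cont.sub (by fun_prop)) fun x => ?_
  rw [h.per]; ring

variable {φ₁ φ₂ : ℝ → ℝ} {S₁ S₂ : ℝ → ℝ}

lemma exists_band (hl : 0 < l) (hα : FwdDense α) (h1 : Sec l α φ₁ m k S₁)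
    (h2 : Sec l α φ₂ m k S₂) (hlt : ∀ x, φ₁ x < φ₂ x) :
    ∃ j : ℤ, ∀ x, j * π < S₂ x - S₁ x ∧ S₂ x - S₁ x < (j + 1) * π := by
  have key : ∀ (j : ℤ) x, j * π ≤ S₂ x - S₁ x → j * π < S₂ (x + α) - S₁ (x + α) := by
    intro j x hx
    have e1 := h1.inv x
    have e2 := h2.inv x
    have : dl l (φ₁ x + S₁ x + j * π) < dl l (φ₂ x + S₂ x) :=
      dl_strictMono hl (by linarith [hlt x])
    rw [dl_add_int_mul_pi] at this
    linarith
  have hall : ∀ (j : ℤ) x₀, j * π ≤ S₂ x₀ - S₁ x₀ → ∀ x, j * π < S₂ x - S₁ x := by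
    intro j x₀ h0 x
    have := hα.forall_of_isClosed (P := fun x => j * π ≤ S₂ x - S₁ x)
      (isClosed_le continuous_const (h2.cont.sub h1.cont)) (fun x hx => (key j x hx).le)
      (fun x i hx => by
        have hp : Function.Periodic (fun x => S₂ x - S₁ x) 1 := fun x => by
          simp only; rw [h1.per, h2.per]; ring
        have := periodic_add_int hp x i
        rw [this]; exact hx) h0 (x - α)
    have := key j _ this
    rwa [sub_add_cancel] at this
  refine ⟨⌊(S₂ 0 - S₁ 0) / π⌋, fun x => ?_⟩
  have hf1 := Int.floor_le ((S₂ 0 - S₁ 0) / π)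
  have hf2 := Int.lt_floor_add_one ((S₂ 0 - S₁ 0) / π)
  set j := ⌊(S₂ 0 - S₁ 0) / π⌋
  rw [le_div_iff₀ Real.pi_pos] at hf1
  rw [div_lt_iff₀ Real.pi_pos] at hf2
  refine ⟨hall j 0 hf1 x, ?_⟩
  by_contra! hcon
  have := hall (j + 1) x (by push_cast; exact hcon) 0
  push_cast at this
  linarith

lemma exists_above (hl : 0 < l) (hα : FwdDense α) (h1 : Sec l α φ₁ m k S₁)
    (h : Sec l α φ m k S) (hlt : ∀ x, φ₁ x < φ x) :
    ∃ S₁', Sec l α φ₁ m k S₁' ∧ ∀ x, S x < S₁' x ∧ S₁' x < S x + π := by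
  obtain ⟨j, hj⟩ := exists_band hl hα h1 h hlt
  refine ⟨_, h1.shift (j + 1), fun x => ?_⟩
  have := hj x
  push_cast
  constructor <;> linarith

lemma exists_below (hl : 0 < l) (hα : FwdDense α) (h : Sec l α φ m k S)
    (h2 : Sec l α φ₂ m k S₂) (hlt : ∀ x, φ x < φ₂ x) :
    ∃ S₂', Sec l α φ₂ m k S₂' ∧ ∀ x, S₂' x < S x ∧ S x < S₂' x + π := by
  obtain ⟨j, hj⟩ := exists_band hl hα h h2 hlt
  refine ⟨_, h2.shift (-(j + 1)), fun x => ?_⟩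
  have := hj x
  push_cast
  constructor <;> linarith

lemma site_add_lt (hl : 0 < l) (h1 : Sec l α φ₁ m k S₁) (h2 : Sec l α φ₂ m k S₂)
    (h : ∀ x, S₂ x < S₁ x) (x : ℝ) : φ₂ x + S₂ x < φ₁ x + S₁ x := by
  have := h (x + α)
  rw [← (dl_strictMono hl).lt_iff_lt, h1.inv, h2.inv]
  linarith

lemma sub_lt_pi (hl : 0 < l) (hα : FwdDense α) (h1 : Sec l α φ₁ m k S₁)
    (h : Sec l α φ m k S) (h2 : Sec l α φ₂ m k S₂) (hlt1 : ∀ x, φ₁ x < φ x)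
    (hlt2 : ∀ x, φ x < φ₂ x) (hS1 : ∀ x, S x < S₁ x ∧ S₁ x < S x + π)
    (hS2 : ∀ x, S₂ x < S x ∧ S x < S₂ x + π) (x : ℝ) : S₁ x - S₂ x < π := by
  obtain ⟨j, hj⟩ := exists_band hl hα h1 h2 fun x => (hlt1 x).trans (hlt2 x)
  by_cases hj1 : -1 ≤ j
  · have : (-1 : ℝ) ≤ j := by exact_mod_cast hj1
    have := hj x
    nlinarith [Real.pi_pos]
  exfalso
  have hj2 : (j : ℝ) + 1 ≤ -1 := by exact_mod_cast (by omega : j + 1 ≤ -1)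
  obtain ⟨ε, hε, hεx⟩ := exists_pos_le_of_periodic (f := fun x => S₁ x - S₂ x - π)
    (by have := h1.cont; have := h2.cont; fun_prop)
    (fun x => by simp only; rw [h1.per, h2.per]; ring)
    (fun x => by have := (hj x).2; nlinarith [Real.pi_pos])
  have hc := h.conv 0 (S₁ 0) (S₂ 0 + π) (hS1 0).1 (hS1 0).2 (by linarith [(hS2 0).2])
    (by linarith [(hS2 0).1])
  have hge : ∀ n : ℕ, ε ≤ ang l (site α φ 0) n (S₁ 0) - ang l (site α φ 0) n (S₂ 0 + π) := by
    intro n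
    have a1 := ang_mono hl (φ := site α φ₁ 0) (φ' := site α φ 0) n
      (fun k _ => (hlt1 _).le) (le_refl (S₁ 0))
    have a2 := ang_mono hl (φ := site α φ 0) (φ' := site α φ₂ 0) n
      (fun k _ => (hlt2 _).le) (le_refl (S₂ 0 + π))
    rw [h1.ang_eq] at a1
    rw [ang_add_pi (φ := site α φ₂ 0), h2.ang_eq] at a2
    have := hεx (0 + n * α)
    linarith
  have := ge_of_tendsto' hc hge
  linarith

/-- Interior sections have uniformly bounded expansion. -/
lemma rad_le (hl : 0 < l) (hα : FwdDense α) {g : ℝ} (hg : 0 < g) (hg' : g ≤ π / 4)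
    (h1 : Sec l α φ₁ m k S₁) (h : Sec l α φ m k S) (h2 : Sec l α φ₂ m k S₂)
    (hlt1 : ∀ x, φ₁ x ≤ φ x - g) (hlt2 : ∀ x, φ x + g ≤ φ₂ x) (y : ℝ) {n : ℕ} (hn : 1 ≤ n) :
    rad l (site α φ y) n (S y) ≤ 1 / Real.sin g := by
  have l1 : ∀ x, φ₁ x < φ x := fun x => by linarith [hlt1 x]
  have l2 : ∀ x, φ x < φ₂ x := fun x => by linarith [hlt2 x]
  obtain ⟨S₁', h1', hS1⟩ := exists_above hl hα h1 h l1
  obtain ⟨S₂', h2', hS2⟩ := exists_below hl hα h h2 l2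
  have h12 := sub_lt_pi hl hα h1' h h2' l1 l2 hS1 hS2
  have d1 : ∀ x, S x + g < S₁' x := fun x => by
    have := site_add_lt hl h1' h (fun x => (hS1 x).1) x
    linarith [hlt1 x]
  have d2 : ∀ x, S₂' x < S x - g := fun x => by
    have := site_add_lt hl h h2' (fun x => (hS2 x).1) x
    linarith [hlt2 x]
  refine rad_le_inv_sin hl (site α φ y) n (t₁ := S₁' y - g) (t₂ := S₂' y + g) hg hg'
    (by linarith [d1 y]) (by linarith [d2 y]) (by linarith [h12 y]) ?_ ?_
  · have := le_ang_rotate hl (φ := site α φ y) (φ' := site α φ₁ y) hn (S₁' y) g (hlt1 _)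
      (fun k _ => (l1 _).le)
    rw [h1'.ang_eq] at this
    rw [h.ang_eq]
    linarith [d1 (y + n * α)]
  · have := ang_rotate_le hl (φ := site α φ y) (φ' := site α φ₂ y) hn (S₂' y) g (hlt2 _)
      (fun k _ => (l2 _).le)
    rw [h2'.ang_eq] at this
    rw [h.ang_eq]
    linarith [d2 (y + n * α)]

/-- The quantity `m α + k` is monotone in the angle function. -/
lemma class_le (hl : 0 < l) {m' k' : ℤ} (h1 : Sec l α φ₁ m k S₁) (h2 : Sec l α φ₂ m' k' S₂)
    (hle : ∀ x, φ₁ x ≤ φ₂ x) : m * α + k ≤ m' * α + k' := by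
  obtain ⟨C₁, hC₁⟩ := h1.bdd
  obtain ⟨C₂, hC₂⟩ := h2.bdd
  obtain ⟨j, hj⟩ : ∃ j : ℕ, S₁ 0 - S₂ 0 ≤ j * π := by
    obtain ⟨j, hj⟩ := exists_nat_ge ((S₁ 0 - S₂ 0) / π)
    exact ⟨j, by rwa [div_le_iff₀ Real.pi_pos] at hj⟩
  by_contra! hcon
  have hb : ∀ n : ℕ, n * (((m * α + k) - (m' * α + k')) * π) ≤ C₁ + C₂ + j * π := by
    intro n
    have a := ang_mono hl (φ := site α φ₁ 0) (φ' := site α φ₂ 0) n (fun k _ => hle _)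
      (show S₁ 0 ≤ S₂ 0 + (j : ℤ) * π by push_cast; linarith)
    rw [ang_add_int_mul_pi, h1.ang_eq, h2.ang_eq] at a
    have b1 := abs_le.mp (hC₁ (0 + n * α))
    have b2 := abs_le.mp (hC₂ (0 + n * α))
    push_cast at a
    linarith [b1.1, b2.2]
  have hpos : 0 < ((m * α + k) - (m' * α + k')) * π := mul_pos (by linarith) Real.pi_pos
  obtain ⟨n, hn⟩ := exists_nat_gt ((C₁ + C₂ + j * π) / (((m * α + k) - (m' * α + k')) * π))
  rw [div_lt_iff₀ hpos] at hn
  linarith [hb n]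

lemma class_abs_le (h : Sec l α φ m k S) {C : ℝ} (hC : ∀ x, |φ x| ≤ C) :
    |m * α + k| ≤ 1 / 2 + C / π := by
  obtain ⟨C₁, hC₁⟩ := h.bdd
  have hb : ∀ n : ℕ, n * (|m * α + k| * π - π / 2 - C) ≤ C₁ + |S 0| := by
    intro n
    have a := ang_sub_abs_lt (l := l) (site α φ 0) n (S 0)
    rw [h.ang_eq] at a
    have b1 := hC₁ (0 + n * α)
    have c1 : |∑ k ∈ Finset.range n, site α φ 0 k| ≤ n * C := by
      refine (Finset.abs_sum_le_sum_abs _ _).trans ?_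
      calc _ ≤ ∑ k ∈ Finset.range n, C := Finset.sum_le_sum fun i _ => hC _
        _ = _ := by simp
    have e : (n : ℝ) * (|m * α + k| * π) = |n * (m * α + k) * π| := by
      rw [abs_mul, abs_mul, Nat.abs_cast, abs_of_pos Real.pi_pos]; ring
    have : |n * (m * α + k) * π| ≤ n * (π / 2) + C₁ + |S 0| + n * C := by
      have e2 : n * (m * α + k) * π =
          (S (0 + n * α) + n * k * π - S 0 - ∑ k ∈ Finset.range n, site α φ 0 k) -
          (S (0 + n * α) - m * π * (0 + n * α)) + S 0 + ∑ k ∈ Finset.range n, site α φ 0 k := by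
        ring
      rw [e2]
      refine (abs_add_le _ _).trans (add_le_add ((abs_add_le _ _).trans
        (add_le_add ((abs_sub _ _).trans (add_le_add a b1)) le_rfl)) c1)
    linarith
  by_contra! hcon
  have hpos : 0 < |m * α + k| * π - π / 2 - C := by
    have := mul_lt_mul_of_pos_right hcon Real.pi_pos
    have e : (1 / 2 + C / π) * π = π / 2 + C := by field_simp
    linarith
  obtain ⟨n, hn⟩ := exists_nat_gt ((C₁ + |S 0|) / (|m * α + k| * π - π / 2 - C))
  rw [div_lt_iff₀ hpos] at hn
  linarith [hb n]

/-- Sections of one class taking the same value at nearby points have nearby parameters. -/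
lemma sub_le_of_eq (hl : 0 < l) (hα : FwdDense α) {ψ : ℝ → ℝ} {L θ₁ θ₂ : ℝ}
    (hL : ∀ x y, |ψ x - ψ y| ≤ L * |x - y|)
    (h1 : Sec l α (fun x => ψ x + θ₁) m k S₁) (h2 : Sec l α (fun x => ψ x + θ₂) m k S₂)
    {x₁ x₂ : ℝ} {j : ℤ} (h : S₂ x₂ = S₁ x₁ + j * π) : θ₂ - θ₁ ≤ L * |x₁ - x₂| := by
  by_contra! hcon
  obtain ⟨i, hi⟩ := exists_band hl hα (h1.translate x₁) (h2.translate x₂) (fun x => by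
    have := abs_le.mp (hL (x + x₁) (x + x₂))
    rw [add_sub_add_left_eq_sub] at this
    linarith [this.2])
  have := hi 0
  simp only [zero_add] at this
  rw [h, add_sub_cancel_left] at this
  have a1 : (i : ℝ) < j := lt_of_mul_lt_mul_right this.1 Real.pi_pos.le
  have a2 : (j : ℝ) < i + 1 := lt_of_mul_lt_mul_right this.2 Real.pi_pos.le
  have a1' : i < j := by exact_mod_cast a1
  have a2' : j < i + 1 := by exact_mod_cast a2
  omega

end Sec

lemma dl_neg (l t : ℝ) : dl l (-t) = -dl l t := by
  unfold dl
  rw [Real.sin_neg, Real.cos_neg, neg_add, ← Real.arctan_neg, ← neg_div]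
  simp only [neg_sq]
  congr 3
  ring

lemma dl_pi_div_two_sub_arctan {l : ℝ} (hl : 0 < l) :
    dl l (π / 2 - Real.arctan l⁻¹) = Real.arctan l⁻¹ := by
  set δ := Real.arctan l⁻¹ with hδ
  have hδ0 : 0 < δ := Real.arctan_pos.mpr (inv_pos.mpr hl)
  have hδ1 : δ < π / 2 := Real.arctan_lt_pi_div_two _
  have hc : 0 < Real.cos δ := Real.cos_pos_of_mem_Ioo ⟨by linarith, hδ1⟩
  have hs : Real.sin δ = l⁻¹ * Real.cos δ := by
    have := Real.tan_arctan l⁻¹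
    rw [← hδ, Real.tan_eq_sin_div_cos, div_eq_iff hc.ne'] at this
    exact this
  obtain ⟨e1, e2⟩ := dr_mul_trig hl (π / 2 - δ)
  have e3 := dr_sq (l := l) (π / 2 - δ)
  rw [Real.cos_pi_div_two_sub] at e1 e3
  rw [Real.sin_pi_div_two_sub] at e2 e3
  rw [← hs] at e2 e3
  have hc' : l * Real.sin δ = Real.cos δ := by rw [hs]; field_simp
  rw [hc'] at e1 e3
  have hr : dr l (π / 2 - δ) = 1 := by
    have h1 := dr_pos hl (π / 2 - δ)
    have : dr l (π / 2 - δ) ^ 2 = 1 := by rw [e3]; linarith [Real.sin_sq_add_cos_sq δ]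
    nlinarith
  rw [hr, one_mul] at e2
  have m1 := (dl_strictMono hl).monotone (show (0 : ℝ) ≤ π / 2 - δ by linarith)
  have m2 := (dl_strictMono hl).monotone (show π / 2 - δ ≤ π / 2 by linarith)
  rw [dl_zero] at m1
  rw [dl_pi_div_two] at m2
  exact Real.injOn_sin ⟨by linarith, m2⟩ ⟨by linarith, hδ1.le⟩ e2

lemma dl_le_arctan {l : ℝ} (hl : 0 < l) {y : ℝ} (j : ℤ)
    (h : y ≤ j * π + π / 2 - Real.arctan l⁻¹) : dl l y ≤ j * π + Real.arctan l⁻¹ := by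
  have := (dl_strictMono hl).monotone (show y ≤ (π / 2 - Real.arctan l⁻¹) + j * π by linarith)
  rw [dl_add_int_mul_pi, dl_pi_div_two_sub_arctan hl] at this
  linarith

lemma arctan_le_dl {l : ℝ} (hl : 0 < l) {y : ℝ} (j : ℤ)
    (h : j * π - π / 2 + Real.arctan l⁻¹ ≤ y) : j * π - Real.arctan l⁻¹ ≤ dl l y := by
  have := (dl_strictMono hl).monotone (show -(π / 2 - Real.arctan l⁻¹) + j * π ≤ y by linarith)
  rw [dl_add_int_mul_pi, dl_neg, dl_pi_div_two_sub_arctan hl] at this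
  linarith

namespace Sec
variable {l α : ℝ} {φ : ℝ → ℝ} {m k : ℤ} {S : ℝ → ℝ} {φ₁ φ₂ : ℝ → ℝ} {S₁ S₂ : ℝ → ℝ}

/-- Parameters of one homotopy class are close to each other when `l` is large. -/
lemma sub_le_arctan (hl : 0 < l) (hα : FwdDense α) {ψ : ℝ → ℝ} {θ₁ θ₂ x₀ : ℝ} (hθ : θ₁ < θ₂)
    (hx₀ : ψ x₀ + (θ₁ + θ₂) / 2 = π / 2)
    (h1 : Sec l α (fun x => ψ x + θ₁) m k S₁) (h2 : Sec l α (fun x => ψ x + θ₂) m k S₂) :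
    θ₂ - θ₁ ≤ 4 * Real.arctan l⁻¹ := by
  by_contra! hcon
  obtain ⟨T, hT, hT2⟩ := exists_above hl hα h1 h2 fun x => by linarith
  have hgap : ∀ x, θ₂ - θ₁ < T x - S₂ x := fun x => by
    have := site_add_lt hl hT h2 (fun x => (hT2 x).1) x
    linarith
  set δ := Real.arctan l⁻¹
  have hδ0 : 0 < δ := Real.arctan_pos.mpr (inv_pos.mpr hl)
  have hup := fun {y : ℝ} j => dl_le_arctan hl (y := y) j
  have hdn := fun {y : ℝ} j => arctan_le_dl hl (y := y) j
  have win : ∀ y₁ y₂ : ℝ, ∀ j : ℤ, j * π - π / 2 + δ ≤ y₂ → y₁ ≤ j * π + π / 2 - δ →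
      dl l y₁ - dl l y₂ ≤ 2 * δ := by
    intro y₁ y₂ j ha hb
    linarith [hup j hb, hdn j ha]
  have e1 := hT.inv (x₀ - α)
  have e2 := h2.inv (x₀ - α)
  have f1 := hT.inv x₀
  have f2 := h2.inv x₀
  rw [sub_add_cancel] at e1 e2
  have b1 := hgap (x₀ - α)
  have b2 := (hT2 (x₀ - α)).2
  have g0 := hgap x₀
  have g1 := hgap (x₀ + α)
  set y₁ := ψ (x₀ - α) + θ₁ + T (x₀ - α)
  set y₂ := ψ (x₀ - α) + θ₂ + S₂ (x₀ - α)
  have hy : y₁ - y₂ < π - (θ₂ - θ₁) := by simp only [y₁, y₂]; linarith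
  obtain ⟨j, hj1, hj2⟩ : ∃ j : ℤ, j * π - π / 2 ≤ y₂ ∧ y₂ < j * π + π / 2 := by
    refine ⟨⌊(y₂ + π / 2) / π⌋, ?_, ?_⟩
    · have := Int.floor_le ((y₂ + π / 2) / π)
      rw [le_div_iff₀ Real.pi_pos] at this
      linarith
    · have := Int.lt_floor_add_one ((y₂ + π / 2) / π)
      rw [div_lt_iff₀ Real.pi_pos] at this
      linarith
  have mono := (dl_strictMono hl).monotone
  have dpi : ∀ i : ℤ, dl l (i * π + π / 2) = i * π + π / 2 := fun i => by
    rw [add_comm, dl_add_int_mul_pi, dl_pi_div_two]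
  have hq : ((j - k : ℤ) : ℝ) = j - k := by push_cast; ring
  have hq1 : ((j - k + 1 : ℤ) : ℝ) = j - k + 1 := by push_cast; ring
  by_cases ha : y₁ ≤ j * π + π / 2 - δ
  · by_cases hb : j * π - π / 2 + δ ≤ y₂
    · have := win y₁ y₂ j hb ha
      linarith
    · have m1 := mono hj1
      have := dpi (j - 1)
      push_cast at this
      rw [show ((j : ℝ) - 1) * π + π / 2 = j * π - π / 2 by ring] at this
      rw [this] at m1
      have m2 := hup j ha
      have := win (ψ x₀ + θ₁ + T x₀) (ψ x₀ + θ₂ + S₂ x₀) (j - k)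
        (by rw [hq]; linarith) (by rw [hq]; linarith)
      linarith
  · push Not at ha
    have hb : j * π - π / 2 + δ ≤ y₂ := by linarith
    have m2 := hdn j hb
    have m1 : dl l y₁ ≤ (j + 1) * π + δ := by
      have := hup (y := y₁) (j + 1) (by push_cast; linarith)
      push_cast at this
      exact this
    have := win (ψ x₀ + θ₁ + T x₀) (ψ x₀ + θ₂ + S₂ x₀) (j - k + 1)
      (by rw [hq1]; linarith) (by rw [hq1]; linarith)
    linarith

/-- An interior section at a parameter with a large block: the neighbouring parameters are
separated by at least `π / 2` after boundedly many steps. -/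
lemma exists_pi_div_two_le (hl : 1 ≤ l) (hα : FwdDense α) {g c : ℝ} (hg : 0 < g)
    (hg' : g ≤ π / 4) (hc : 0 < c) (hc1 : c ≤ 1) (hcg : c ^ 2 ≤ g)
    (h1 : Sec l α φ₁ m k S₁) (h : Sec l α φ m k S) (h2 : Sec l α φ₂ m k S₂)
    (hlt1 : ∀ x, φ₁ x ≤ φ x - g) (hlt2 : ∀ x, φ x + g ≤ φ₂ x) (x : ℝ) {N i : ℕ}
    (hB : 2 * (1 / Real.sin g + (1 / Real.sin g * (N * l ^ 2 / c ^ 2) + 1 / c)) <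
      nr l (site α φ (x + i * α)) N) :
    ∃ n ≤ i + N, ∀ φp φm : ℕ → ℝ, (∀ k, site α φ x k + g ≤ φp k) →
      (∀ k, φm k ≤ site α φ x k - g) → π / 2 ≤ ang l φp n (S x) - ang l φm n (S x) := by
  have hl0 : 0 < l := by linarith
  have hpi := Real.pi_pos
  have hN : 1 ≤ N := by
    by_contra! hN
    obtain rfl : N = 0 := by omega
    have hs : 0 < Real.sin g := Real.sin_pos_of_pos_of_lt_pi hg (by linarith)
    have : 1 ≤ 1 / Real.sin g := by rw [le_div_iff₀ hs]; linarith [Real.sin_le_one g]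
    have h3 : 0 < c⁻¹ := by positivity
    simp [nr] at hB
    simp at this
    linarith
  have hex : ∃ r ≤ N, rad l (site α φ (x + i * α)) r (S (x + i * α)) < c := by
    by_contra! hcon
    exact absurd (nr_le_of_rad (site α φ (x + i * α)) hl N hc hcon
      (Sec.rad_le hl0 hα hg hg' h1 h h2 hlt1 hlt2 _ hN)) (not_le.mpr hB)
  obtain ⟨r, hrN, hr⟩ := hex
  have hr1 : 1 ≤ r := by
    by_contra! h0
    obtain rfl : r = 0 := by omega
    simp at hr; linarith
  refine ⟨i + r, by omega, fun φp φm hp hm => ?_⟩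
  have hrp := rad_pos hl0 (site α φ (x + i * α)) r (S (x + i * α))
  have hinc := pi_div_two_le_ang_sub hl0 (site α φ (x + i * α)) r (t := S (x + i * α)) hg
    (by linarith) (by
      have : rad l (site α φ (x + i * α)) r (S (x + i * α)) ^ 2 ≤ c ^ 2 := by gcongr
      exact this.trans (hcg.trans (Real.le_tan hg.le (by linarith))))
  have hsite : ∀ k, site α φ (x + i * α) k = site α φ x (i + k) := fun k => by
    simp only [site]; congr 1; push_cast; ring
  have hi := h.ang_eq x i
  have p1 := ang_rotate_le hl0 (φ := site α φ (x + i * α)) (φ' := fun k => φp (i + k)) hr1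
    (S (x + i * α)) g (by rw [hsite]; exact hp _) (fun k _ => by
      rw [hsite]; linarith [hp (i + k)])
  have p2 := le_ang_rotate hl0 (φ := site α φ (x + i * α)) (φ' := fun k => φm (i + k)) hr1
    (S (x + i * α)) g (by rw [hsite]; exact hm _) (fun k _ => by
      rw [hsite]; linarith [hm (i + k)])
  have q1 := ang_mono hl0 (φ := site α φ x) (φ' := φp) i (fun k _ => by linarith [hp k])
    (le_refl (S x))
  have q2 := ang_mono hl0 (φ := φm) (φ' := site α φ x) i (fun k _ => by linarith [hm k])
    (le_refl (S x))
  have hik : (i : ℝ) * k * π = ((i * k : ℤ) : ℝ) * π := by push_cast; ring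
  rw [hi, hik] at q1 q2
  have r1 := (ang_strictMono hl0 (fun k => φp (i + k)) r).monotone q1
  have r2 := (ang_strictMono hl0 (fun k => φm (i + k)) r).monotone q2
  rw [ang_add_int_mul_pi] at r1 r2
  rw [ang_add_index, ang_add_index]
  linarith

end Sec

open MeasureTheory in
lemma mul_volume_le_of_card {K M : ℕ} {v : ENNReal} {A : ℕ → Set ℝ} {T : Set ℝ}
    (hv : ∀ j < K, volume (A j) ≤ v)
    (hT : ∀ θ ∈ T, ∃ J : Finset ℕ, J ⊆ Finset.range K ∧ M ≤ J.card ∧ ∀ j ∈ J, θ ∈ A j) :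
    (M : ENNReal) * volume T ≤ K * v := by
  set f : ℝ → ENNReal := fun θ => ∑ j ∈ Finset.range K,
    (toMeasurable volume (A j)).indicator (fun _ => (1 : ENNReal)) θ with hf
  have hmeas : Measurable f := Finset.measurable_sum _ fun j _ =>
    measurable_const.indicator (measurableSet_toMeasurable _ _)
  have hint : ∫⁻ θ, f θ = ∑ j ∈ Finset.range K, volume (A j) := by
    rw [hf, lintegral_finsetSum _ fun j _ =>
      measurable_const.indicator (measurableSet_toMeasurable _ _)]
    refine Finset.sum_congr rfl fun j _ => ?_
    rw [lintegral_indicator_const (measurableSet_toMeasurable _ _), one_mul, measure_toMeasurable]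
  calc (M : ENNReal) * volume T ≤ M * volume {θ | (M : ENNReal) ≤ f θ} := by
        gcongr
        intro θ hθ
        obtain ⟨J, hJ, hM, hA⟩ := hT θ hθ
        calc (M : ENNReal) ≤ J.card := by exact_mod_cast hM
          _ = ∑ j ∈ J, (toMeasurable volume (A j)).indicator (fun _ => (1 : ENNReal)) θ := by
            rw [Finset.sum_congr rfl fun j hj => Set.indicator_of_mem
              (subset_toMeasurable volume (A j) (hA j hj)) (fun _ => (1 : ENNReal))]
            simp
          _ ≤ f θ := Finset.sum_le_sum_of_subset hJ
    _ ≤ ∫⁻ θ, f θ := mul_meas_ge_le_lintegral hmeas _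
    _ = ∑ j ∈ Finset.range K, volume (A j) := hint
    _ ≤ ∑ j ∈ Finset.range K, v := Finset.sum_le_sum fun j hj => hv j (Finset.mem_range.mp hj)
    _ = K * v := by simp

/-- Points of `H` having points of `H` at distance at least `g` on both sides. -/
def innerPart (g : ℝ) (H : Set ℝ) : Set ℝ :=
  {θ ∈ H | (∃ θ₁ ∈ H, θ₁ ≤ θ - g) ∧ ∃ θ₂ ∈ H, θ + g ≤ θ₂}

open MeasureTheory in
lemma volume_diff_inner_le {H : Set ℝ} {a b g : ℝ} (hH : H ⊆ Set.Icc a b) :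
    volume (H \ innerPart g H) ≤ ENNReal.ofReal g + ENNReal.ofReal g := by
  have hba : BddAbove H := ⟨b, fun x hx => (hH hx).2⟩
  have hbb : BddBelow H := ⟨a, fun x hx => (hH hx).1⟩
  have hsub : H \ innerPart g H ⊆
      Set.Icc (sInf H) (sInf H + g) ∪ Set.Icc (sSup H - g) (sSup H) := by
    rintro θ ⟨hθ, hn⟩
    by_cases h1 : ∃ θ₁ ∈ H, θ₁ ≤ θ - g
    · have h2 : ¬ ∃ θ₂ ∈ H, θ + g ≤ θ₂ := fun h2 => hn ⟨hθ, h1, h2⟩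
      push Not at h2
      right
      refine ⟨?_, le_csSup hba hθ⟩
      have := csSup_le ⟨θ, hθ⟩ (fun x hx => (h2 x hx).le)
      linarith
    · push Not at h1
      left
      refine ⟨csInf_le hbb hθ, ?_⟩
      have := le_csInf ⟨θ, hθ⟩ (fun x hx => (h1 x hx).le)
      linarith
  refine (measure_mono hsub).trans ((measure_union_le _ _).trans ?_)
  rw [Real.volume_Icc, Real.volume_Icc]
  simp

open MeasureTheory in
lemma volume_le_of_forall_sub_le {H : Set ℝ} {d : ℝ}
    (h : ∀ x ∈ H, ∀ y ∈ H, y - x ≤ d) : volume H ≤ ENNReal.ofReal d := by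
  rcases H.eq_empty_or_nonempty with rfl | ⟨x, hx⟩
  · simp
  refine (Real.volume_le_diam _).trans (Metric.ediam_le fun x hx y hy => ?_)
  rw [edist_dist, Real.dist_eq]
  exact ENNReal.ofReal_le_ofReal (abs_sub_le_iff.mpr ⟨h y hy x hx, h x hx y hy⟩)

/-- Parameters in `[a, b]` with a section of class `c = (m, k)`. -/
def classSet (l α : ℝ) (ψ : ℝ → ℝ) (a b : ℝ) (c : ℤ × ℤ) : Set ℝ :=
  {θ ∈ Set.Icc a b | ∃ S, Sec l α (fun x => ψ x + θ) c.1 c.2 S}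

/-- Parameters for which every orbit of length `q` meets a block of size larger than `B`. -/
def goodSet (l α : ℝ) (ψ : ℝ → ℝ) (N q : ℕ) (B : ℝ) : Set ℝ :=
  {θ | ∀ x, ∃ i ≤ q, B < nr l (site α (fun y => ψ y + θ) (x + i * α)) N}

section
variable {l α : ℝ} {ψ : ℝ → ℝ} {a b : ℝ}

lemma irrational_eq {α : ℝ} (hα : Irrational α) {c c' : ℤ × ℤ}
    (h : (c.1 : ℝ) * α + c.2 = c'.1 * α + c'.2) : c = c' := by
  have h1 : ((c.1 - c'.1 : ℤ) : ℝ) * α = ((c'.2 - c.2 : ℤ) : ℝ) := by push_cast; linarith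
  have h0 : c.1 - c'.1 = 0 := by
    by_contra hne
    have := (hα.intCast_mul hne).ne_int (c'.2 - c.2)
    exact this h1
  rw [h0] at h1
  have h2 : c'.2 - c.2 = 0 := by
    have : ((c'.2 - c.2 : ℤ) : ℝ) = 0 := by rw [← h1]; simp
    exact_mod_cast this
  exact Prod.ext (by omega) (by omega)

lemma classSet_lt (hl : 0 < l) {c c' : ℤ × ℤ} (h : (c.1 : ℝ) * α + c.2 < c'.1 * α + c'.2)
    {θ θ' : ℝ} (hθ : θ ∈ classSet l α ψ a b c) (hθ' : θ' ∈ classSet l α ψ a b c') : θ < θ' := by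
  obtain ⟨-, S, hS⟩ := hθ
  obtain ⟨-, S', hS'⟩ := hθ'
  by_contra! hcon
  have := hS'.class_le hl hS (fun x => by linarith)
  linarith

/-- The classes having an interior good parameter whose section vanishes near `z`. -/
def hitClasses (l α : ℝ) (ψ : ℝ → ℝ) (a b g : ℝ) (G : Set ℝ) (z d : ℝ) : Set (ℤ × ℤ) :=
  {c | ∃ θ ∈ innerPart (2 * g) (classSet l α ψ a b c) ∩ G, ∃ S x,
    Sec l α (fun x => ψ x + θ) c.1 c.2 S ∧ |x - z| ≤ d ∧ S x = 0}

lemma hitClasses_finite (hl : 1 ≤ l) (hα : FwdDense α) (hirr : Irrational α) {L : ℝ}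
    (hL : ∀ x y, |ψ x - ψ y| ≤ L * |x - y|) (hL0 : 0 ≤ L) (hba : b ≤ a + π) {g c : ℝ} (hg : 0 < g)
    (hg' : g ≤ π / 4) (hc : 0 < c) (hc1 : c ≤ 1) (hcg : c ^ 2 ≤ g) {N q : ℕ} {B : ℝ}
    (hB : 2 * (1 / Real.sin g + (1 / Real.sin g * (N * l ^ 2 / c ^ 2) + 1 / c)) ≤ B)
    (z : ℝ) {d : ℝ} (hd : L * d ≤ g) :
    (hitClasses l α ψ a b g (goodSet l α ψ N q B) z d).Finite ∧
    (hitClasses l α ψ a b g (goodSet l α ψ N q B) z d).ncard ≤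
      (q + N + 1) * (2 * (q + N) + 1) := by
  have hl0 : 0 < l := by linarith
  have hpi := Real.pi_pos
  set F : ℕ → ℝ → ℝ := fun n θ => ang l (site α (fun y => ψ y + θ) z) n 0 with hF
  have hFm : ∀ n, Monotone (F n) := fun n θ θ' h =>
    ang_mono hl0 n (fun k _ => by simp only [site]; linarith) le_rfl
  have hFpi : ∀ n θ, F n (θ + π) = F n θ + n * π := fun n θ => by
    simp only [hF]
    rw [← ang_add_pi_sites]
    congr 1
    funext k; simp only [site]; ring
  have key : ∀ c ∈ hitClasses l α ψ a b g (goodSet l α ψ N q B) z d, ∃ n ≤ q + N,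
      ∃ θ₁ ∈ classSet l α ψ a b c, ∃ θ₂ ∈ classSet l α ψ a b c,
        π / 2 ≤ F n θ₂ - F n θ₁ := by
    rintro ⟨m, k⟩ ⟨θ, ⟨⟨hθ, ⟨θ₁, hθ₁, h1⟩, ⟨θ₂, hθ₂, h2⟩⟩, hG⟩, S, x, hS, hx, hSx⟩
    obtain ⟨i, hiq, hi⟩ := hG x
    obtain ⟨S₁, hS₁⟩ := hθ₁.2
    obtain ⟨S₂, hS₂⟩ := hθ₂.2
    obtain ⟨n, hn, hnn⟩ := Sec.exists_pi_div_two_le hl hα hg hg' hc hc1 hcg hS₁ hS hS₂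
      (fun x => by linarith) (fun x => by linarith) x (hB.trans_lt hi)
    refine ⟨n, by omega, θ₁, hθ₁, θ₂, hθ₂, ?_⟩
    rw [hSx] at hnn
    have hψ : ∀ k : ℕ, |ψ (x + k * α) - ψ (z + k * α)| ≤ g := fun k => by
      refine (hL _ _).trans ?_
      rw [add_sub_add_right_eq_sub]
      exact (mul_le_mul_of_nonneg_left hx hL0).trans hd
    exact hnn _ _
      (fun k => by simp only [site]; linarith [(abs_le.mp (hψ k)).2])
      (fun k => by simp only [site]; linarith [(abs_le.mp (hψ k)).1])
  choose! n hn θ₁ hθ₁ θ₂ hθ₂ hinc using key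
  set Hc := hitClasses l α ψ a b g (goodSet l α ψ N q B) z d
  set f : ℤ × ℤ → ℕ × ℕ := fun c => (n c, ⌊(F (n c) (θ₁ c) - F (n c) a) / (π / 2)⌋₊) with hf
  set R : Finset (ℕ × ℕ) := Finset.range (q + N + 1) ×ˢ Finset.range (2 * (q + N) + 1) with hR
  have hmaps : ∀ c ∈ Hc, f c ∈ (R : Set (ℕ × ℕ)) := by
    intro c hc
    have h1 := hn c hc
    have hle : F (n c) (θ₁ c) ≤ F (n c) a + n c * π := by
      rw [← hFpi]; exact hFm _ ((hθ₁ c hc).1.2.trans hba)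
    have h2 : ⌊(F (n c) (θ₁ c) - F (n c) a) / (π / 2)⌋₊ ≤ 2 * n c := by
      apply Nat.floor_le_of_le
      rw [div_le_iff₀ (by positivity)]
      push_cast
      linarith
    simp only [hR, hf, Finset.coe_product, Set.mem_prod, Finset.coe_range, Set.mem_Iio]
    constructor <;> omega
  have hne : ∀ c ∈ Hc, ∀ c' ∈ Hc, f c = f c' →
      ¬ (c.1 : ℝ) * α + c.2 < c'.1 * α + c'.2 := by
    intro c hc c' hc' hfe hlt
    have e1 : n c = n c' := congrArg Prod.fst hfe
    have e2 := congrArg Prod.snd hfe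
    simp only [hf] at e2
    rw [← e1] at e2
    have hlt' := classSet_lt hl0 hlt (hθ₂ c hc) (hθ₁ c' hc')
    have i1 := hinc c hc
    have i2 := hFm (n c) hlt'.le
    have i3 := hFm (n c) (hθ₁ c hc).1.1
    have : ⌊(F (n c) (θ₁ c) - F (n c) a) / (π / 2)⌋₊ + 1 ≤
        ⌊(F (n c) (θ₁ c') - F (n c) a) / (π / 2)⌋₊ := by
      rw [← Nat.floor_add_one (by apply div_nonneg <;> linarith)]
      apply Nat.floor_le_floor
      rw [div_add_one (by positivity)]
      gcongr
      linarith
    omega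
  have hinj : Set.InjOn f Hc := by
    intro c hc c' hc' hfe
    refine irrational_eq hirr (le_antisymm ?_ ?_)
    · exact not_lt.mp (hne c' hc' c hc hfe.symm)
    · exact not_lt.mp (hne c hc c' hc' hfe)
  have hfin : Hc.Finite := Set.Finite.of_injOn hmaps hinj R.finite_toSet
  refine ⟨hfin, ?_⟩
  have := Set.ncard_le_ncard_of_injOn f hmaps hinj R.finite_toSet
  rw [Set.ncard_coe_finset] at this
  simpa [hR] using this

end

section
variable {l α : ℝ} {ψ : ℝ → ℝ} {a b : ℝ}

lemma Sec.exists_zeros {φ : ℝ → ℝ} {m k : ℤ} {S : ℝ → ℝ} (h : Sec l α φ m k S) :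
    ∃ x : ℕ → ℝ, ∃ i₀ : ℤ, ∀ i < m.natAbs, x i ∈ Set.Icc (0 : ℝ) 1 ∧ S (x i) = (i₀ + i : ℤ) * π := by
  have hpi := Real.pi_pos
  have h1 : S 1 = S 0 + m * π := by simpa using h.per 0
  have hiv := intermediate_value_uIcc (h.cont.continuousOn (s := Set.uIcc (0 : ℝ) 1))
  rw [Set.uIcc_of_le zero_le_one] at hiv
  have key : ∀ v, min (S 0) (S 1) ≤ v → v ≤ max (S 0) (S 1) → ∃ x ∈ Set.Icc (0 : ℝ) 1, S x = v :=
    fun v hv hv' => hiv ⟨hv, hv'⟩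
  set i₀ : ℤ := ⌈min (S 0) (S 1) / π⌉ with hi₀
  have hdiff : max (S 0) (S 1) = min (S 0) (S 1) + m.natAbs * π := by
    have e : ((m.natAbs : ℕ) : ℝ) = |(m : ℝ)| := by
      rw [← Int.cast_natCast, Int.natCast_natAbs, Int.cast_abs]
    rw [← sub_eq_iff_eq_add', max_sub_min_eq_abs, h1, e]
    rw [show S 0 + m * π - S 0 = m * π by ring, abs_mul, abs_of_pos hpi]
  have hex : ∀ i : ℕ, i < m.natAbs → ∃ x ∈ Set.Icc (0 : ℝ) 1, S x = (i₀ + i : ℤ) * π := by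
    intro i hi
    have hc1 : min (S 0) (S 1) / π ≤ i₀ := Int.le_ceil _
    have hc2 : (i₀ : ℝ) < min (S 0) (S 1) / π + 1 := Int.ceil_lt_add_one _
    have hi' : (i : ℝ) + 1 ≤ m.natAbs := by exact_mod_cast hi
    rw [div_le_iff₀ hpi] at hc1
    rw [← sub_lt_iff_lt_add, lt_div_iff₀ hpi] at hc2
    apply key
    · push_cast; nlinarith [(Nat.cast_nonneg i : (0 : ℝ) ≤ i)]
    · rw [hdiff]; push_cast; nlinarith
  choose! x hx using hex
  exact ⟨x, i₀, hx⟩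

/-- Interior good parameters of large homotopy class. -/
def largeClass (l α : ℝ) (ψ : ℝ → ℝ) (a b g : ℝ) (G : Set ℝ) (M : ℕ) : Set ℝ :=
  {θ | ∃ c : ℤ × ℤ, M ≤ c.1.natAbs ∧ θ ∈ innerPart (2 * g) (classSet l α ψ a b c) ∧ θ ∈ G}

open MeasureTheory in
lemma mul_volume_largeClass_le (hl : 1 ≤ l) (hα : FwdDense α) (hirr : Irrational α) {L : ℝ}
    (hL : ∀ x y, |ψ x - ψ y| ≤ L * |x - y|) (hL0 : 0 ≤ L) (hba : b ≤ a + π) {g c : ℝ} (hg : 0 < g)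
    (hg' : g ≤ π / 4) (hc : 0 < c) (hc1 : c ≤ 1) (hcg : c ^ 2 ≤ g) {N q : ℕ} {B : ℝ}
    (hB : 2 * (1 / Real.sin g + (1 / Real.sin g * (N * l ^ 2 / c ^ 2) + 1 / c)) ≤ B) (M : ℕ) :
    (M : ENNReal) * volume (largeClass l α ψ a b g (goodSet l α ψ N q B) M) ≤
      ENNReal.ofReal (4 * L * ((q + N + 1) * (2 * (q + N) + 1) : ℕ)) := by
  have hl0 : 0 < l := by linarith
  have hpi := Real.pi_pos
  set G := goodSet l α ψ N q B
  set T := largeClass l α ψ a b g G M with hT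
  set X : ℕ := (q + N + 1) * (2 * (q + N) + 1) with hX
  -- the set of parameters hitting the cell `j`
  let A : ℕ → ℕ → Set ℝ := fun K j => {θ | ∃ c : ℤ × ℤ,
    θ ∈ innerPart (2 * g) (classSet l α ψ a b c) ∩ G ∧ ∃ S, ∃ x : ℝ,
      Sec l α (fun x => ψ x + θ) c.1 c.2 S ∧ |x - (j / K : ℝ)| ≤ (1 / K : ℝ) ∧ S x = 0}
  have hA : ∀ K j : ℕ, L * (1 / K) ≤ g →
      volume (A K j) ≤ ENNReal.ofReal (X * (2 * L * (1 / K))) := by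
    intro K j hK
    obtain ⟨hfin, hcard⟩ := hitClasses_finite hl hα hirr hL hL0 hba hg hg' hc hc1 hcg hB
      (j / K : ℝ) (d := 1 / K) hK
    let P : ℤ × ℤ → Set ℝ := fun c => {θ | ∃ S, ∃ x : ℝ, Sec l α (fun x => ψ x + θ) c.1 c.2 S ∧
      |x - (j / K : ℝ)| ≤ (1 / K : ℝ) ∧ S x = 0}
    have hsub : A K j ⊆ ⋃ c ∈ hfin.toFinset, P c := by
      rintro θ ⟨c, hc, h⟩
      simp only [Set.mem_iUnion]
      exact ⟨c, hfin.mem_toFinset.mpr ⟨θ, hc, h⟩, h⟩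
    have hP : ∀ c, volume (P c) ≤ ENNReal.ofReal (2 * L * (1 / K)) := by
      intro c
      apply volume_le_of_forall_sub_le
      rintro θ₁ ⟨S₁, x₁, h1, hx1, hS1⟩ θ₂ ⟨S₂, x₂, h2, hx2, hS2⟩
      refine (Sec.sub_le_of_eq hl0 hα hL h1 h2 (j := 0) (by rw [hS1, hS2]; simp)).trans ?_
      rw [mul_comm 2 L, mul_assoc]
      refine mul_le_mul_of_nonneg_left ?_ hL0
      rw [abs_le] at *
      constructor <;> linarith
    calc volume (A K j) ≤ ∑ c ∈ hfin.toFinset, volume (P c) :=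
          (measure_mono hsub).trans (measure_biUnion_finset_le _ _)
      _ ≤ ∑ c ∈ hfin.toFinset, ENNReal.ofReal (2 * L * (1 / K)) :=
          Finset.sum_le_sum fun c _ => hP c
      _ ≤ X * ENNReal.ofReal (2 * L * (1 / K)) := by
          rw [Finset.sum_const, nsmul_eq_mul]
          gcongr
          rwa [← Set.ncard_eq_toFinset_card _ hfin]
      _ = ENNReal.ofReal (X * (2 * L * (1 / K))) := by
          rw [ENNReal.ofReal_mul (Nat.cast_nonneg X), ENNReal.ofReal_natCast]
  let TK : ℕ → Set ℝ := fun K => {θ | ∃ J : Finset ℕ, J ⊆ Finset.range (K + 1) ∧ M ≤ J.card ∧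
    ∀ j ∈ J, θ ∈ A K j}
  have hTK : ∀ K : ℕ, 1 ≤ K → L * (1 / K) ≤ g →
      (M : ENNReal) * volume (TK K) ≤ ENNReal.ofReal (4 * L * X) := by
    intro K hK1 hK
    refine (mul_volume_le_of_card (K := K + 1) (fun j _ => hA K j hK) fun θ hθ => hθ).trans ?_
    rw [← ENNReal.ofReal_natCast, ← ENNReal.ofReal_mul (Nat.cast_nonneg _)]
    apply ENNReal.ofReal_le_ofReal
    have hK' : (1 : ℝ) ≤ K := by exact_mod_cast hK1
    have : ((K + 1 : ℕ) : ℝ) * (1 / K) ≤ 2 := by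
      rw [mul_one_div, div_le_iff₀ (by linarith)]; push_cast; linarith
    calc ((K + 1 : ℕ) : ℝ) * (X * (2 * L * (1 / K)))
        = (X * (2 * L)) * (((K + 1 : ℕ) : ℝ) * (1 / K)) := by ring
      _ ≤ (X * (2 * L)) * 2 := by gcongr
      _ = 4 * L * X := by ring
  have hev : ∀ θ ∈ T, ∃ K₀ : ℕ, ∀ K, K₀ ≤ K → θ ∈ TK K := by
    rintro θ ⟨c, hM, hθ, hG⟩
    obtain ⟨S, hS⟩ := hθ.1.2
    obtain ⟨x, i₀, hx⟩ := hS.exists_zeros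
    have hinj : Set.InjOn x (Finset.range M : Set ℕ) := by
      intro i hi j hj hij
      simp only [Finset.coe_range, Set.mem_Iio] at hi hj
      have h1 := (hx i (by omega)).2
      rw [hij, (hx j (by omega)).2] at h1
      have h2 := mul_right_cancel₀ hpi.ne' h1
      have h3 : i₀ + (j : ℤ) = i₀ + i := by exact_mod_cast h2
      omega
    obtain ⟨K₀, hK₀, hsep⟩ : ∃ K₀ : ℕ, 1 ≤ K₀ ∧ ∀ i ∈ Finset.range M, ∀ j ∈ Finset.range M, i ≠ j →
        1 ≤ K₀ * |x i - x j| := by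
      have hex : ∀ p ∈ Finset.range M ×ˢ Finset.range M, ∃ n : ℕ, p.1 ≠ p.2 →
          1 ≤ n * |x p.1 - x p.2| := by
        rintro ⟨i, j⟩ hp
        rw [Finset.mem_product] at hp
        by_cases hij : i = j
        · exact ⟨0, fun h => absurd hij h⟩
        have hpos : 0 < |x i - x j| := abs_pos.mpr (sub_ne_zero.mpr fun h =>
          hij (hinj (by simpa using hp.1) (by simpa using hp.2) h))
        obtain ⟨n, hn⟩ := exists_nat_ge (1 / |x i - x j|)
        exact ⟨n, fun _ => by rwa [div_le_iff₀ hpos] at hn⟩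
      choose! n hn using hex
      refine ⟨(Finset.range M ×ˢ Finset.range M).sup n + 1, by omega, fun i hi j hj hij => ?_⟩
      have hp : (i, j) ∈ Finset.range M ×ˢ Finset.range M := Finset.mem_product.mpr ⟨hi, hj⟩
      refine (hn _ hp hij).trans ?_
      gcongr
      exact (Finset.le_sup hp).trans (Nat.le_succ _)
    refine ⟨K₀, fun K hK => ?_⟩
    have hKpos : (0 : ℝ) < K := by exact_mod_cast (by omega : 0 < K)
    refine ⟨(Finset.range M).image fun i => ⌊K * x i⌋₊, ?_, ?_, ?_⟩
    · intro j hj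
      obtain ⟨i, hi, rfl⟩ := Finset.mem_image.mp hj
      have := hx i (by have := Finset.mem_range.mp hi; omega)
      rw [Finset.mem_range, Nat.lt_succ_iff]
      apply Nat.floor_le_of_le
      nlinarith [this.1.2]
    · rw [Finset.card_image_of_injOn, Finset.card_range]
      intro i hi j hj hij
      by_contra hne
      have h1 := hsep i (by simpa using hi) j (by simpa using hj) hne
      simp only [Finset.coe_range, Set.mem_Iio] at hi hj
      have xi := (hx i (by omega)).1.1
      have xj := (hx j (by omega)).1.1
      have h2 : |K * x i - K * x j| < 1 := by
        have a1 := Nat.floor_le (mul_nonneg hKpos.le xi)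
        have a2 := Nat.lt_floor_add_one (K * x i)
        have a3 := Nat.floor_le (mul_nonneg hKpos.le xj)
        have a4 := Nat.lt_floor_add_one (K * x j)
        simp only at hij
        rw [hij] at a1 a2
        rw [abs_lt]; constructor <;> linarith
      rw [← mul_sub, abs_mul, abs_of_pos hKpos] at h2
      have : (K₀ : ℝ) * |x i - x j| ≤ K * |x i - x j| := by gcongr
      linarith
    · intro j hj
      obtain ⟨i, hi, rfl⟩ := Finset.mem_image.mp hj
      have hxi := hx i (by have := Finset.mem_range.mp hi; omega)
      refine ⟨c, ⟨hθ, hG⟩, _, x i, hS.shift (-(i₀ + i)), ?_, ?_⟩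
      · have a1 := Nat.floor_le (mul_nonneg hKpos.le hxi.1.1)
        have a2 := Nat.lt_floor_add_one (K * x i)
        rw [show x i - (⌊K * x i⌋₊ : ℝ) / K = (K * x i - ⌊K * x i⌋₊) / K by field_simp,
          abs_div, abs_of_pos hKpos]
        gcongr
        rw [abs_le]; constructor <;> linarith
      · simp only [hxi.2]; push_cast; ring
  obtain ⟨K₁, hK₁, hK₁g⟩ : ∃ K₁ : ℕ, 1 ≤ K₁ ∧ L * (1 / K₁) ≤ g := by
    obtain ⟨n, hn⟩ := exists_nat_ge (L / g)
    refine ⟨n + 1, by omega, ?_⟩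
    rw [div_le_iff₀ hg] at hn
    rw [mul_one_div, div_le_iff₀ (by positivity)]
    push_cast; nlinarith
  let U : ℕ → Set ℝ := fun K₀ => {θ | ∀ K, K₀ ≤ K → θ ∈ TK K}
  have hUm : Monotone U := fun i j hij θ hθ K hK => hθ K (hij.trans hK)
  have hTU : T ⊆ ⋃ i, U i := fun θ hθ => Set.mem_iUnion.mpr (hev θ hθ)
  calc (M : ENNReal) * volume T ≤ M * volume (⋃ i, U i) := by gcongr
    _ = ⨆ i, M * volume (U i) := by rw [hUm.measure_iUnion, ENNReal.mul_iSup]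
    _ ≤ _ := by
      refine iSup_le fun i => ?_
      have hK : K₁ ≤ max i K₁ := le_max_right _ _
      refine le_trans ?_ (hTK (max i K₁) (hK₁.trans hK) (le_trans ?_ hK₁g))
      · gcongr
        exact fun θ hθ => hθ _ (le_max_left _ _)
      · have : (K₁ : ℝ) ≤ (max i K₁ : ℕ) := by exact_mod_cast hK
        have : (0 : ℝ) < K₁ := by exact_mod_cast hK₁
        gcongr

end

lemma continuous_ang_sites {X : Type*} [TopologicalSpace X] {l : ℝ} (hl : 0 < l) {Φ : X → ℕ → ℝ}
    (hΦ : ∀ k, Continuous fun p => Φ p k) (n : ℕ) (t : ℝ) :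
    Continuous fun p => ang l (Φ p) n t := by
  induction n with
  | zero => simpa using continuous_const
  | succ n ih => exact (continuous_dl hl).comp ((hΦ n).add ih)

lemma continuous_rad_sites {X : Type*} [TopologicalSpace X] {l : ℝ} (hl : 0 < l) {Φ : X → ℕ → ℝ}
    (hΦ : ∀ k, Continuous fun p => Φ p k) (n : ℕ) (t : ℝ) :
    Continuous fun p => rad l (Φ p) n t := by
  induction n with
  | zero => simpa using continuous_const
  | succ n ih =>
    have h := (hΦ n).add (continuous_ang_sites hl hΦ n t)
    have h2 : Continuous (dr l) := by unfold dr; fun_prop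
    exact (h2.comp h).mul ih

open Polynomial in
lemma exists_poly {l : ℝ} (hl : 0 < l) (φ : ℕ → ℝ) (t : ℝ) (n : ℕ) : ∃ P Q : ℂ[X],
    P.natDegree ≤ n ∧ Q.natDegree ≤ n ∧
    ‖P.coeff n + Complex.I * Q.coeff n‖ = ((l + l⁻¹) / 2) ^ n ∧
    (1 ≤ n → ‖P.coeff n‖ = l / 2 * ((l + l⁻¹) / 2) ^ (n - 1) ∧
      ‖Q.coeff n‖ = l⁻¹ / 2 * ((l + l⁻¹) / 2) ^ (n - 1)) ∧
    ∀ θ : ℝ, P.eval (Complex.exp (2 * θ * Complex.I)) = Complex.exp (n * θ * Complex.I) *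
        (rad l (fun k => φ k + θ) n t * Real.cos (ang l (fun k => φ k + θ) n t) : ℝ) ∧
      Q.eval (Complex.exp (2 * θ * Complex.I)) = Complex.exp (n * θ * Complex.I) *
        (rad l (fun k => φ k + θ) n t * Real.sin (ang l (fun k => φ k + θ) n t) : ℝ) := by
  induction n with
  | zero =>
    refine ⟨C (Real.cos t : ℂ), C (Real.sin t : ℂ), by simp, by simp, ?_, by simp, by simp⟩
    have : ((Real.cos t : ℝ) : ℂ) + Complex.I * (Real.sin t : ℝ) = Complex.exp (t * Complex.I) := by
      rw [Complex.exp_mul_I]; push_cast; ring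
    simp only [coeff_C_zero, pow_zero, this]
    exact Complex.norm_exp_ofReal_mul_I t
  | succ n ih =>
    obtain ⟨P, Q, hP, hQ, hn, -, hev⟩ := ih
    set u : ℂ := Complex.exp (φ n * Complex.I) with hu
    set v : ℂ := Complex.exp (-(φ n * Complex.I)) with hv
    have hun : ‖u‖ = 1 := Complex.norm_exp_ofReal_mul_I _
    set A : ℂ[X] → ℂ[X] := fun R => C u * (X * R) + C v * R with hA
    set B : ℂ[X] → ℂ[X] := fun R => C u * (X * R) - C v * R with hB
    have hAc : ∀ R : ℂ[X], R.natDegree ≤ n → (A R).coeff (n + 1) = u * R.coeff n := fun R hR => by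
      simp only [hA, coeff_add, coeff_C_mul, coeff_X_mul]
      rw [coeff_eq_zero_of_natDegree_lt (by omega : R.natDegree < n + 1)]; ring
    have hBc : ∀ R : ℂ[X], R.natDegree ≤ n → (B R).coeff (n + 1) = u * R.coeff n := fun R hR => by
      simp only [hB, coeff_sub, coeff_C_mul, coeff_X_mul]
      rw [coeff_eq_zero_of_natDegree_lt (by omega : R.natDegree < n + 1)]; ring
    have hXR : ∀ R : ℂ[X], R.natDegree ≤ n → (C u * (X * R)).natDegree ≤ n + 1 := fun R hR =>
      (natDegree_C_mul_le _ _).trans (natDegree_mul_le.trans (by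
        have := natDegree_X_le (R := ℂ); omega))
    have hCR : ∀ R : ℂ[X], R.natDegree ≤ n → (C v * R).natDegree ≤ n + 1 := fun R hR =>
      (natDegree_C_mul_le _ _).trans (by omega)
    have hAd : ∀ R : ℂ[X], R.natDegree ≤ n → (A R).natDegree ≤ n + 1 := fun R hR =>
      natDegree_add_le_of_degree_le (hXR R hR) (hCR R hR)
    have hBd : ∀ R : ℂ[X], R.natDegree ≤ n → (B R).natDegree ≤ n + 1 := fun R hR =>
      (natDegree_sub_le_of_le (hXR R hR) (hCR R hR)).trans (max_self _).le
    set P' : ℂ[X] := C ((l : ℂ) / 2) * (A P + C Complex.I * B Q) with hP'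
    set Q' : ℂ[X] := C ((l : ℂ)⁻¹ / 2) * (A Q - C Complex.I * B P) with hQ'
    have cP : P'.coeff (n + 1) = (l / 2 : ℂ) * u * (P.coeff n + Complex.I * Q.coeff n) := by
      simp only [hP', coeff_C_mul, coeff_add, hAc P hP, hBc Q hQ]; ring
    have cQ : Q'.coeff (n + 1) = -Complex.I * (((l : ℂ)⁻¹ / 2) * u *
        (P.coeff n + Complex.I * Q.coeff n)) := by
      simp only [hQ', coeff_C_mul, coeff_sub, hBc P hP, hAc Q hQ]
      linear_combination (u * Q.coeff n * (l : ℂ)⁻¹ / 2) * Complex.I_sq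
    have hl2 : ‖(l / 2 : ℂ)‖ = l / 2 := by
      rw [show (l / 2 : ℂ) = ((l / 2 : ℝ) : ℂ) by push_cast; rfl, Complex.norm_real,
        Real.norm_of_nonneg (by positivity)]
    have hli2 : ‖((l : ℂ)⁻¹ / 2)‖ = l⁻¹ / 2 := by
      rw [show ((l : ℂ)⁻¹ / 2) = ((l⁻¹ / 2 : ℝ) : ℂ) by push_cast; rfl, Complex.norm_real,
        Real.norm_of_nonneg (by positivity)]
    refine ⟨P', Q', ?_, ?_, ?_, fun _ => ⟨?_, ?_⟩, fun θ => ?_⟩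
    · exact (natDegree_C_mul_le _ _).trans (natDegree_add_le_of_degree_le (hAd P hP)
        ((natDegree_C_mul_le _ _).trans (hBd Q hQ)))
    · exact (natDegree_C_mul_le _ _).trans ((natDegree_sub_le_of_le (hAd Q hQ)
        ((natDegree_C_mul_le _ _).trans (hBd P hP))).trans (max_self _).le)
    · have : P'.coeff (n + 1) + Complex.I * Q'.coeff (n + 1) = (((l + l⁻¹) / 2 : ℝ) : ℂ) * u *
          (P.coeff n + Complex.I * Q.coeff n) := by
        rw [cP, cQ]; push_cast
        linear_combination (-((l : ℂ)⁻¹ / 2 * u * (P.coeff n + Complex.I * Q.coeff n))) *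
          Complex.I_sq
      rw [this, norm_mul, norm_mul, hun, hn, Complex.norm_real,
        Real.norm_of_nonneg (by positivity), pow_succ]
      ring
    · rw [cP, norm_mul, norm_mul, hun, hn, hl2, Nat.add_sub_cancel]; ring
    · rw [cQ, norm_mul, norm_mul, norm_mul, hun, hn, hli2, Nat.add_sub_cancel, norm_neg,
        Complex.norm_I]; ring
    · obtain ⟨e1, e2⟩ := hev θ
      obtain ⟨r1, r2⟩ := rad_trig_succ hl (fun k => φ k + θ) n t
      set z : ℂ := Complex.exp (2 * θ * Complex.I) with hz
      set w : ℂ := Complex.exp (θ * Complex.I) with hw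
      set w' : ℂ := Complex.exp (-(θ * Complex.I)) with hw'
      have hww : w * w' = 1 := by rw [hw, hw', ← Complex.exp_add]; simp
      have huv : u * v = 1 := by rw [hu, hv, ← Complex.exp_add]; simp
      have hzw : z = w * w := by rw [hz, hw, ← Complex.exp_add]; congr 1; ring
      have hsucc : Complex.exp (((n + 1 : ℕ) : ℂ) * θ * Complex.I) =
          w * Complex.exp (n * θ * Complex.I) := by
        rw [hw, ← Complex.exp_add]; congr 1; push_cast; ring
      have hc : ((Real.cos (φ n + θ) : ℝ) : ℂ) = (u * w + v * w') / 2 := by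
        rw [Complex.ofReal_cos, Complex.cos, hu, hw, hv, hw', ← Complex.exp_add, ← Complex.exp_add]
        push_cast
        congr 3 <;> ring
      have hs : ((Real.sin (φ n + θ) : ℝ) : ℂ) = (v * w' - u * w) * Complex.I / 2 := by
        rw [Complex.ofReal_sin, Complex.sin, hu, hw, hv, hw', ← Complex.exp_add, ← Complex.exp_add]
        push_cast
        congr 4 <;> ring
      rw [r1, r2, hsucc]
      set E := Complex.exp (n * θ * Complex.I)
      simp only [hP', hQ', hA, hB, eval_mul, eval_add, eval_sub, eval_C, eval_X]
      rw [e1, e2, hzw]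
      simp only [Complex.ofReal_mul, Complex.ofReal_sub, Complex.ofReal_add, Complex.ofReal_inv]
      rw [hc, hs]
      set cc := (rad l (fun k => φ k + θ) n t : ℂ) * Real.cos (ang l (fun k => φ k + θ) n t)
      set ss := (rad l (fun k => φ k + θ) n t : ℂ) * Real.sin (ang l (fun k => φ k + θ) n t)
      constructor
      · linear_combination (-(l * E * v * (cc - ss * Complex.I) / 2)) * hww
      · linear_combination (-((l : ℂ)⁻¹ * E * v * (ss + cc * Complex.I) / 2)) * hww

section
variable {l : ℝ} (hl : 0 < l) (φ : ℕ → ℝ) {n : ℕ} (hn : 1 ≤ n) (t : ℝ)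

include hl hn

lemma exists_ang_eq (v : ℝ) : ∃ θ, ang l (fun k => φ k + θ) n t = v := by
  have hpi := Real.pi_pos
  have hn' : (1 : ℝ) ≤ n := by exact_mod_cast hn
  have hcont : Continuous fun θ : ℝ => ang l (fun k => φ k + θ) n t :=
    continuous_ang_sites hl (fun k => by fun_prop) n t
  have hup : ∀ (ξ : ℕ → ℝ) (j : ℕ), ang l (fun k => ξ k + j * π) n t = ang l ξ n t + j * (n * π) := by
    intro ξ j
    induction j with
    | zero => simp
    | succ j ih =>
      have := ang_add_pi_sites (l := l) (fun k => ξ k + j * π) n t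
      rw [ih] at this
      rw [show (fun k => ξ k + ((j + 1 : ℕ) : ℝ) * π) = fun k => ξ k + j * π + π by
        funext k; push_cast; ring, this]
      push_cast; ring
  refine mem_range_of_exists_le_of_exists_ge hcont ?_ ?_
  · obtain ⟨j, hj⟩ := exists_nat_ge ((ang l φ n t - v) / π)
    rw [div_le_iff₀ hpi] at hj
    refine ⟨-(j * π), ?_⟩
    have := hup (fun k => φ k + -(j * π)) j
    simp only [neg_add_cancel_right] at this
    have h2 : (j : ℝ) * π ≤ j * (n * π) := by
      gcongr; nlinarith
    linarith
  · obtain ⟨j, hj⟩ := exists_nat_ge ((v - ang l φ n t) / π)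
    rw [div_le_iff₀ hpi] at hj
    refine ⟨j * π, ?_⟩
    have := hup φ j
    have h2 : (j : ℝ) * π ≤ j * (n * π) := by
      gcongr; nlinarith
    linarith

omit hl hn in
/-- The phase for which the image angle is `v`. -/
def rootAt (l : ℝ) (φ : ℕ → ℝ) (n : ℕ) (t v : ℝ) : ℝ :=
  Function.invFun (fun θ => ang l (fun k => φ k + θ) n t) v

lemma ang_rootAt (v : ℝ) : ang l (fun k => φ k + rootAt l φ n t v) n t = v :=
  Function.invFun_eq (f := fun θ => ang l (fun k => φ k + θ) n t) (exists_ang_eq hl φ hn t v)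

lemma rootAt_le {φ' : ℕ → ℝ} {δ : ℝ} (h : ∀ k, φ k - δ ≤ φ' k) (v : ℝ) :
    rootAt l φ' n t v ≤ rootAt l φ n t v + δ := by
  by_contra! hcon
  have := ang_lt_of_lt (l := l) hl hn (φ := fun k => φ k + rootAt l φ n t v)
    (φ' := fun k => φ' k + rootAt l φ' n t v) (fun k _ => by linarith [h k]) (le_refl t)
  rw [ang_rootAt hl φ hn, ang_rootAt hl φ' hn] at this
  exact lt_irrefl _ this

lemma abs_rootAt_sub_le {φ' : ℕ → ℝ} {δ : ℝ} (h : ∀ k, |φ k - φ' k| ≤ δ) (v : ℝ) :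
    |rootAt l φ n t v - rootAt l φ' n t v| ≤ δ := by
  have h1 := rootAt_le hl φ hn t (φ' := φ') (δ := δ) (fun k => by linarith [(abs_le.mp (h k)).2]) v
  have h2 := rootAt_le hl φ' hn t (φ' := φ) (δ := δ) (fun k => by linarith [(abs_le.mp (h k)).1]) v
  rw [abs_le]; constructor <;> linarith

omit hl hn

/-- Projection on the direction `τ` of the image of the unit vector of angle `t`. -/
def ent (l : ℝ) (φ : ℕ → ℝ) (n : ℕ) (t τ : ℝ) : ℝ := rad l φ n t * Real.cos (ang l φ n t - τ)

lemma norm_exp_sub_exp (x y : ℝ) :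
    ‖Complex.exp (2 * x * Complex.I) - Complex.exp (2 * y * Complex.I)‖ = 2 * |Real.sin (x - y)| := by
  have h1 : Complex.exp (2 * x * Complex.I) - Complex.exp (2 * y * Complex.I) =
      Complex.exp ((2 * y : ℝ) * Complex.I) *
        (Complex.exp (Complex.I * ((2 * (x - y) : ℝ) : ℂ)) - 1) := by
    rw [mul_sub, ← Complex.exp_add, mul_one]
    congr 2 <;> push_cast <;> ring
  rw [h1, norm_mul, Complex.norm_exp_ofReal_mul_I, Complex.norm_exp_I_mul_ofReal_sub_one, one_mul,
    mul_div_cancel_left₀ _ (two_ne_zero), norm_mul, Real.norm_eq_abs, Real.norm_eq_abs, abs_two]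

include hl hn in
open Polynomial in
lemma abs_ent_eq_of_poly {τ : ℝ} {P : ℂ[X]} (hP : P.natDegree ≤ n)
    (hev : ∀ θ : ℝ, P.eval (Complex.exp (2 * θ * Complex.I)) = Complex.exp (n * θ * Complex.I) *
        (ent l (fun k => φ k + θ) n t τ : ℝ)) (θ : ℝ) :
    |ent l (fun k => φ k + θ) n t τ| = ‖P.coeff n‖ * ∏ j ∈ Finset.range n,
      (2 * |Real.sin (θ - rootAt l φ n t (τ + π / 2 + j * π))|) := by
  have hpi := Real.pi_pos
  set r : ℕ → ℝ := fun j => rootAt l φ n t (τ + π / 2 + j * π) with hr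
  have hang : ∀ j, ang l (fun k => φ k + r j) n t = τ + π / 2 + j * π := fun j =>
    ang_rootAt hl φ hn t _
  set z : ℕ → ℂ := fun j => Complex.exp (2 * r j * Complex.I) with hz
  have hmono : ∀ (i : ℕ) (x : ℝ), ang l (fun k => φ k + (x + i * π)) n t =
      ang l (fun k => φ k + x) n t + i * n * π := by
    intro i x
    induction i with
    | zero => simp
    | succ i ih =>
      have := ang_add_pi_sites (l := l) (fun k => φ k + (x + i * π)) n t
      rw [ih] at this
      rw [show (fun k => φ k + (x + ((i + 1 : ℕ) : ℝ) * π)) = fun k => φ k + (x + i * π) + π by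
        funext k; push_cast; ring, this]
      push_cast; ring
  have hno : ∀ i j : ℕ, i < n → j < n → ∀ k : ℕ, r i = r j + k * π → i = j := by
    intro i j hi hj k hk
    have h1 := hang i
    rw [hk, hmono, hang j] at h1
    have h2 : ((j + k * n : ℕ) : ℝ) * π = (i : ℕ) * π := by push_cast; linarith
    have h3 : j + k * n = i := by exact_mod_cast mul_right_cancel₀ hpi.ne' h2
    rcases Nat.eq_zero_or_pos k with rfl | hk0
    · omega
    · nlinarith
  have hinj : Set.InjOn z (Finset.range n : Set ℕ) := by
    intro i hi j hj hij
    simp only [Finset.coe_range, Set.mem_Iio] at hi hj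
    obtain ⟨m, hm⟩ := Complex.exp_eq_exp_iff_exists_int.mp hij
    have h1 : r i = r j + m * π := by
      have h2 : ((2 * r i : ℝ) : ℂ) = ((2 * r j + m * (2 * π) : ℝ) : ℂ) := by
        apply mul_right_cancel₀ Complex.I_ne_zero
        push_cast
        linear_combination hm
      have h3 := Complex.ofReal_injective h2
      linarith
    obtain ⟨k, rfl | rfl⟩ := m.eq_nat_or_neg
    · exact hno i j hi hj k (by simpa using h1)
    · exact (hno j i hj hi k (by push_cast at h1; linarith)).symm
  set R : ℂ[X] := C (P.coeff n) * ∏ j ∈ Finset.range n, (X - C (z j)) with hR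
  have hmon : (∏ j ∈ Finset.range n, (X - C (z j))).Monic :=
    monic_prod_of_monic _ _ fun j _ => monic_X_sub_C _
  have hdeg : (∏ j ∈ Finset.range n, (X - C (z j))).natDegree = n := by
    rw [natDegree_prod_of_monic _ _ fun j _ => monic_X_sub_C _]; simp
  have hPR : P = R := by
    refine eq_of_degree_sub_lt_of_eval_index_eq (Finset.range n) hinj ?_ ?_
    · rw [Finset.card_range, degree_lt_iff_coeff_zero]
      intro m hm
      rw [coeff_sub, hR, coeff_C_mul]
      rcases hm.eq_or_lt with rfl | hlt
      · have := hmon.coeff_natDegree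
        rw [hdeg] at this
        rw [this]; ring
      · have := coeff_eq_zero_of_natDegree_lt (hdeg.trans_lt hlt)
        rw [coeff_eq_zero_of_natDegree_lt (hP.trans_lt hlt), this]; ring
    · intro j hj
      rw [hev, ent, hang j, show τ + π / 2 + j * π - τ = π / 2 + j * π by ring]
      have : Real.cos (π / 2 + j * π) = 0 := by
        rw [Real.cos_add_nat_mul_pi]; simp
      rw [this, hR, eval_mul, eval_prod, Finset.prod_eq_zero hj (by simp [hz])]
      simp
  have h1 := congrArg norm (hev θ)
  have h2 : ‖Complex.exp (n * θ * Complex.I)‖ = 1 := by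
    have := Complex.norm_exp_ofReal_mul_I (n * θ)
    push_cast at this; exact this
  rw [norm_mul, h2, one_mul, Complex.norm_real, Real.norm_eq_abs] at h1
  rw [← h1, hPR, hR, eval_mul, eval_C, norm_mul, eval_prod, norm_prod]
  congr 1
  · rw [coeff_C_mul]
    have := hmon.coeff_natDegree
    rw [hdeg] at this
    rw [this, mul_one]
  · refine Finset.prod_congr rfl fun j _ => ?_
    rw [eval_sub, eval_X, eval_C, norm_exp_sub_exp]

include hl hn in
lemma exists_abs_ent_eq {τ : ℝ} (hτ : τ = 0 ∨ τ = π / 2) : ∃ κ > 0, (τ = 0 → (l / 2) ^ n ≤ κ) ∧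
    ∀ (φ : ℕ → ℝ) (θ : ℝ), |ent l (fun k => φ k + θ) n t τ| = κ * ∏ j ∈ Finset.range n,
      (2 * |Real.sin (θ - rootAt l φ n t (τ + π / 2 + j * π))|) := by
  have hli : 0 < l⁻¹ := inv_pos.mpr hl
  rcases hτ with rfl | rfl
  · refine ⟨l / 2 * ((l + l⁻¹) / 2) ^ (n - 1), by positivity, fun _ => ?_, fun φ θ => ?_⟩
    · obtain ⟨m, rfl⟩ : ∃ m, n = m + 1 := ⟨n - 1, by omega⟩
      rw [pow_succ', Nat.add_sub_cancel]
      gcongr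
      linarith
    · obtain ⟨P, Q, hP, -, -, hc, hev⟩ := exists_poly hl φ t n
      rw [← (hc hn).1]
      exact abs_ent_eq_of_poly hl φ hn t hP (fun θ => by rw [(hev θ).1, ent, sub_zero]) θ
  · refine ⟨l⁻¹ / 2 * ((l + l⁻¹) / 2) ^ (n - 1), by positivity, fun h => ?_, fun φ θ => ?_⟩
    · exact absurd h (by positivity)
    · obtain ⟨P, Q, -, hQ, -, hc, hev⟩ := exists_poly hl φ t n
      rw [← (hc hn).2]
      exact abs_ent_eq_of_poly hl φ hn t hQ
        (fun θ => by rw [(hev θ).2, ent, Real.cos_sub_pi_div_two]) θ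

end

lemma integral_log_sin_sub (a r : ℝ) :
    IntervalIntegrable (fun θ => Real.log 2 + Real.log (Real.sin (θ - r))) MeasureTheory.volume
      a (a + π) ∧
    ∫ θ in a..a + π, (Real.log 2 + Real.log (Real.sin (θ - r))) = 0 := by
  have h1 : IntervalIntegrable (fun θ => Real.log (Real.sin (θ - r))) MeasureTheory.volume
      a (a + π) := by
    have := (intervalIntegrable_log_sin (a := a - r) (b := a + π - r)).comp_sub_right r
    simpa using this
  refine ⟨intervalIntegrable_const.add h1, ?_⟩
  have hper : Function.Periodic (fun θ => Real.log (Real.sin θ)) π := fun θ => by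
    simp only [Real.sin_add_pi, Real.log_neg_eq_log]
  rw [intervalIntegral.integral_add intervalIntegrable_const h1,
    intervalIntegral.integral_comp_sub_right (fun θ => Real.log (Real.sin θ)),
    show a + π - r = (a - r) + π by ring, hper.intervalIntegral_add_eq _ 0, zero_add,
    integral_log_sin_zero_pi, intervalIntegral.integral_const]
  simp; ring

lemma abs_ent_le_rad {l : ℝ} (hl : 0 < l) (φ : ℕ → ℝ) (n : ℕ) (t τ : ℝ) :
    |ent l φ n t τ| ≤ rad l φ n t := by
  rw [ent, abs_mul, abs_of_pos (rad_pos hl φ n t)]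
  exact mul_le_of_le_one_right (rad_pos hl φ n t).le (Real.abs_cos_le_one _)

lemma continuous_nr_sites {X : Type*} [TopologicalSpace X] {l : ℝ} (hl : 0 < l) {Φ : X → ℕ → ℝ}
    (hΦ : ∀ k, Continuous fun p => Φ p k) (n : ℕ) : Continuous fun p => nr l (Φ p) n :=
  (continuous_rad_sites hl hΦ n 0).add (continuous_rad_sites hl hΦ n (π / 2))

/-- Averaged growth over the phase. -/
lemma pi_mul_log_le_integral {l : ℝ} (hl : 0 < l) (φ : ℕ → ℝ) {n : ℕ} (hn : 1 ≤ n) (a : ℝ) :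
    π * (n * Real.log (l / 2)) ≤ ∫ θ in a..a + π, Real.log (nr l (fun k => φ k + θ) n) := by
  obtain ⟨κ, hκ, hκl, hent⟩ := exists_abs_ent_eq hl hn 0 (τ := 0) (Or.inl rfl)
  set r : ℕ → ℝ := fun j => rootAt l φ n 0 (0 + π / 2 + j * π) with hr
  have hI : IntervalIntegrable (fun θ => Real.log κ + ∑ j ∈ Finset.range n,
      (Real.log 2 + Real.log (Real.sin (θ - r j)))) MeasureTheory.volume a (a + π) := by
    refine intervalIntegrable_const.add ?_
    have := IntervalIntegrable.sum (Finset.range n)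
      (f := fun j θ => Real.log 2 + Real.log (Real.sin (θ - r j)))
      (fun j _ => (integral_log_sin_sub a (r j)).1)
    have he : (∑ j ∈ Finset.range n, fun θ => Real.log 2 + Real.log (Real.sin (θ - r j))) =
        fun θ => ∑ j ∈ Finset.range n, (Real.log 2 + Real.log (Real.sin (θ - r j))) := by
      funext θ; rw [Finset.sum_apply]
    rw [he] at this
    exact this
  have hc : Continuous fun θ : ℝ => Real.log (nr l (fun k => φ k + θ) n) :=
    (continuous_nr_sites hl (fun k => by fun_prop) n).log fun θ => by
      have := two_le_nr hl (fun k => φ k + θ) n; linarith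
  have hval : ∫ θ in a..a + π, (Real.log κ + ∑ j ∈ Finset.range n,
      (Real.log 2 + Real.log (Real.sin (θ - r j)))) = π * Real.log κ := by
    rw [intervalIntegral.integral_add intervalIntegrable_const, intervalIntegral.integral_finsetSum
      fun j _ => (integral_log_sin_sub a (r j)).1,
      Finset.sum_eq_zero fun j _ => (integral_log_sin_sub a (r j)).2]
    · simp
    · have := hI.sub (intervalIntegrable_const (c := Real.log κ))
      simpa using this
  have hlog : n * Real.log (l / 2) ≤ Real.log κ := by
    rw [← Real.log_pow]
    exact Real.log_le_log (by positivity) (hκl rfl)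
  calc π * (n * Real.log (l / 2)) ≤ π * Real.log κ := by gcongr
    _ = _ := hval.symm
    _ ≤ _ := by
      refine intervalIntegral.integral_mono_ae (by linarith [Real.pi_pos]) hI
        (hc.intervalIntegrable _ _) ?_
      have hcount : (⋃ p : ℕ × ℤ, {r p.1 + p.2 * π} : Set ℝ).Countable :=
        Set.countable_iUnion fun p => Set.countable_singleton _
      filter_upwards [(hcount.ae_notMem MeasureTheory.volume)] with θ hθ
      have hs : ∀ j, Real.sin (θ - r j) ≠ 0 := by
        intro j h0
        obtain ⟨k, hk⟩ := Real.sin_eq_zero_iff.mp h0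
        exact hθ (Set.mem_iUnion.mpr ⟨(j, k), by simp; linarith⟩)
      have hp : ∀ j ∈ Finset.range n, 2 * |Real.sin (θ - r j)| ≠ 0 := fun j _ =>
        mul_ne_zero two_ne_zero (abs_ne_zero.mpr (hs j))
      have h1 : Real.log |ent l (fun k => φ k + θ) n 0 0| = Real.log κ + ∑ j ∈ Finset.range n,
          (Real.log 2 + Real.log (Real.sin (θ - r j))) := by
        rw [hent φ θ, Real.log_mul hκ.ne' (Finset.prod_ne_zero_iff.mpr hp), Real.log_prod hp]
        congr 1
        refine Finset.sum_congr rfl fun j _ => ?_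
        rw [Real.log_mul two_ne_zero (abs_ne_zero.mpr (hs j)), Real.log_abs]
      rw [← h1]
      refine Real.log_le_log ?_ ((abs_ent_le_rad hl _ n 0 0).trans (rad_le_nr hl _ n 0))
      rw [hent φ θ]
      exact mul_pos hκ (Finset.prod_pos fun j hj => lt_of_le_of_ne (by positivity) (hp j hj).symm)

/-- Mean over the circle of the logarithm of the size of the `N`-step product. -/
def logInt (l α : ℝ) (ψ : ℝ → ℝ) (N : ℕ) (θ : ℝ) : ℝ :=
  ∫ x in (0 : ℝ)..1, Real.log (nr l (site α (fun y => ψ y + θ) x) N)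

section
variable {l α : ℝ} {ψ : ℝ → ℝ}

lemma continuous_log_nr (hl : 0 < l) (hψ : Continuous ψ) (N : ℕ) :
    Continuous fun p : ℝ × ℝ => Real.log (nr l (site α (fun y => ψ y + p.1) p.2) N) :=
  (continuous_nr_sites hl (fun k => by simp only [site]; fun_prop) N).log fun p => by
    have := two_le_nr hl (site α (fun y => ψ y + p.1) p.2) N; linarith

lemma log_nr_le (hl : 1 ≤ l) {N : ℕ} (hN : 1 ≤ N) (φ : ℕ → ℝ) :
    Real.log (nr l φ N) ≤ N * Real.log (2 * l) := by
  have hl0 : 0 < l := by linarith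
  rw [← Real.log_pow, mul_pow]
  have h2 := two_le_nr hl0 φ N
  refine Real.log_le_log (by linarith) ((nr_le_two_mul_pow φ hl N).trans ?_)
  gcongr
  calc (2 : ℝ) = 2 ^ 1 := by norm_num
    _ ≤ 2 ^ N := pow_le_pow_right₀ (by norm_num) hN

lemma nr_site_add_int (hper : Function.Periodic ψ 1) (θ x : ℝ) (j : ℤ) (N : ℕ) :
    nr l (site α (fun y => ψ y + θ) (x + j)) N = nr l (site α (fun y => ψ y + θ) x) N := by
  congr 1
  funext k
  simp only [site]
  rw [show x + j + k * α = x + k * α + j by ring, periodic_add_int hper]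

lemma logInt_le (hl : 1 ≤ l) (hψ : Continuous ψ) {N : ℕ} (hN : 1 ≤ N) (θ : ℝ) :
    logInt l α ψ N θ ≤ N * Real.log (2 * l) := by
  have hl0 : 0 < l := by linarith
  have h := intervalIntegral.integral_mono_on (μ := MeasureTheory.volume) (zero_le_one (α := ℝ))
    (((continuous_log_nr (α := α) hl0 hψ N).comp
      (continuous_const (y := θ) |>.prodMk continuous_id)).intervalIntegrable 0 1)
    (intervalIntegrable_const (c := N * Real.log (2 * l))) (fun x _ => log_nr_le hl hN _)
  simpa [logInt] using h

lemma logInt_two_mul_le (hl : 0 < l) (hψ : Continuous ψ) (hper : Function.Periodic ψ 1) (N : ℕ)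
    (θ : ℝ) : logInt l α ψ (2 * N) θ ≤ 2 * logInt l α ψ N θ := by
  set f : ℕ → ℝ → ℝ := fun n x => Real.log (nr l (site α (fun y => ψ y + θ) x) n) with hf
  have hfc : ∀ n, Continuous (f n) := fun n => (continuous_log_nr (α := α) hl hψ n).comp
    (continuous_const (y := θ) |>.prodMk continuous_id)
  have hfp : Function.Periodic (f N) 1 := fun x => by
    have := nr_site_add_int (l := l) (α := α) hper θ x 1 N
    simp only [hf]
    rw [← this]; simp
  have hle : ∀ x, f (2 * N) x ≤ f N (x + N * α) + f N x := by
    intro x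
    have h1 := two_le_nr hl (site α (fun y => ψ y + θ) x) N
    have h2 := two_le_nr hl (site α (fun y => ψ y + θ) (x + N * α)) N
    have h3 := two_le_nr hl (site α (fun y => ψ y + θ) x) (2 * N)
    simp only [hf]
    rw [← Real.log_mul (by linarith) (by linarith)]
    refine Real.log_le_log (by linarith) ?_
    have := nr_add_le hl (site α (fun y => ψ y + θ) x) N N
    rw [two_mul]
    convert this using 4 with k
    simp only [site]; congr 2; push_cast; ring
  have hshift : ∫ x in (0 : ℝ)..1, f N (x + N * α) = ∫ x in (0 : ℝ)..1, f N x := by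
    rw [intervalIntegral.integral_comp_add_right (f N)]
    have := hfp.intervalIntegral_add_eq (N * α) 0
    rw [zero_add (1 : ℝ)] at this
    rwa [zero_add, add_comm (1 : ℝ)]
  calc logInt l α ψ (2 * N) θ ≤ ∫ x in (0 : ℝ)..1, (f N (x + N * α) + f N x) :=
        intervalIntegral.integral_mono_on zero_le_one ((hfc _).intervalIntegrable _ _)
          ((((hfc N).comp (by fun_prop)).add (hfc N)).intervalIntegrable _ _) fun x _ => hle x
    _ = 2 * logInt l α ψ N θ := by
        have hfs : Continuous fun x => f N (x + N * α) := (hfc N).comp (by fun_prop)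
        rw [intervalIntegral.integral_add (hfs.intervalIntegrable _ _)
          ((hfc N).intervalIntegrable _ _), hshift, two_mul]
        rfl

lemma continuous_logInt (hl : 0 < l) (hψ : Continuous ψ) (N : ℕ) :
    Continuous (logInt l α ψ N) :=
  intervalIntegral.continuous_parametric_intervalIntegral_of_continuous'
    (f := fun θ x => Real.log (nr l (site α (fun y => ψ y + θ) x) N))
    (continuous_log_nr hl hψ N) 0 1

lemma le_integral_logInt (hl : 0 < l) (hψ : Continuous ψ) {N : ℕ} (hN : 1 ≤ N) (a : ℝ) :
    π * (N * Real.log (l / 2)) ≤ ∫ θ in a..a + π, logInt l α ψ N θ := by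
  have hc := continuous_log_nr (α := α) hl hψ N
  unfold logInt
  rw [MeasureTheory.intervalIntegral_intervalIntegral_swap]
  · have h := intervalIntegral.integral_mono_on (μ := MeasureTheory.volume) (zero_le_one (α := ℝ))
      (intervalIntegrable_const (c := π * (N * Real.log (l / 2))))
      ((intervalIntegral.continuous_parametric_intervalIntegral_of_continuous'
        (f := fun x θ => Real.log (nr l (site α (fun y => ψ y + θ) x) N))
        (hc.comp continuous_swap) a (a + π)).intervalIntegrable 0 1)
      (fun x _ => pi_mul_log_le_integral hl (site α ψ x) hN a)
    simpa using h
  · refine MeasureTheory.IntegrableOn.mono_set (hc.continuousOn.integrableOn_compact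
      (isCompact_uIcc.prod isCompact_uIcc)) (Set.prod_mono Set.uIoc_subset_uIcc Set.uIoc_subset_uIcc)

/-- Parameters for which the averaged growth is small at scale `2 ^ j`. -/
def slowSet (l α : ℝ) (ψ : ℝ → ℝ) (j : ℕ) : Set ℝ :=
  {θ | logInt l α ψ (2 ^ j) θ < 3 / 4 * ((2 ^ j : ℕ) * Real.log (2 * l))}

lemma slowSet_mono (hl : 0 < l) (hψ : Continuous ψ) (hper : Function.Periodic ψ 1) :
    Monotone (slowSet l α ψ) := by
  refine monotone_nat_of_le_succ fun j θ hθ => ?_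
  simp only [slowSet, Set.mem_ofPred_eq] at *
  rw [pow_succ']
  have := logInt_two_mul_le (α := α) hl hψ hper (2 ^ j) θ
  push_cast at *
  linarith

open MeasureTheory in
lemma volume_slowSet_le (hl : 2 < l) (hψ : Continuous ψ) (j : ℕ) (a : ℝ) :
    volume (slowSet l α ψ j ∩ Set.Ioc a (a + π)) ≤
      ENNReal.ofReal (4 * π * Real.log 4 / Real.log (2 * l)) := by
  have hl0 : 0 < l := by linarith
  have hpi := Real.pi_pos
  set N : ℕ := 2 ^ j with hN
  have hN1 : 1 ≤ N := Nat.one_le_two_pow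
  have hNr : (0 : ℝ) < N := by exact_mod_cast hN1
  set L := Real.log (2 * l) with hL
  have hLpos : 0 < L := Real.log_pos (by linarith)
  set h : ℝ → ℝ := fun θ => N * L - logInt l α ψ N θ with hh
  have hhc : Continuous h := continuous_const.sub (continuous_logInt hl0 hψ N)
  have hnn : ∀ θ, 0 ≤ h θ := fun θ => sub_nonneg.mpr (logInt_le (by linarith) hψ hN1 θ)
  have hint : ∫ θ in a..a + π, h θ ≤ π * (N * Real.log 4) := by
    rw [intervalIntegral.integral_sub intervalIntegrable_const
      ((continuous_logInt hl0 hψ N).intervalIntegrable _ _)]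
    have h1 := le_integral_logInt (α := α) hl0 hψ hN1 a
    have h2 : L - Real.log (l / 2) = Real.log 4 := by
      rw [hL, ← Real.log_div (by positivity) (by positivity)]; congr 1; field_simp; norm_num
    simp only [intervalIntegral.integral_const, add_sub_cancel_left, smul_eq_mul]
    rw [← h2]; linarith
  rw [intervalIntegral.integral_of_le (by linarith)] at hint
  have hI : Integrable h (volume.restrict (Set.Ioc a (a + π))) :=
    (hhc.integrableOn_Icc (a := a) (b := a + π)).mono_set Set.Ioc_subset_Icc_self
  have hM := mul_meas_ge_le_integral_of_nonneg (Filter.Eventually.of_forall hnn) hI (1 / 4 * (N * L))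
  have hsub : slowSet l α ψ j ∩ Set.Ioc a (a + π) ⊆
      {θ | 1 / 4 * (N * L) ≤ h θ} ∩ Set.Ioc a (a + π) := by
    refine Set.inter_subset_inter_left _ fun θ hθ => ?_
    have : logInt l α ψ N θ < 3 / 4 * (N * L) := hθ
    simp only [hh, Set.mem_ofPred_eq]; linarith
  have hmeas : MeasurableSet {θ | 1 / 4 * (N * L) ≤ h θ} :=
    measurableSet_le measurable_const hhc.measurable
  rw [measureReal_restrict_apply hmeas] at hM
  have hfin : volume ({θ | 1 / 4 * (N * L) ≤ h θ} ∩ Set.Ioc a (a + π)) ≠ ⊤ :=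
    ((measure_mono Set.inter_subset_right).trans_lt measure_Ioc_lt_top).ne
  refine (measure_mono hsub).trans ?_
  rw [← ENNReal.ofReal_toReal hfin]
  apply ENNReal.ofReal_le_ofReal
  rw [le_div_iff₀ hLpos]
  have h3 := hM.trans hint
  rw [measureReal_def] at h3
  set V := (volume ({θ | 1 / 4 * (N * L) ≤ h θ} ∩ Set.Ioc a (a + π))).toReal
  have h4 : N * (V * L) ≤ N * (4 * π * Real.log 4) := by linarith
  exact le_of_mul_le_mul_left h4 hNr

open MeasureTheory in
lemma volume_iUnion_slowSet_le (hl : 2 < l) (hψ : Continuous ψ) (hper : Function.Periodic ψ 1)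
    (a : ℝ) : volume ((⋃ j, slowSet l α ψ j) ∩ Set.Ioc a (a + π)) ≤
      ENNReal.ofReal (4 * π * Real.log 4 / Real.log (2 * l)) := by
  rw [Set.iUnion_inter, Monotone.measure_iUnion fun i j hij =>
    Set.inter_subset_inter_left _ (slowSet_mono (by linarith) hψ hper hij)]
  exact iSup_le fun j => volume_slowSet_le hl hψ j a

end

open MeasureTheory in
lemma volume_abs_sin_sub_lt_le (a c : ℝ) {δ : ℝ} (hδ : 0 ≤ δ) :
    volume {θ ∈ Set.Icc a (a + π) | |Real.sin (θ - c)| < δ} ≤ ENNReal.ofReal (10 * δ) := by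
  have hpi := Real.pi_pos
  set s := (a - c) / π with hs
  have hsub : {θ ∈ Set.Icc a (a + π) | |Real.sin (θ - c)| < δ} ⊆
      ⋃ i ∈ Finset.range 3, Set.Icc (c + (⌊s⌋ + i : ℤ) * π - π / 2 * δ)
        (c + (⌊s⌋ + i : ℤ) * π + π / 2 * δ) := by
    rintro θ ⟨⟨h1, h2⟩, h3⟩
    set r : ℤ := round ((θ - c) / π) with hr
    have hrd : |(θ - c) / π - r| ≤ 1 / 2 := abs_sub_round _
    have hrd' : |θ - c - r * π| ≤ π / 2 := by
      rw [show θ - c - r * π = ((θ - c) / π - r) * π by field_simp, abs_mul, abs_of_pos hpi]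
      nlinarith
    have hsin : |Real.sin (θ - c)| = |Real.sin (θ - c - r * π)| := by
      rw [Real.sin_sub_int_mul_pi, abs_mul, abs_zpow, abs_neg, abs_one, _root_.one_zpow, one_mul]
    have hj := Real.mul_abs_le_abs_sin hrd'
    rw [← hsin] at hj
    have hd : |θ - c - r * π| ≤ π / 2 * δ := by
      have : 2 / π * |θ - c - r * π| ≤ δ := hj.trans h3.le
      rw [div_mul_eq_mul_div, div_le_iff₀ hpi] at this
      linarith
    have hs1 : s ≤ (θ - c) / π := by rw [hs]; gcongr
    have hs2 : (θ - c) / π ≤ s + 1 := by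
      rw [hs, div_add_one hpi.ne']; gcongr; linarith
    have f1 := Int.floor_le s
    have f2 := Int.lt_floor_add_one s
    rw [abs_le] at hrd
    have r1 : ⌊s⌋ ≤ r := by
      by_contra! hlt
      have : (r : ℝ) + 1 ≤ ⌊s⌋ := by exact_mod_cast hlt
      linarith
    have r2 : r ≤ ⌊s⌋ + 2 := by
      by_contra! hlt
      have : (⌊s⌋ : ℝ) + 2 + 1 ≤ r := by exact_mod_cast hlt
      linarith
    simp only [Set.mem_iUnion]
    refine ⟨(r - ⌊s⌋).toNat, Finset.mem_range.mpr (by omega), ?_⟩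
    have e : ⌊s⌋ + ((r - ⌊s⌋).toNat : ℤ) = r := by omega
    rw [e]
    rw [abs_le] at hd
    constructor <;> linarith
  refine (measure_mono hsub).trans ((measure_biUnion_finset_le _ _).trans ?_)
  calc ∑ i ∈ Finset.range 3, volume (Set.Icc (c + (⌊s⌋ + i : ℤ) * π - π / 2 * δ)
        (c + (⌊s⌋ + i : ℤ) * π + π / 2 * δ)) = ∑ i ∈ Finset.range 3, ENNReal.ofReal (π * δ) := by
        refine Finset.sum_congr rfl fun i _ => ?_
        rw [Real.volume_Icc]; congr 1; ring
    _ = ENNReal.ofReal (3 * (π * δ)) := by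
        rw [ENNReal.ofReal_mul (by norm_num : (0 : ℝ) ≤ 3)]; simp
    _ ≤ _ := by
        apply ENNReal.ofReal_le_ofReal
        nlinarith [Real.pi_lt_d2]

/-- Parameters for which some entry of the `N`-step product nearly vanishes in the `k`-th cell. -/
def badCell (l α : ℝ) (ψ : ℝ → ℝ) (Λ : ℝ) (N K k : ℕ) : Set ℝ :=
  {θ | ∃ t ∈ ({0, π / 2} : Finset ℝ), ∃ τ ∈ ({0, π / 2} : Finset ℝ), ∃ j < N,
    |Real.sin (θ - rootAt l (site α ψ (k / K)) N t (τ + π / 2 + j * π))| < 3 * (Λ / K)}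

section
variable {l α : ℝ} {ψ : ℝ → ℝ} {Λ : ℝ}

open MeasureTheory in
lemma volume_badCell_le (hΛ : 0 ≤ Λ) (N K k : ℕ) (a : ℝ) :
    volume (badCell l α ψ Λ N K k ∩ Set.Icc a (a + π)) ≤
      ENNReal.ofReal (120 * N * (Λ / K)) := by
  have hsub : badCell l α ψ Λ N K k ∩ Set.Icc a (a + π) ⊆
      ⋃ t ∈ ({0, π / 2} : Finset ℝ), ⋃ τ ∈ ({0, π / 2} : Finset ℝ), ⋃ j ∈ Finset.range N,
        {θ ∈ Set.Icc a (a + π) |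
          |Real.sin (θ - rootAt l (site α ψ (k / K)) N t (τ + π / 2 + j * π))| < 3 * (Λ / K)} := by
    rintro θ ⟨⟨t, ht, τ, hτ, j, hj, h⟩, hθ⟩
    simp only [Set.mem_iUnion]
    exact ⟨t, ht, τ, hτ, j, Finset.mem_range.mpr hj, hθ, h⟩
  have hcard : (({0, π / 2} : Finset ℝ).card : ENNReal) ≤ 2 := by
    exact_mod_cast Finset.card_le_two
  have hΛK : 0 ≤ Λ / K := by positivity
  calc _ ≤ ∑ t ∈ ({0, π / 2} : Finset ℝ), ∑ τ ∈ ({0, π / 2} : Finset ℝ), ∑ j ∈ Finset.range N,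
        ENNReal.ofReal (10 * (3 * (Λ / K))) := by
        refine (measure_mono hsub).trans ((measure_biUnion_finset_le _ _).trans ?_)
        refine Finset.sum_le_sum fun t _ => (measure_biUnion_finset_le _ _).trans ?_
        refine Finset.sum_le_sum fun τ _ => (measure_biUnion_finset_le _ _).trans ?_
        exact Finset.sum_le_sum fun j _ => volume_abs_sin_sub_lt_le a _ (by positivity)
    _ = ({0, π / 2} : Finset ℝ).card * (({0, π / 2} : Finset ℝ).card *
          (N * ENNReal.ofReal (10 * (3 * (Λ / K))))) := by
        simp only [Finset.sum_const, nsmul_eq_mul, Finset.card_range]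
    _ ≤ 2 * (2 * (N * ENNReal.ofReal (10 * (3 * (Λ / K))))) := by gcongr
    _ = ENNReal.ofReal (2 * (2 * (N * (10 * (3 * (Λ / K)))))) := by
        rw [ENNReal.ofReal_mul (by norm_num : (0 : ℝ) ≤ 2),
          ENNReal.ofReal_mul (by norm_num : (0 : ℝ) ≤ 2), ENNReal.ofReal_mul (Nat.cast_nonneg N)]
        simp
    _ = _ := by congr 1; ring

/-- Parameters for which at least half of the cells are bad. -/
def manyBad (l α : ℝ) (ψ : ℝ → ℝ) (Λ : ℝ) (N K : ℕ) (a : ℝ) : Set ℝ :=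
  {θ | ∃ J : Finset ℕ, J ⊆ Finset.range K ∧ (K + 1) / 2 ≤ J.card ∧
    ∀ k ∈ J, θ ∈ badCell l α ψ Λ N K k ∩ Set.Icc a (a + π)}

open MeasureTheory in
lemma volume_manyBad_le (hΛ : 0 ≤ Λ) (N : ℕ) {K : ℕ} (hK : 1 ≤ K) (a : ℝ) :
    volume (manyBad l α ψ Λ N K a) ≤ ENNReal.ofReal (240 * N * (Λ / K)) := by
  have h := mul_volume_le_of_card (M := (K + 1) / 2)
    (fun k (_ : k < K) => volume_badCell_le (l := l) (α := α) (ψ := ψ) hΛ N K k a)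
    (T := manyBad l α ψ Λ N K a) fun θ hθ => hθ
  have hK0 : (K : ENNReal) ≠ 0 := by exact_mod_cast (by omega : K ≠ 0)
  have hKt : (K : ENNReal) ≠ ⊤ := ENNReal.natCast_ne_top K
  rw [← ENNReal.mul_le_mul_iff_right hK0 hKt]
  calc (K : ENNReal) * volume (manyBad l α ψ Λ N K a)
      ≤ (2 * ((K + 1) / 2 : ℕ)) * volume (manyBad l α ψ Λ N K a) := by
        gcongr
        exact_mod_cast (by omega : K ≤ 2 * ((K + 1) / 2))
    _ ≤ 2 * (K * ENNReal.ofReal (120 * N * (Λ / K))) := by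
        rw [mul_assoc]; gcongr
    _ = K * ENNReal.ofReal (240 * N * (Λ / K)) := by
        rw [show 240 * N * (Λ / K) = 2 * (120 * N * (Λ / K)) by ring,
          ENNReal.ofReal_mul (by norm_num : (0 : ℝ) ≤ 2)]
        simp only [ENNReal.ofReal_ofNat]
        ring

lemma nr_le_of_not_badCell (hl : 0 < l) (hΛ : 0 < Λ) (hL : ∀ x y, |ψ x - ψ y| ≤ Λ * |x - y|)
    {N K k : ℕ} (hN : 1 ≤ N) (hK : 1 ≤ K) {θ x y : ℝ} (hθ : θ ∉ badCell l α ψ Λ N K k)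
    (hx : |x - k / K| ≤ 1 / K) (hy : |y - k / K| ≤ 1 / K) :
    nr l (site α (fun y => ψ y + θ) x) N ≤ 4 * 2 ^ N * nr l (site α (fun y => ψ y + θ) y) N := by
  have hKr : (0 : ℝ) < K := by exact_mod_cast hK
  set η := Λ / K with hη
  have hη0 : 0 < η := by positivity
  have hroot : ∀ t v z : ℝ, |z - k / K| ≤ 1 / K →
      |rootAt l (site α ψ z) N t v - rootAt l (site α ψ (k / K)) N t v| ≤ η := fun t v z hz =>
    abs_rootAt_sub_le hl _ hN t (fun i => by
      simp only [site]
      refine (hL _ _).trans ?_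
      rw [add_sub_add_right_eq_sub, hη, show Λ / K = Λ * (1 / K) by ring]
      exact mul_le_mul_of_nonneg_left hz hΛ.le) v
  have hsinLip : ∀ u v : ℝ, |Real.sin u - Real.sin v| ≤ |u - v| := fun u v => by
    have := Real.lipschitzWith_sin.dist_le_mul u v
    simpa [Real.dist_eq] using this
  have hent : ∀ t ∈ ({0, π / 2} : Finset ℝ), ∀ τ ∈ ({0, π / 2} : Finset ℝ),
      |ent l (site α (fun y => ψ y + θ) x) N t τ| ≤
        2 ^ N * |ent l (site α (fun y => ψ y + θ) y) N t τ| := by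
    intro t ht τ hτ
    obtain ⟨κ, hκ, -, he⟩ := exists_abs_ent_eq hl hN t (τ := τ) (by simpa using hτ)
    have ex := he (site α ψ x) θ
    have ey := he (site α ψ y) θ
    change |ent l (fun i => site α ψ x i + θ) N t τ| ≤
      2 ^ N * |ent l (fun i => site α ψ y i + θ) N t τ|
    rw [ex, ey]
    have : ∏ j ∈ Finset.range N, (2 * |Real.sin (θ - rootAt l (site α ψ x) N t
        (τ + π / 2 + j * π))|) ≤ ∏ j ∈ Finset.range N, (2 * (2 * |Real.sin (θ -
          rootAt l (site α ψ y) N t (τ + π / 2 + j * π))|)) := by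
      refine Finset.prod_le_prod (fun j _ => by positivity) fun j hj => ?_
      have hb : 3 * η ≤ |Real.sin (θ - rootAt l (site α ψ (k / K)) N t (τ + π / 2 + j * π))| := by
        by_contra! hcon
        exact hθ ⟨t, ht, τ, hτ, j, Finset.mem_range.mp hj, hcon⟩
      have e1 := (hsinLip (θ - rootAt l (site α ψ x) N t (τ + π / 2 + j * π))
        (θ - rootAt l (site α ψ (k / K)) N t (τ + π / 2 + j * π)))
      have e2 := (hsinLip (θ - rootAt l (site α ψ (k / K)) N t (τ + π / 2 + j * π))
        (θ - rootAt l (site α ψ y) N t (τ + π / 2 + j * π)))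
      rw [sub_sub_sub_cancel_left, abs_sub_comm (rootAt _ _ _ _ _)] at e1
      rw [sub_sub_sub_cancel_left] at e2
      have a1 := (abs_sub_abs_le_abs_sub _ _).trans (e1.trans (hroot t _ x hx))
      have a2 := (abs_sub_abs_le_abs_sub _ _).trans (e2.trans (hroot t _ y hy))
      linarith
    rw [Finset.prod_mul_distrib (f := fun _ => (2 : ℝ)) (g := fun j : ℕ => 2 * |Real.sin (θ -
      rootAt l (site α ψ y) N t (τ + π / 2 + j * π))|), Finset.prod_const, Finset.card_range] at this
    calc _ ≤ κ * (2 ^ N * ∏ j ∈ Finset.range N, (2 * |Real.sin (θ -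
          rootAt l (site α ψ y) N t (τ + π / 2 + j * π))|)) := by gcongr
      _ = _ := by rw [mul_left_comm]
  have hrad : ∀ t, rad l (site α (fun y => ψ y + θ) x) N t ≤
      |ent l (site α (fun y => ψ y + θ) x) N t 0| +
        |ent l (site α (fun y => ψ y + θ) x) N t (π / 2)| := by
    intro t
    set R := rad l (site α (fun y => ψ y + θ) x) N t
    set A := ang l (site α (fun y => ψ y + θ) x) N t
    have hR : 0 < R := rad_pos hl _ N t
    have h1 : (1 : ℝ) ≤ |Real.cos A| + |Real.sin A| := by
      have := Real.sin_sq_add_cos_sq A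
      have i1 := Real.abs_cos_le_one A
      have i2 := Real.abs_sin_le_one A
      nlinarith [sq_abs (Real.cos A), sq_abs (Real.sin A), abs_nonneg (Real.cos A),
        abs_nonneg (Real.sin A)]
    have e1 : ent l (site α (fun y => ψ y + θ) x) N t 0 = R * Real.cos A := by rw [ent, sub_zero]
    have e2 : ent l (site α (fun y => ψ y + θ) x) N t (π / 2) = R * Real.sin A := by
      rw [ent, Real.cos_sub_pi_div_two]
    rw [e1, e2, abs_mul, abs_mul, abs_of_pos hR]
    nlinarith
  have hle : ∀ t τ, |ent l (site α (fun y => ψ y + θ) y) N t τ| ≤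
      nr l (site α (fun y => ψ y + θ) y) N := fun t τ =>
    (abs_ent_le_rad hl _ N t τ).trans (rad_le_nr hl _ N t)
  have hfin : ∀ t ∈ ({0, π / 2} : Finset ℝ), ∀ τ ∈ ({0, π / 2} : Finset ℝ),
      |ent l (site α (fun y => ψ y + θ) x) N t τ| ≤
        2 ^ N * nr l (site α (fun y => ψ y + θ) y) N := fun t ht τ hτ =>
    (hent t ht τ hτ).trans (by gcongr; exact hle t τ)
  have m0 : (0 : ℝ) ∈ ({0, π / 2} : Finset ℝ) := by simp
  have m1 : π / 2 ∈ ({0, π / 2} : Finset ℝ) := by simp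
  have := hrad 0
  have := hrad (π / 2)
  have := hfin 0 m0 0 m0
  have := hfin 0 m0 _ m1
  have := hfin _ m1 0 m0
  have := hfin _ m1 _ m1
  rw [nr]
  linarith

lemma exists_good_cell (hl : 1 ≤ l) (hψ : Continuous ψ) (hΛ : 0 < Λ)
    (hL : ∀ x y, |ψ x - ψ y| ≤ Λ * |x - y|) {N K : ℕ} (hN : 1 ≤ N) (hK : 1 ≤ K) {θ a : ℝ}
    (hθa : θ ∈ Set.Icc a (a + π)) (hθ : θ ∉ manyBad l α ψ Λ N K a)
    (hslow : 3 / 4 * (N * Real.log (2 * l)) ≤ logInt l α ψ N θ) :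
    ∃ k < K, ∀ x : ℝ, |x - k / K| ≤ 1 / K → 0 ≤ x - k / K →
      Real.exp (N * Real.log (2 * l) / 2) ≤
        4 * 2 ^ N * nr l (site α (fun y => ψ y + θ) x) N := by
  classical
  have hl0 : 0 < l := by linarith
  have hKr : (0 : ℝ) < K := by exact_mod_cast hK
  set D := N * Real.log (2 * l) with hD
  have hD0 : 0 < D := mul_pos (by exact_mod_cast hN) (Real.log_pos (by linarith))
  set f : ℝ → ℝ := fun x => Real.log (nr l (site α (fun y => ψ y + θ) x) N) with hf
  have hfc : Continuous f := (continuous_log_nr (α := α) hl0 hψ N).comp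
    (continuous_const (y := θ) |>.prodMk continuous_id)
  by_contra! hcon
  set J := (Finset.range K).filter fun k => θ ∈ badCell l α ψ Λ N K k with hJ
  have hJc : 2 * J.card < K := by
    by_contra! h
    exact hθ ⟨J, Finset.filter_subset _ _, by omega, fun k hk => ⟨(Finset.mem_filter.mp hk).2, hθa⟩⟩
  have hsum : ∑ k ∈ Finset.range K, ∫ x in (k / K : ℝ)..((k + 1 : ℕ) / K : ℝ), f x =
      logInt l α ψ N θ := by
    rw [intervalIntegral.sum_integral_adjacent_intervals (a := fun k : ℕ => (k / K : ℝ))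
      fun k _ => hfc.intervalIntegrable _ _]
    rw [logInt, Nat.cast_zero, zero_div, div_self hKr.ne']
  have hterm : ∀ k ∈ Finset.range K, ∫ x in (k / K : ℝ)..((k + 1 : ℕ) / K : ℝ), f x ≤
      (1 / K) * (D / 2) + if k ∈ J then (1 / K) * (D / 2) else 0 := by
    intro k hk
    have hkk : (k / K : ℝ) ≤ ((k + 1 : ℕ) / K : ℝ) := by gcongr; simp
    have hlen : ((k + 1 : ℕ) / K : ℝ) - k / K = 1 / K := by push_cast; ring
    have hconst : ∀ c, (∀ x ∈ Set.Icc (k / K : ℝ) ((k + 1 : ℕ) / K : ℝ), f x ≤ c) →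
        ∫ x in (k / K : ℝ)..((k + 1 : ℕ) / K : ℝ), f x ≤ 1 / K * c := by
      intro c hc
      have := intervalIntegral.integral_mono_on (μ := MeasureTheory.volume) hkk
        (hfc.intervalIntegrable _ _) (intervalIntegrable_const (c := c)) hc
      rwa [intervalIntegral.integral_const, hlen, smul_eq_mul] at this
    by_cases hkJ : k ∈ J
    · rw [if_pos hkJ]
      refine (hconst D fun x _ => log_nr_le hl hN _).trans (le_of_eq (by ring))
    · rw [if_neg hkJ, add_zero]
      have hnb : θ ∉ badCell l α ψ Λ N K k := fun h => hkJ (Finset.mem_filter.mpr ⟨hk, h⟩)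
      obtain ⟨y, hy, hy0, hylt⟩ := hcon k (Finset.mem_range.mp hk)
      refine hconst (D / 2) fun x hx => ?_
      have hx' : |x - k / K| ≤ 1 / K := by
        rw [← hlen, abs_le]; constructor <;> linarith [hx.1, hx.2]
      have h1 := nr_le_of_not_badCell (α := α) hl0 hΛ hL hN hK hnb hx' hy
      have h2 := two_le_nr hl0 (site α (fun y => ψ y + θ) x) N
      rw [hf]
      refine (Real.log_le_iff_le_exp (by linarith)).mpr (h1.trans hylt.le)
  have htot := Finset.sum_le_sum hterm
  rw [hsum, Finset.sum_add_distrib, Finset.sum_const, Finset.card_range, nsmul_eq_mul,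
    ← Finset.sum_filter, Finset.sum_const, nsmul_eq_mul] at htot
  have hJJ : ((Finset.range K).filter fun k => k ∈ J) = J := by
    ext k; simp only [hJ, Finset.mem_filter]; tauto
  rw [hJJ] at htot
  have hJr : (2 : ℝ) * J.card < K := by exact_mod_cast hJc
  have e : (K : ℝ) * (1 / K * (D / 2)) + J.card * (1 / K * (D / 2)) =
      D / 2 + (2 * J.card) / K * (D / 4) := by field_simp; ring
  have hlt : (2 * J.card : ℝ) / K < 1 := (div_lt_one hKr).mpr hJr
  rw [e] at htot
  nlinarith

end

section
variable {l α : ℝ} {ψ : ℝ → ℝ} {Λ : ℝ}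

lemma mem_goodSet (hl : 1 ≤ l) (hψ : Continuous ψ) (hper : Function.Periodic ψ 1) (hΛ : 0 < Λ)
    (hL : ∀ x y, |ψ x - ψ y| ≤ Λ * |x - y|) {N K : ℕ} (hN : 1 ≤ N) (hK : 1 ≤ K) {q : ℕ}
    (hKq : 4 * K ≤ q) {p : ℤ} (hpq : IsCoprime p (q : ℤ)) (hα : |α - p / q| ≤ 1 / (q : ℝ) ^ 2)
    {θ a B : ℝ} (hθa : θ ∈ Set.Icc a (a + π)) (hθ : θ ∉ manyBad l α ψ Λ N K a)
    (hslow : 3 / 4 * (N * Real.log (2 * l)) ≤ logInt l α ψ N θ)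
    (hB : B * (4 * 2 ^ N) < Real.exp (N * Real.log (2 * l) / 2)) :
    θ ∈ goodSet l α ψ N q B := by
  obtain ⟨k, -, hk⟩ := exists_good_cell hl hψ hΛ hL hN hK hθa hθ hslow
  have hKr : (0 : ℝ) < K := by exact_mod_cast hK
  have hq : (4 * K : ℝ) ≤ q := by exact_mod_cast hKq
  intro x
  obtain ⟨i, hi, j, hij⟩ := exists_orbit_near (by omega : 0 < q) hpq hα x ((k + 1 / 2) / K)
  have hqK : (2 : ℝ) / q ≤ 1 / K / 2 := by
    rw [div_div, div_le_div_iff₀ (by linarith) (by positivity)]; linarith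
  have hd := abs_le.mp (hij.trans hqK)
  have e : ((k : ℝ) + 1 / 2) / K = k / K + 1 / K / 2 := by ring
  rw [e] at hd
  have hK1 : (0 : ℝ) < 1 / K := by positivity
  have h := hk (x + i * α + j) (abs_le.mpr ⟨by linarith, by linarith⟩) (by linarith)
  rw [nr_site_add_int hper] at h
  refine ⟨i, hi.le, ?_⟩
  have h4 : (0 : ℝ) < 4 * 2 ^ N := by positivity
  by_contra! hcon
  have := mul_le_mul_of_nonneg_left hcon h4.le
  linarith

lemma DC.irrational {τ α : ℝ} (h : DC τ α) : Irrational α := by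
  obtain ⟨γ, hγ, h⟩ := h
  rintro ⟨r, rfl⟩
  have := h r.num r.den (by exact_mod_cast r.den_nz)
  rw [show ((r : ℝ) - (r.num : ℝ) / ((r.den : ℤ) : ℝ)) = 0 by
    rw [sub_eq_zero]; exact_mod_cast (Rat.num_div_den r).symm, abs_zero] at this
  have h2 : 0 < γ / |(((r.den : ℤ)) : ℝ)| ^ τ :=
    div_pos hγ (Real.rpow_pos_of_pos (abs_pos.mpr (by exact_mod_cast r.den_nz)) _)
  linarith

/-- Diophantine numbers have good rational approximations at every scale. -/
lemma DCwith.exists_denominator {τ γ α : ℝ} (h : DCwith τ γ α) {Q : ℕ} (hQ : 1 ≤ Q) :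
    ∃ (p : ℤ) (q : ℕ), 0 < q ∧ q ≤ Q ∧ IsCoprime p (q : ℤ) ∧ |α - p / q| ≤ 1 / (q : ℝ) ^ 2 ∧
      γ * Q ≤ (q : ℝ) ^ (τ - 1) := by
  obtain ⟨r, hr, hrQ⟩ := Real.exists_rat_abs_sub_le_and_den_le α hQ
  have hq : (0 : ℝ) < r.den := by exact_mod_cast r.den_pos
  have hQr : (0 : ℝ) < Q := by exact_mod_cast hQ
  have hqQ : (r.den : ℝ) ≤ Q := by exact_mod_cast hrQ
  have e : (r : ℝ) = (r.num : ℝ) / (r.den : ℝ) := by exact_mod_cast (Rat.num_div_den r).symm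
  rw [e] at hr
  refine ⟨r.num, r.den, r.den_pos, hrQ, ?_, ?_, ?_⟩
  · rw [Int.isCoprime_iff_nat_coprime]; simpa using r.reduced
  · refine hr.trans ?_
    rw [sq]
    gcongr
    linarith
  · have h1 := h r.num r.den (by exact_mod_cast r.den_nz)
    simp only [Int.cast_natCast, abs_of_pos hq] at h1
    have h2 := h1.trans hr
    have h3 : γ / (r.den : ℝ) ^ τ ≤ 1 / (Q * r.den) := h2.trans (by gcongr; linarith)
    rw [div_le_div_iff₀ (Real.rpow_pos_of_pos hq _) (by positivity), one_mul] at h3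
    rw [Real.rpow_sub_one hq.ne', le_div_iff₀ hq]
    linarith

lemma DC.fwdDense {τ α : ℝ} (hτ : 2 < τ) (h : DC τ α) : FwdDense α := by
  obtain ⟨γ, hγ, h⟩ := h
  intro ε hε x y
  have hex : ∃ Q : ℕ, 1 ≤ Q ∧ (2 / ε + 1) ^ (τ - 1) ≤ γ * Q := by
    obtain ⟨Q, hQ⟩ := exists_nat_ge (((2 / ε + 1) ^ (τ - 1)) / γ)
    rw [div_le_iff₀ hγ] at hQ
    refine ⟨Q + 1, by omega, ?_⟩
    push_cast
    nlinarith
  obtain ⟨Q, hQ1, hQ⟩ := hex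
  obtain ⟨p, q, hq, -, hpq, hα, hγq⟩ := h.exists_denominator hQ1
  obtain ⟨i, -, j, hij⟩ := exists_orbit_near hq hpq hα x y
  have hqr : (0 : ℝ) < q := by exact_mod_cast hq
  have h1 : 2 / ε + 1 ≤ q :=
    (Real.rpow_le_rpow_iff (by positivity) hqr.le (by linarith)).mp (hQ.trans hγq)
  refine ⟨i, j, hij.trans_lt ?_⟩
  rw [div_lt_iff₀ hqr]
  have : 2 / ε < q := by linarith
  rw [div_lt_iff₀ hε] at this
  linarith

end

lemma exists_finset_classes (α : ℝ) {C : ℝ} (hC : 0 ≤ C) (M : ℕ) :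
    ∃ F : Finset (ℤ × ℤ), (∀ c : ℤ × ℤ, c.1.natAbs < M → |c.1 * α + c.2| ≤ C → c ∈ F) ∧
      (F.card : ℝ) ≤ 2 * M * (2 * C + 1) := by
  classical
  refine ⟨(Finset.Ioo (-M : ℤ) M).biUnion fun m =>
    (Finset.Icc ⌈-C - m * α⌉ ⌊C - m * α⌋).image fun k => (m, k), ?_, ?_⟩
  · rintro ⟨m, k⟩ hm hk
    simp only at hm hk
    rw [abs_le] at hk
    simp only [Finset.mem_biUnion, Finset.mem_image, Finset.mem_Ioo, Finset.mem_Icc]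
    refine ⟨m, by omega, k, ⟨Int.ceil_le.mpr (by linarith), Int.le_floor.mpr (by linarith)⟩, rfl⟩
  · have h1 : ∀ m ∈ Finset.Ioo (-M : ℤ) M, (((Finset.Icc ⌈-C - m * α⌉ ⌊C - m * α⌋).image
        fun k => ((m, k) : ℤ × ℤ)).card : ℝ) ≤ 2 * C + 1 := by
      intro m _
      refine (Nat.cast_le.mpr Finset.card_image_le).trans ?_
      rw [Int.card_Icc]
      have h2 := Int.floor_le (C - m * α)
      have h3 := Int.le_ceil (-C - m * α)
      rcases le_total 0 (⌊C - m * α⌋ + 1 - ⌈-C - m * α⌉) with h | h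
      · have e : (((⌊C - m * α⌋ + 1 - ⌈-C - m * α⌉).toNat : ℕ) : ℝ) =
            ((⌊C - m * α⌋ + 1 - ⌈-C - m * α⌉ : ℤ) : ℝ) := by
          exact_mod_cast Int.toNat_of_nonneg h
        rw [e]
        push_cast
        linarith
      · rw [Int.toNat_of_nonpos h]
        push_cast
        linarith
    calc _ ≤ ((∑ m ∈ Finset.Ioo (-M : ℤ) M, ((Finset.Icc ⌈-C - m * α⌉ ⌊C - m * α⌋).image
        fun k => ((m, k) : ℤ × ℤ)).card : ℕ) : ℝ) := Nat.cast_le.mpr Finset.card_biUnion_le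
      _ ≤ ∑ m ∈ Finset.Ioo (-M : ℤ) M, (2 * C + 1) := by
        push_cast
        exact Finset.sum_le_sum h1
      _ ≤ 2 * M * (2 * C + 1) := by
        rw [Finset.sum_const, Int.card_Ioo, nsmul_eq_mul]
        gcongr
        exact_mod_cast (by omega : ((M : ℤ) - -M - 1).toNat ≤ 2 * M)

open MeasureTheory in
lemma volume_biUnion_le_card_mul {F : Finset (ℤ × ℤ)} {A : ℤ × ℤ → Set ℝ} {v n : ℝ}
    (hv : 0 ≤ v) (hA : ∀ c ∈ F, volume (A c) ≤ ENNReal.ofReal v) (hn : (F.card : ℝ) ≤ n) :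
    volume (⋃ c ∈ F, A c) ≤ ENNReal.ofReal (n * v) := by
  refine (measure_biUnion_finset_le _ _).trans ((Finset.sum_le_sum hA).trans ?_)
  rw [Finset.sum_const, nsmul_eq_mul, ← ENNReal.ofReal_natCast,
    ← ENNReal.ofReal_mul (Nat.cast_nonneg _)]
  exact ENNReal.ofReal_le_ofReal (by gcongr)

/-- Parameters with a section of class `(m, k)`, `M ≤ |m| < M'`, whose `N`-step products are
large on average. -/
def levelSet (l α : ℝ) (ψ : ℝ → ℝ) (a b : ℝ) (N M M' : ℕ) : Set ℝ :=
  {θ | ∃ c : ℤ × ℤ, M ≤ c.1.natAbs ∧ c.1.natAbs < M' ∧ θ ∈ classSet l α ψ a b c ∧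
    3 / 4 * (N * Real.log (2 * l)) ≤ logInt l α ψ N θ}

section
variable {l α : ℝ} {ψ : ℝ → ℝ} {Λ : ℝ}

lemma abs_class_le {a b C : ℝ} (hC : ∀ x, ∀ θ ∈ Set.Icc a b, |ψ x + θ| ≤ C) {c : ℤ × ℤ} {θ : ℝ}
    (h : θ ∈ classSet l α ψ a b c) : |c.1 * α + c.2| ≤ 1 / 2 + C / π := by
  obtain ⟨hθ, S, hS⟩ := h
  exact hS.class_abs_le fun x => hC x θ hθ

open MeasureTheory in
lemma volume_levelSet_le (hl : 1 ≤ l) (hψ : Continuous ψ) (hper : Function.Periodic ψ 1)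
    (hdense : FwdDense α) (hirr : Irrational α) (hΛ : 0 < Λ)
    (hL : ∀ x y, |ψ x - ψ y| ≤ Λ * |x - y|) {a b C : ℝ} (hba : b ≤ a + π) (hC0 : 0 ≤ C)
    (hC : ∀ x, ∀ θ ∈ Set.Icc a b, |ψ x + θ| ≤ C)
    {N K : ℕ} (hN : 1 ≤ N) (hK : 1 ≤ K) {q : ℕ} (hKq : 4 * K ≤ q) {p : ℤ}
    (hpq : IsCoprime p (q : ℤ)) (hα : |α - p / q| ≤ 1 / (q : ℝ) ^ 2) {g c B : ℝ} (hg : 0 < g)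
    (hg' : g ≤ π / 4) (hc : 0 < c) (hc1 : c ≤ 1) (hcg : c ^ 2 ≤ g)
    (hB : 2 * (1 / Real.sin g + (1 / Real.sin g * (N * l ^ 2 / c ^ 2) + 1 / c)) ≤ B)
    (hB' : B * (4 * 2 ^ N) < Real.exp (N * Real.log (2 * l) / 2)) {M M' : ℕ} (hM : 1 ≤ M) :
    volume (levelSet l α ψ a b N M M') ≤ ENNReal.ofReal (240 * N * (Λ / K) +
      2 * M' * (2 * (1 / 2 + C / π) + 1) * (4 * g) +
      4 * Λ * ((q + N + 1) * (2 * (q + N) + 1) : ℕ) / M) := by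
  have hpi := Real.pi_pos
  have hMr : (0 : ℝ) < M := by exact_mod_cast hM
  obtain ⟨F, hF, hFc⟩ := exists_finset_classes α (C := 1 / 2 + C / π) (by positivity) M'
  have hsub : levelSet l α ψ a b N M M' ⊆ manyBad l α ψ Λ N K a ∪
      (⋃ c ∈ F, classSet l α ψ a b c \ innerPart (2 * g) (classSet l α ψ a b c)) ∪
      largeClass l α ψ a b g (goodSet l α ψ N q B) M := by
    rintro θ ⟨c, h1, h2, h3, h4⟩
    by_cases hbad : θ ∈ manyBad l α ψ Λ N K a
    · exact Or.inl (Or.inl hbad)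
    have hgood : θ ∈ goodSet l α ψ N q B := mem_goodSet hl hψ hper hΛ hL hN hK hKq hpq hα
      ⟨h3.1.1, h3.1.2.trans hba⟩ hbad h4 hB'
    by_cases hin : θ ∈ innerPart (2 * g) (classSet l α ψ a b c)
    · exact Or.inr ⟨c, h1, hin, hgood⟩
    · refine Or.inl (Or.inr ?_)
      simp only [Set.mem_iUnion]
      exact ⟨c, hF c h2 (abs_class_le hC h3), h3, hin⟩
  have v1 := volume_manyBad_le (l := l) (α := α) (ψ := ψ) hΛ.le N hK a
  have v2 : volume (⋃ c ∈ F, classSet l α ψ a b c \ innerPart (2 * g) (classSet l α ψ a b c)) ≤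
      ENNReal.ofReal (2 * M' * (2 * (1 / 2 + C / π) + 1) * (4 * g)) := by
    refine volume_biUnion_le_card_mul (by positivity) (fun c _ => ?_) hFc
    refine (volume_diff_inner_le (a := a) (b := b) fun θ hθ => hθ.1).trans (le_of_eq ?_)
    rw [← ENNReal.ofReal_add (by positivity) (by positivity)]
    congr 1; ring
  have v3 : volume (largeClass l α ψ a b g (goodSet l α ψ N q B) M) ≤
      ENNReal.ofReal (4 * Λ * ((q + N + 1) * (2 * (q + N) + 1) : ℕ) / M) := by
    have h := mul_volume_largeClass_le hl hdense hirr hL hΛ.le hba hg hg' hc hc1 hcg hB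
      (q := q) M
    rw [ENNReal.ofReal_div_of_pos hMr, ENNReal.ofReal_natCast, ENNReal.le_div_iff_mul_le
      (Or.inl (by exact_mod_cast (by omega : M ≠ 0))) (Or.inl (ENNReal.natCast_ne_top M)),
      mul_comm]
    exact h
  have hΛK : 0 ≤ Λ / K := by positivity
  rw [ENNReal.ofReal_add (by positivity) (by positivity),
    ENNReal.ofReal_add (by positivity) (by positivity)]
  exact (measure_mono hsub).trans ((measure_union_le _ _).trans
    (add_le_add ((measure_union_le _ _).trans (add_le_add v1 v2)) v3))

open MeasureTheory in
lemma volume_small_classes_le (hl : 0 < l) (hdense : FwdDense α) (hψ : Continuous ψ) {a b C : ℝ}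
    (ha : ∃ x, ψ x + a = π / 2) (hb : ∃ x, ψ x + b = π / 2)
    (hC0 : 0 ≤ C) (hC : ∀ x, ∀ θ ∈ Set.Icc a b, |ψ x + θ| ≤ C) (M : ℕ) :
    volume {θ | ∃ c : ℤ × ℤ, c.1.natAbs < M ∧ θ ∈ classSet l α ψ a b c} ≤
      ENNReal.ofReal (2 * M * (2 * (1 / 2 + C / π) + 1) * (4 * l⁻¹)) := by
  have hpi := Real.pi_pos
  obtain ⟨F, hF, hFc⟩ := exists_finset_classes α (C := 1 / 2 + C / π) (by positivity) M
  have hsub : {θ | ∃ c : ℤ × ℤ, c.1.natAbs < M ∧ θ ∈ classSet l α ψ a b c} ⊆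
      ⋃ c ∈ F, classSet l α ψ a b c := by
    rintro θ ⟨c, h1, h2⟩
    simp only [Set.mem_iUnion]
    exact ⟨c, hF c h1 (abs_class_le hC h2), h2⟩
  refine (measure_mono hsub).trans (volume_biUnion_le_card_mul (by positivity) (fun c _ => ?_) hFc)
  refine volume_le_of_forall_sub_le ?_
  rintro θ₁ ⟨h1, S₁, hS₁⟩ θ₂ ⟨h2, S₂, hS₂⟩
  have hli : 0 < l⁻¹ := inv_pos.mpr hl
  rcases le_or_gt θ₂ θ₁ with h | h
  · have : 0 < 4 * l⁻¹ := by positivity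
    linarith
  have hat : Real.arctan l⁻¹ ≤ l⁻¹ := by
    have := Real.lt_tan (Real.arctan_pos.mpr hli) (Real.arctan_lt_pi_div_two l⁻¹)
    rw [Real.tan_arctan] at this
    exact this.le
  have hx : ∃ x₀, ψ x₀ + (θ₁ + θ₂) / 2 = π / 2 := by
    obtain ⟨xa, hxa⟩ := ha
    obtain ⟨xb, hxb⟩ := hb
    have hs := intermediate_value_uIcc (hψ.continuousOn (s := Set.uIcc xb xa))
    obtain ⟨x₀, -, hx₀⟩ := hs (show π / 2 - (θ₁ + θ₂) / 2 ∈ Set.uIcc (ψ xb) (ψ xa) by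
      rw [Set.mem_uIcc]
      left
      constructor <;> linarith [h1.1, h1.2, h2.1, h2.2])
    exact ⟨x₀, by linarith⟩
  obtain ⟨x₀, hx₀⟩ := hx
  have := Sec.sub_le_arctan hl hdense h hx₀ hS₁ hS₂
  linarith

end

section
variable {l α : ℝ} {ψ : ℝ → ℝ} {Λ : ℝ}

lemma block_bound {u N l g c : ℝ} (hu : 10 ≤ u) (hN : 0 ≤ N) (hNu : N ≤ u)
    (hl : l ^ 2 ≤ u ^ 33) (hg : g = (u ^ 12)⁻¹) (hc : c = (u ^ 6)⁻¹) :
    2 * (1 / Real.sin g + (1 / Real.sin g * (N * l ^ 2 / c ^ 2) + 1 / c)) ≤ u ^ 64 := by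
  have hu0 : 0 < u := by linarith
  have hg0 : 0 < g := by rw [hg]; positivity
  have hu1 : (1 : ℝ) ≤ u ^ 12 := one_le_pow₀ (by linarith)
  have hg1 : g ≤ 1 := by rw [hg]; exact inv_le_one_of_one_le₀ hu1
  have hsin : g / 2 ≤ Real.sin g := by
    refine le_trans ?_ (Real.mul_le_sin hg0.le (by linarith [Real.pi_gt_three]))
    rw [div_mul_eq_mul_div, div_le_div_iff₀ (by norm_num) Real.pi_pos]
    nlinarith [Real.pi_lt_four]
  have h1 : 1 / Real.sin g ≤ 2 * u ^ 12 := by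
    calc 1 / Real.sin g ≤ 1 / (g / 2) := by gcongr
      _ = _ := by rw [hg]; field_simp
  have h2 : N * l ^ 2 / c ^ 2 ≤ u ^ 46 := by
    have e : N * l ^ 2 / c ^ 2 = N * l ^ 2 * u ^ 12 := by rw [hc]; field_simp
    rw [e]
    calc N * l ^ 2 * u ^ 12 ≤ u * u ^ 33 * u ^ 12 := by gcongr
      _ = u ^ 46 := by ring
  have h3 : 1 / c = u ^ 6 := by rw [hc]; simp
  have hnn : 0 ≤ N * l ^ 2 / c ^ 2 := by positivity
  calc _ ≤ 2 * (2 * u ^ 12 + (2 * u ^ 12 * u ^ 46 + u ^ 6)) := by rw [h3]; gcongr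
    _ ≤ 2 * (2 * u ^ 58 + (2 * u ^ 58 + u ^ 58)) := by
        rw [mul_assoc 2 (u ^ 12), ← pow_add]
        gcongr <;> linarith
    _ = 10 * u ^ 58 := by ring
    _ ≤ u * u ^ 58 := by gcongr
    _ = u ^ 59 := by ring
    _ ≤ u ^ 64 := pow_le_pow_right₀ (by linarith) (by norm_num)

lemma block_lt_exp {x l : ℝ} (hx : 10 ≤ x) (hl : x ^ 256 ≤ l) {N : ℕ} (hN : 1 ≤ N) :
    (x ^ N) ^ 64 * (4 * 2 ^ N) < Real.exp (N * Real.log (2 * l) / 2) := by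
  have hx0 : 0 < x := by linarith
  have hl0 : 0 < l := lt_of_lt_of_le (by positivity) hl
  set u := x ^ N with hu
  have hux : x ≤ u := le_self_pow₀ (by linarith) (by omega)
  have hu10 : 10 ≤ u := hx.trans hux
  have hE : u ^ 128 ≤ Real.exp (N * Real.log (2 * l) / 2) := by
    refine le_of_sq_le_sq ?_ (Real.exp_pos _).le
    rw [← Real.exp_nat_mul, ← pow_mul]
    rw [show ((2 : ℕ) : ℝ) * (N * Real.log (2 * l) / 2) = N * Real.log (2 * l) by push_cast; ring,
      Real.exp_nat_mul, Real.exp_log (by positivity)]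
    calc u ^ (128 * 2) = (x ^ 256) ^ N := by rw [hu, ← pow_mul, ← pow_mul]; congr 1; ring
      _ ≤ (2 * l) ^ N := by gcongr; linarith
  have h2 : (2 : ℝ) ^ N ≤ u := by rw [hu]; gcongr; linarith
  refine lt_of_lt_of_le ?_ hE
  calc u ^ 64 * (4 * 2 ^ N) ≤ u ^ 64 * (4 * u) := by gcongr
    _ < u ^ 64 * (u * u) := by gcongr; linarith
    _ = u ^ 66 := by ring
    _ ≤ u ^ 128 := pow_le_pow_right₀ (by linarith) (by norm_num)

open MeasureTheory in
lemma volume_levelSet_scale {τ γ : ℝ} (hψ : Continuous ψ) (hper : Function.Periodic ψ 1)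
    (hτ : 2 < τ) (hγ : 0 < γ) (hα : DCwith τ γ α) (hΛ : 0 < Λ)
    (hL : ∀ x y, |ψ x - ψ y| ≤ Λ * |x - y|) {a b C : ℝ} (hba : b ≤ a + π) (hC0 : 0 ≤ C)
    (hC : ∀ x, ∀ θ ∈ Set.Icc a b, |ψ x + θ| ≤ C) {ν : ℕ} (hν : 10 ≤ ν) (hl1 : (ν : ℝ) ^ 256 ≤ l)
    (hl2 : l ≤ (ν : ℝ) ^ 257) {N : ℕ} (hN : 16 ≤ N) {y δ : ℝ} (hy : 4 ≤ y) (hyν : y ≤ ν)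
    (hδ : 0 < δ) (hδy : 4 ≤ δ * y)
    (hq : ∀ q : ℕ, γ * (ν : ℝ) ^ N ≤ (q : ℝ) ^ (τ - 1) → δ * y ^ N ≤ q) :
    volume (levelSet l α ψ a b N ((ν ^ N) ^ 4) ((ν ^ N) ^ 8)) ≤ ENNReal.ofReal
      ((1920 * Λ / δ + 8 * (2 * (1 / 2 + C / π) + 1) + 60 * Λ) * (4 / y * (1 / 2) ^ N)) := by
  have hpi := Real.pi_pos
  have hνr : (10 : ℝ) ≤ ν := by exact_mod_cast hν
  have hDC : DC τ α := ⟨γ, hγ, hα⟩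
  set U : ℕ := ν ^ N with hU
  set u : ℝ := (ν : ℝ) ^ N with hu
  have hUu : (U : ℝ) = u := by rw [hU, hu]; push_cast; rfl
  have huν : (ν : ℝ) ≤ u := le_self_pow₀ (by linarith) (by omega)
  have hu10 : 10 ≤ u := hνr.trans huν
  have hu0 : 0 < u := by linarith
  have hU1 : 1 ≤ U := Nat.one_le_pow _ _ (by omega)
  have hNU : N ≤ U := (Nat.lt_pow_self (by omega)).le
  have hNu : (N : ℝ) ≤ u := by rw [← hUu]; exact_mod_cast hNU
  have hl : 1 ≤ l := (one_le_pow₀ (by linarith)).trans hl1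
  have hlsq : l ^ 2 ≤ u ^ 33 := by
    calc l ^ 2 ≤ ((ν : ℝ) ^ 257) ^ 2 := by gcongr
      _ = (ν : ℝ) ^ 514 := by rw [← pow_mul]
      _ ≤ (ν : ℝ) ^ (N * 33) := pow_le_pow_right₀ (by linarith) (by omega)
      _ = u ^ 33 := by rw [hu, ← pow_mul]
  obtain ⟨p, q, hq0, hqU, hpq, hpα, hγq⟩ := hα.exists_denominator hU1
  rw [hUu] at hγq
  have hqy := hq q hγq
  have hy1 : 1 ≤ y := by linarith
  have hyN : y ≤ y ^ N := le_self_pow₀ hy1 (by omega)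
  have hyN0 : 0 < y ^ N := by positivity
  have hq4r : (4 : ℝ) ≤ q := hδy.trans ((mul_le_mul_of_nonneg_left hyN hδ.le).trans hqy)
  have hq4 : 4 ≤ q := by exact_mod_cast hq4r
  have hK : 1 ≤ q / 4 := by omega
  have hKr : (0 : ℝ) < (q / 4 : ℕ) := by exact_mod_cast hK
  have hK8 : (q : ℝ) ≤ 8 * (q / 4 : ℕ) := by exact_mod_cast (by omega : q ≤ 8 * (q / 4))
  have hu12 : (1 : ℝ) ≤ u ^ 12 := one_le_pow₀ (by linarith)
  have hg4 : (u ^ 12)⁻¹ ≤ π / 4 := by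
    have : (10 : ℝ) ≤ u ^ 12 := hu10.trans (le_self_pow₀ (by linarith) (by norm_num))
    calc (u ^ 12)⁻¹ ≤ 10⁻¹ := by gcongr
      _ ≤ π / 4 := by norm_num; linarith [Real.pi_gt_three]
  have key := volume_levelSet_le hl hψ hper (hDC.fwdDense hτ) hDC.irrational hΛ hL hba hC0 hC
    (by omega : 1 ≤ N) hK (by omega : 4 * (q / 4) ≤ q) hpq hpα (g := (u ^ 12)⁻¹)
    (c := (u ^ 6)⁻¹) (B := u ^ 64) (by positivity) hg4 (by positivity)
    (inv_le_one_of_one_le₀ (one_le_pow₀ (by linarith)))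
    (by rw [inv_pow, ← pow_mul]) (block_bound hu10 (Nat.cast_nonneg N) hNu hlsq
      rfl rfl) (block_lt_exp hνr hl1 (by omega)) (M := U ^ 4) (M' := U ^ 8)
    (Nat.one_le_pow _ _ (by omega))
  refine key.trans (ENNReal.ofReal_le_ofReal ?_)
  have hyu : y ^ N ≤ u := by rw [hu]; gcongr
  have hN1 : (1 : ℝ) ≤ N := by exact_mod_cast (by omega : 1 ≤ N)
  have hsmall : (N : ℝ) / y ^ N ≤ 4 / y * (1 / 2) ^ N := by
    have h4 : (N : ℝ) ≤ 2 ^ N := by exact_mod_cast (Nat.lt_two_pow_self (n := N)).le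
    obtain ⟨n, rfl⟩ : ∃ n, N = n + 1 := ⟨N - 1, by omega⟩
    have h5 : (4 : ℝ) ^ n ≤ y ^ n := by gcongr
    have h6 : (2 : ℝ) ^ n * 2 ^ n = 4 ^ n := by rw [← mul_pow]; norm_num
    rw [one_div, inv_pow, ← div_eq_mul_inv, div_div, div_le_div_iff₀ hyN0 (by positivity)]
    calc ((n + 1 : ℕ) : ℝ) * (y * 2 ^ (n + 1)) ≤ 2 ^ (n + 1) * (y * 2 ^ (n + 1)) := by gcongr
      _ = 4 * (y * 4 ^ n) := by rw [← h6]; ring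
      _ ≤ 4 * (y * y ^ n) := by gcongr
      _ = 4 * y ^ (n + 1) := by ring
  have hinv : 1 / u ≤ N / y ^ N := by
    rw [div_le_div_iff₀ hu0 hyN0]
    nlinarith
  have t1 : 240 * N * (Λ / (q / 4 : ℕ)) ≤ 1920 * Λ / δ * (N / y ^ N) := by
    have : Λ / (q / 4 : ℕ) ≤ 8 * Λ / (δ * y ^ N) := by
      rw [div_le_div_iff₀ hKr (by positivity)]
      nlinarith [mul_le_mul_of_nonneg_left (hqy.trans hK8) hΛ.le]
    calc 240 * N * (Λ / (q / 4 : ℕ)) ≤ 240 * N * (8 * Λ / (δ * y ^ N)) := by gcongr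
      _ = _ := by field_simp; norm_num
  have t2 : 2 * ((U ^ 8 : ℕ) : ℝ) * (2 * (1 / 2 + C / π) + 1) * (4 * (u ^ 12)⁻¹) ≤
      8 * (2 * (1 / 2 + C / π) + 1) * (N / y ^ N) := by
    have hc0 : 0 ≤ 2 * (1 / 2 + C / π) + 1 := by positivity
    have e : 2 * ((U ^ 8 : ℕ) : ℝ) * (2 * (1 / 2 + C / π) + 1) * (4 * (u ^ 12)⁻¹) =
        8 * (2 * (1 / 2 + C / π) + 1) * (1 / u ^ 4) := by
      push_cast; rw [hUu]; field_simp; norm_num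
    rw [e]
    have : 1 / u ^ 4 ≤ 1 / u := by
      gcongr; exact le_self_pow₀ (by linarith) (by norm_num)
    have := this.trans hinv
    gcongr
  have t3 : 4 * Λ * ((q + N + 1) * (2 * (q + N) + 1) : ℕ) / ((U ^ 4 : ℕ) : ℝ) ≤
      60 * Λ * (N / y ^ N) := by
    have h1 : (((q + N + 1) * (2 * (q + N) + 1) : ℕ) : ℝ) ≤ 15 * u ^ 2 := by
      rw [← hUu]
      have : (q + N + 1) * (2 * (q + N) + 1) ≤ 15 * U ^ 2 := by
        calc _ ≤ (3 * U) * (5 * U) := Nat.mul_le_mul (by omega) (by omega)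
          _ = _ := by ring
      exact_mod_cast this
    have h2 : ((U ^ 4 : ℕ) : ℝ) = u ^ 4 := by push_cast; rw [hUu]
    rw [h2]
    calc _ ≤ 4 * Λ * (15 * u ^ 2) / u ^ 4 := by gcongr
      _ = 60 * Λ * (1 / u ^ 2) := by field_simp; norm_num
      _ ≤ 60 * Λ * (N / y ^ N) := by
        have : 1 / u ^ 2 ≤ 1 / u := by
          gcongr; exact le_self_pow₀ (by linarith) (by norm_num)
        have := this.trans hinv
        gcongr
  calc _ ≤ (1920 * Λ / δ + 8 * (2 * (1 / 2 + C / π) + 1) + 60 * Λ) * (N / y ^ N) :=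
        (add_le_add (add_le_add t1 t2) t3).trans (le_of_eq (by ring))
    _ ≤ _ := by
        have hc0 : 0 ≤ 2 * (1 / 2 + C / π) + 1 := by positivity
        gcongr

end

/-- Parameters in `[a, b]` with an invariant section of some class. -/
def secSet (l α : ℝ) (ψ : ℝ → ℝ) (a b : ℝ) : Set ℝ :=
  {θ ∈ Set.Icc a b | ∃ m k S, Sec l α (fun x => ψ x + θ) m k S}

section
variable {l α : ℝ} {ψ : ℝ → ℝ} {Λ : ℝ}

lemma secSet_subset {a b : ℝ} {ν : ℕ} (hν : 2 ≤ ν) : secSet l α ψ a b ⊆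
    (({a} ∪ (⋃ j, slowSet l α ψ j) ∩ Set.Ioc a b) ∪
      {θ | ∃ c : ℤ × ℤ, c.1.natAbs < ν ^ 64 ∧ θ ∈ classSet l α ψ a b c}) ∪
      ⋃ j : ℕ, levelSet l α ψ a b (2 ^ (j + 4)) ((ν ^ 2 ^ (j + 4)) ^ 4)
        ((ν ^ 2 ^ (j + 4)) ^ 8) := by
  rintro θ ⟨hθ, m, k, S, hS⟩
  have hcl : θ ∈ classSet l α ψ a b (m, k) := ⟨hθ, S, hS⟩
  rcases eq_or_lt_of_le hθ.1 with rfl | hlt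
  · exact Or.inl (Or.inl (Or.inl rfl))
  by_cases hslow : θ ∈ ⋃ j, slowSet l α ψ j
  · exact Or.inl (Or.inl (Or.inr ⟨hslow, hlt, hθ.2⟩))
  by_cases hm : m.natAbs < ν ^ 64
  · exact Or.inl (Or.inr ⟨(m, k), hm, hcl⟩)
  have hex : ∃ j : ℕ, m.natAbs < (ν ^ 2 ^ (j + 4)) ^ 8 := by
    refine ⟨m.natAbs, ?_⟩
    have h1 : m.natAbs < 2 ^ m.natAbs := Nat.lt_two_pow_self
    have h2 : 2 ^ (m.natAbs) ≤ 2 ^ (m.natAbs + 4) := Nat.pow_le_pow_right (by norm_num) (by omega)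
    have h3 : 2 ^ (m.natAbs + 4) < ν ^ 2 ^ (m.natAbs + 4) := Nat.lt_pow_self (by omega)
    have h4 : ν ^ 2 ^ (m.natAbs + 4) ≤ (ν ^ 2 ^ (m.natAbs + 4)) ^ 8 :=
      Nat.le_self_pow (by norm_num) _
    omega
  classical
  refine Or.inr (Set.mem_iUnion.mpr ⟨Nat.find hex, (m, k), ?_, Nat.find_spec hex, hcl, ?_⟩)
  · rcases Nat.eq_zero_or_pos (Nat.find hex) with h0 | hpos
    · rw [h0]
      have e : (ν ^ 2 ^ (0 + 4)) ^ 4 = ν ^ 64 := by rw [← pow_mul]; norm_num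
      rw [e]
      exact not_lt.mp hm
    · have h := Nat.find_min hex (Nat.sub_lt hpos one_pos)
      obtain ⟨i, hi⟩ : ∃ i, Nat.find hex = i + 1 := ⟨Nat.find hex - 1, by omega⟩
      rw [hi] at h ⊢
      simp only [Nat.add_sub_cancel] at h
      have e : (ν ^ 2 ^ (i + 1 + 4)) ^ 4 = (ν ^ 2 ^ (i + 4)) ^ 8 := by
        rw [← pow_mul, ← pow_mul]; congr 1; rw [show i + 1 + 4 = i + 4 + 1 by ring, pow_succ]; ring
      rw [e]
      exact not_lt.mp h
  · have : θ ∉ slowSet l α ψ (Nat.find hex + 4) := fun h => hslow (Set.mem_iUnion.mpr ⟨_, h⟩)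
    exact not_lt.mp this

open MeasureTheory in
lemma volume_secSet_le {τ γ : ℝ} (hψ : Continuous ψ) (hper : Function.Periodic ψ 1)
    (hτ : 2 < τ) (hγ : 0 < γ) (hα : DCwith τ γ α) (hΛ : 0 < Λ)
    (hL : ∀ x y, |ψ x - ψ y| ≤ Λ * |x - y|) {a b C : ℝ} (hba : b ≤ a + π)
    (ha : ∃ x, ψ x + a = π / 2) (hb : ∃ x, ψ x + b = π / 2) (hC0 : 0 ≤ C)
    (hC : ∀ x, ∀ θ ∈ Set.Icc a b, |ψ x + θ| ≤ C) {ν : ℕ} (hν : 10 ≤ ν) (hl1 : (ν : ℝ) ^ 256 ≤ l)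
    (hl2 : l ≤ (ν : ℝ) ^ 257) {y δ : ℝ} (hy : 4 ≤ y) (hyν : y ≤ ν)
    (hδ : 0 < δ) (hδy : 4 ≤ δ * y)
    (hq : ∀ N q : ℕ, γ * (ν : ℝ) ^ N ≤ (q : ℝ) ^ (τ - 1) → δ * y ^ N ≤ q) :
    volume (secSet l α ψ a b) ≤ ENNReal.ofReal (4 * π * Real.log 4 / Real.log (2 * l) +
      8 * (2 * (1 / 2 + C / π) + 1) / ν +
      (1920 * Λ / δ + 8 * (2 * (1 / 2 + C / π) + 1) + 60 * Λ) * (8 / y)) := by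
  have hpi := Real.pi_pos
  have hνr : (10 : ℝ) ≤ ν := by exact_mod_cast hν
  have hνl : (ν : ℝ) ≤ l := (le_self_pow₀ (by linarith) (by norm_num)).trans hl1
  have hl0 : 0 < l := by linarith
  set D := 2 * (1 / 2 + C / π) + 1 with hD
  have hD0 : 0 ≤ D := by positivity
  set A := 1920 * Λ / δ + 8 * D + 60 * Λ with hA
  have hA0 : 0 ≤ A := by positivity
  have hlog : 0 < Real.log (2 * l) := Real.log_pos (by linarith)
  have hlog4 : 0 < Real.log 4 := Real.log_pos (by norm_num)
  have v1 : volume ({a} ∪ (⋃ j, slowSet l α ψ j) ∩ Set.Ioc a b) ≤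
      ENNReal.ofReal (4 * π * Real.log 4 / Real.log (2 * l)) := by
    refine (measure_union_le _ _).trans ?_
    rw [Real.volume_singleton, zero_add]
    exact (measure_mono (Set.inter_subset_inter_right _ (Set.Ioc_subset_Ioc_right hba))).trans
      (volume_iUnion_slowSet_le (by linarith) hψ hper a)
  have v2 : volume {θ | ∃ c : ℤ × ℤ, c.1.natAbs < ν ^ 64 ∧ θ ∈ classSet l α ψ a b c} ≤
      ENNReal.ofReal (8 * D / ν) := by
    refine (volume_small_classes_le hl0 (DC.fwdDense hτ ⟨γ, hγ, hα⟩) hψ ha hb hC0 hC _).trans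
      (ENNReal.ofReal_le_ofReal ?_)
    have h1 : (ν : ℝ) ^ 65 ≤ l := (pow_le_pow_right₀ (by linarith) (by norm_num)).trans hl1
    have h2 : (ν : ℝ) ^ 64 * l⁻¹ ≤ 1 / ν := by
      rw [← div_eq_mul_inv, div_le_div_iff₀ hl0 (by linarith), one_mul, ← pow_succ]
      exact h1
    calc 2 * ((ν ^ 64 : ℕ) : ℝ) * (2 * (1 / 2 + C / π) + 1) * (4 * l⁻¹)
        = 8 * D * ((ν : ℝ) ^ 64 * l⁻¹) := by rw [hD]; push_cast; ring
      _ ≤ 8 * D * (1 / ν) := by gcongr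
      _ = 8 * D / ν := by ring
  have v3 : volume (⋃ j : ℕ, levelSet l α ψ a b (2 ^ (j + 4)) ((ν ^ 2 ^ (j + 4)) ^ 4)
        ((ν ^ 2 ^ (j + 4)) ^ 8)) ≤ ENNReal.ofReal (A * (8 / y)) := by
    refine (measure_iUnion_le _).trans ?_
    have hs : Summable fun j : ℕ => A * (4 / y) * (1 / 2 : ℝ) ^ j :=
      summable_geometric_two.mul_left _
    calc _ ≤ ∑' j : ℕ, ENNReal.ofReal (A * (4 / y) * (1 / 2) ^ j) := by
          refine ENNReal.tsum_le_tsum fun j => ?_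
          have hj : 16 ≤ 2 ^ (j + 4) := by
            calc 16 = 2 ^ 4 := by norm_num
              _ ≤ 2 ^ (j + 4) := Nat.pow_le_pow_right (by norm_num) (by omega)
          refine (volume_levelSet_scale hψ hper hτ hγ hα hΛ hL hba hC0 hC hν hl1 hl2 hj hy hyν hδ
            hδy (hq _)).trans (ENNReal.ofReal_le_ofReal ?_)
          rw [mul_assoc A]
          refine mul_le_mul_of_nonneg_left (mul_le_mul_of_nonneg_left ?_ (by positivity)) hA0
          refine pow_le_pow_of_le_one (by norm_num) (by norm_num) ?_
          have : j + 4 < 2 ^ (j + 4) := Nat.lt_two_pow_self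
          omega
      _ = ENNReal.ofReal (∑' j : ℕ, A * (4 / y) * (1 / 2) ^ j) :=
          (ENNReal.ofReal_tsum_of_nonneg (fun j => by positivity) hs).symm
      _ = _ := by rw [tsum_mul_left, tsum_geometric_two]; congr 1; ring
  rw [ENNReal.ofReal_add (by positivity) (by positivity),
    ENNReal.ofReal_add (by positivity) (by positivity)]
  exact (measure_mono (secSet_subset (by omega))).trans ((measure_union_le _ _).trans
    (add_le_add ((measure_union_le _ _).trans (add_le_add v1 v2)) v3))

open MeasureTheory Filter in
lemma tendsto_volume_secSet {τ : ℝ} (hψ : Continuous ψ) (hper : Function.Periodic ψ 1)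
    (hτ : 2 < τ) (hα : DC τ α) (hΛ : 0 < Λ)
    (hL : ∀ x y, |ψ x - ψ y| ≤ Λ * |x - y|) {a b C : ℝ} (hba : b ≤ a + π)
    (ha : ∃ x, ψ x + a = π / 2) (hb : ∃ x, ψ x + b = π / 2) (hC0 : 0 ≤ C)
    (hC : ∀ x, ∀ θ ∈ Set.Icc a b, |ψ x + θ| ≤ C) :
    Tendsto (fun l => volume (secSet l α ψ a b)) atTop (nhds 0) := by
  obtain ⟨γ, hγ, hα⟩ := hα
  set s : ℝ := (τ - 1)⁻¹ with hs
  have hs0 : 0 < s := inv_pos.mpr (by linarith)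
  have hs1 : s ≤ 1 := inv_le_one_of_one_le₀ (by linarith)
  set δ : ℝ := γ ^ s with hδ
  have hδ0 : 0 < δ := Real.rpow_pos_of_pos hγ s
  set n : ℝ → ℕ := fun l => ⌊l ^ (1 / 256 : ℝ)⌋₊ with hn
  have hnt : Tendsto n atTop atTop :=
    tendsto_nat_floor_atTop.comp (tendsto_rpow_atTop (by norm_num))
  have hnr : Tendsto (fun l => (n l : ℝ)) atTop atTop := tendsto_natCast_atTop_atTop.comp hnt
  have hyt : Tendsto (fun l => (n l : ℝ) ^ s) atTop atTop := (tendsto_rpow_atTop hs0).comp hnr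
  have hδy : Tendsto (fun l => δ * (n l : ℝ) ^ s) atTop atTop := hyt.const_mul_atTop hδ0
  have hlog : Tendsto (fun l : ℝ => Real.log (2 * l)) atTop atTop :=
    Real.tendsto_log_atTop.comp (tendsto_id.const_mul_atTop two_pos)
  have hF : Tendsto (fun l => 4 * π * Real.log 4 / Real.log (2 * l) +
      8 * (2 * (1 / 2 + C / π) + 1) / (n l : ℝ) +
      (1920 * Λ / δ + 8 * (2 * (1 / 2 + C / π) + 1) + 60 * Λ) * (8 / (n l : ℝ) ^ s))
      atTop (nhds 0) := by
    have := ((hlog.const_div_atTop (4 * π * Real.log 4)).add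
      (hnr.const_div_atTop (8 * (2 * (1 / 2 + C / π) + 1)))).add
      ((hyt.const_div_atTop 8).const_mul
        (1920 * Λ / δ + 8 * (2 * (1 / 2 + C / π) + 1) + 60 * Λ))
    simpa using this
  have hF' := ENNReal.tendsto_ofReal hF
  rw [ENNReal.ofReal_zero] at hF'
  refine tendsto_of_tendsto_of_tendsto_of_le_of_le' tendsto_const_nhds hF'
    (Eventually.of_forall fun _ => zero_le) ?_
  filter_upwards [hnt.eventually_ge_atTop (2 ^ 256), hyt.eventually_ge_atTop 4,
    hδy.eventually_ge_atTop 4, eventually_gt_atTop 0] with l h1 h2 h3 hl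
  have hx0 : 0 ≤ l ^ (1 / 256 : ℝ) := Real.rpow_nonneg hl.le _
  have hxl : (l ^ (1 / 256 : ℝ)) ^ 256 = l := by
    rw [← Real.rpow_natCast, ← Real.rpow_mul hl.le]; norm_num
  have f1 : (n l : ℝ) ≤ l ^ (1 / 256 : ℝ) := Nat.floor_le hx0
  have f2 : l ^ (1 / 256 : ℝ) < n l + 1 := Nat.lt_floor_add_one _
  have hn1 : (2 : ℝ) ^ 256 ≤ n l := by exact_mod_cast h1
  have h10 : 10 ≤ n l := le_trans (by norm_num) h1
  have hn10 : (10 : ℝ) ≤ n l := by exact_mod_cast h10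
  refine volume_secSet_le hψ hper hτ hγ hα hΛ hL hba ha hb hC0 hC h10 ?_ ?_ h2 ?_ hδ0 h3 ?_
  · calc (n l : ℝ) ^ 256 ≤ (l ^ (1 / 256 : ℝ)) ^ 256 := by gcongr
      _ = l := hxl
  · calc l = (l ^ (1 / 256 : ℝ)) ^ 256 := hxl.symm
      _ ≤ (2 * (n l : ℝ)) ^ 256 := by gcongr; linarith
      _ = 2 ^ 256 * (n l : ℝ) ^ 256 := by rw [mul_pow]
      _ ≤ n l * (n l : ℝ) ^ 256 := by gcongr
      _ = (n l : ℝ) ^ 257 := by rw [← pow_succ']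
  · calc (n l : ℝ) ^ s ≤ (n l : ℝ) ^ (1 : ℝ) :=
        Real.rpow_le_rpow_of_exponent_le (by linarith) hs1
      _ = n l := Real.rpow_one _
  · intro N q hq
    have h := Real.rpow_le_rpow (by positivity) hq hs0.le
    rw [← Real.rpow_mul (Nat.cast_nonneg q), hs, mul_inv_cancel₀ (by linarith), Real.rpow_one,
      ← hs, Real.mul_rpow hγ.le (by positivity), ← Real.rpow_natCast, ← Real.rpow_mul (by positivity),
      mul_comm (N : ℝ), Real.rpow_mul (by positivity), Real.rpow_natCast] at h
    exact h

end

section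
variable {l : ℝ}

lemma rad_le_of_trig (φ : ℕ → ℝ) (n : ℕ) (t : ℝ) {R : ℝ}
    (h : ∀ A, Real.cos A * (rad l φ n t * Real.cos (ang l φ n t)) +
      Real.sin A * (rad l φ n t * Real.sin (ang l φ n t)) ≤ R) : rad l φ n t ≤ R := by
  refine le_trans (le_of_eq ?_) (h (ang l φ n t))
  linear_combination (-rad l φ n t) * Real.sin_sq_add_cos_sq (ang l φ n t)

lemma trig_le_rad (hl : 0 < l) (φ : ℕ → ℝ) (n : ℕ) (t A : ℝ) :
    |Real.cos A * (rad l φ n t * Real.cos (ang l φ n t)) +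
      Real.sin A * (rad l φ n t * Real.sin (ang l φ n t))| ≤ rad l φ n t := by
  have e : Real.cos A * (rad l φ n t * Real.cos (ang l φ n t)) +
      Real.sin A * (rad l φ n t * Real.sin (ang l φ n t)) =
      rad l φ n t * Real.cos (A - ang l φ n t) := by rw [Real.cos_sub]; ring
  rw [e, abs_mul, abs_of_pos (rad_pos hl φ n t)]
  exact mul_le_of_le_one_right (rad_pos hl φ n t).le (Real.abs_cos_le_one _)

lemma rad_le_add_sin (hl : 1 ≤ l) (φ : ℕ → ℝ) (n : ℕ) (s t : ℝ) :
    rad l φ n t ≤ rad l φ n s + |Real.sin (t - s)| * l ^ n := by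
  have hl0 : 0 < l := by linarith
  refine rad_le_of_trig φ n t fun A => ?_
  have h1 := trig_le_rad hl0 φ n s A
  have h2 := (trig_le_rad hl0 φ n (s + π / 2) A).trans (rad_le hl φ n _)
  set X := Real.cos A * (rad l φ n s * Real.cos (ang l φ n s)) +
      Real.sin A * (rad l φ n s * Real.sin (ang l φ n s)) with hX
  set Y := Real.cos A * (rad l φ n (s + π / 2) * Real.cos (ang l φ n (s + π / 2))) +
      Real.sin A * (rad l φ n (s + π / 2) * Real.sin (ang l φ n (s + π / 2))) with hY
  have e : Real.cos A * (rad l φ n t * Real.cos (ang l φ n t)) +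
      Real.sin A * (rad l φ n t * Real.sin (ang l φ n t)) =
      Real.cos (t - s) * X + Real.sin (t - s) * Y := by
    rw [hX, hY, (rad_trig_linear hl0 φ n t).1, (rad_trig_linear hl0 φ n t).2,
      (rad_trig_linear hl0 φ n s).1, (rad_trig_linear hl0 φ n s).2,
      (rad_trig_linear hl0 φ n (s + π / 2)).1, (rad_trig_linear hl0 φ n (s + π / 2)).2,
      Real.cos_add_pi_div_two, Real.sin_add_pi_div_two]
    have ec : Real.cos t = Real.cos (t - s) * Real.cos s - Real.sin (t - s) * Real.sin s := by
      rw [← Real.cos_add, sub_add_cancel]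
    have es : Real.sin t = Real.sin (t - s) * Real.cos s + Real.cos (t - s) * Real.sin s := by
      rw [← Real.sin_add, sub_add_cancel]
    rw [ec, es]
    ring
  rw [e]
  have h3 : Real.cos (t - s) * X ≤ rad l φ n s := by
    refine (le_abs_self _).trans ?_
    rw [abs_mul]
    exact (mul_le_of_le_one_left (abs_nonneg _) (Real.abs_cos_le_one _)).trans h1
  have h4 : Real.sin (t - s) * Y ≤ |Real.sin (t - s)| * l ^ n := by
    refine (le_abs_self _).trans ?_
    rw [abs_mul]
    gcongr
  linarith

lemma rad_le_add_dist (hl : 0 < l) (φ φ' : ℕ → ℝ) (n : ℕ) (t : ℝ) :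
    rad l φ n t ≤ rad l φ' n t +
      (|ent l φ n 0 0 - ent l φ' n 0 0| + |ent l φ n (π / 2) 0 - ent l φ' n (π / 2) 0| +
      (|ent l φ n 0 (π / 2) - ent l φ' n 0 (π / 2)| +
        |ent l φ n (π / 2) (π / 2) - ent l φ' n (π / 2) (π / 2)|)) := by
  refine rad_le_of_trig φ n t fun A => ?_
  have h1 := (le_abs_self _).trans (trig_le_rad hl φ' n t A)
  simp only [ent, sub_zero, Real.cos_sub_pi_div_two]
  rw [(rad_trig_linear hl φ n t).1, (rad_trig_linear hl φ n t).2]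
  rw [(rad_trig_linear hl φ' n t).1, (rad_trig_linear hl φ' n t).2] at h1
  have key : ∀ u v w : ℝ, |u| ≤ 1 → |v| ≤ 1 → u * (v * w) ≤ |w| := fun u v w hu hv => by
    refine (le_abs_self _).trans ?_
    rw [abs_mul, abs_mul]
    have := abs_nonneg w
    have := abs_nonneg v
    nlinarith [abs_nonneg u, mul_le_mul hu hv (abs_nonneg v) zero_le_one,
      mul_nonneg (abs_nonneg u) (abs_nonneg v)]
  have a1 := key _ _ (rad l φ n 0 * Real.cos (ang l φ n 0) - rad l φ' n 0 * Real.cos (ang l φ' n 0))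
    (Real.abs_cos_le_one A) (Real.abs_cos_le_one t)
  have a2 := key _ _ (rad l φ n (π / 2) * Real.cos (ang l φ n (π / 2)) -
    rad l φ' n (π / 2) * Real.cos (ang l φ' n (π / 2)))
    (Real.abs_cos_le_one A) (Real.abs_sin_le_one t)
  have a3 := key _ _ (rad l φ n 0 * Real.sin (ang l φ n 0) - rad l φ' n 0 * Real.sin (ang l φ' n 0))
    (Real.abs_sin_le_one A) (Real.abs_cos_le_one t)
  have a4 := key _ _ (rad l φ n (π / 2) * Real.sin (ang l φ n (π / 2)) -
    rad l φ' n (π / 2) * Real.sin (ang l φ' n (π / 2)))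
    (Real.abs_sin_le_one A) (Real.abs_sin_le_one t)
  nlinarith

lemma exists_int_mul_pi_of_continuous {f : ℝ → ℝ} (hf : Continuous f)
    (h : ∀ x, Real.sin (f x) = 0) : ∃ m : ℤ, ∀ x, f x = m * π := by
  choose k hk using fun x => Real.sin_eq_zero_iff.mp (h x)
  have hkc : Continuous k := by
    rw [Int.isClosedEmbedding_coe_real.isInducing.continuous_iff]
    have : (Int.cast ∘ k : ℝ → ℝ) = fun x => f x / π := by
      funext x; simp only [Function.comp]; rw [← hk x]; field_simp
    rw [this]
    exact hf.div_const π
  refine ⟨k 0, fun x => ?_⟩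
  rw [← hk x, PreconnectedSpace.constant inferInstance hkc (x := x) (y := 0)]

/-- Angles of the stable and unstable directions of a uniformly hyperbolic cocycle. -/
structure HypAngles (l α : ℝ) (φ σ υ : ℝ → ℝ) (c ρ : ℝ) : Prop where
  c_pos : 0 < c
  one_lt : 1 < ρ
  per : ∀ x, Real.sin (σ (x + 1) - σ x) = 0
  inv_s : ∀ x, Real.sin (dl l (φ x + σ x) - σ (x + α)) = 0
  inv_u : ∀ x, Real.sin (dl l (φ x + υ x) - υ (x + α)) = 0
  contr : ∀ x, ∀ n : ℕ, 1 ≤ n → rad l (site α φ x) n (σ x) < c / ρ ^ n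
  expan : ∀ x, ∀ n : ℕ, 1 ≤ n → ρ ^ n / c < rad l (site α φ x) n (υ x)

namespace HypAngles
variable {α c ρ : ℝ} {φ σ υ : ℝ → ℝ}

lemma exists_le_sin (h : HypAngles l α φ σ υ c ρ) (hl : 1 ≤ l) :
    ∃ ε > 0, ∀ x, ε ≤ |Real.sin (υ x - σ x)| := by
  have hc := h.c_pos
  obtain ⟨n, hn⟩ := ((tendsto_pow_atTop_atTop_of_one_lt h.one_lt).eventually_ge_atTop
    (2 * c) |>.and (Filter.eventually_ge_atTop 1)).exists
  have hρn : 0 < ρ ^ n := by linarith [hn.1]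
  have hln : 0 < l ^ n := by positivity
  refine ⟨1 / l ^ n, by positivity, fun x => ?_⟩
  have h1 := h.contr x n hn.2
  have h2 := h.expan x n hn.2
  have h3 := rad_le_add_sin hl (site α φ x) n (σ x) (υ x)
  have h4 : c / ρ ^ n ≤ 1 / 2 := by rw [div_le_div_iff₀ hρn two_pos]; linarith [hn.1]
  have h5 : 2 ≤ ρ ^ n / c := by rw [le_div_iff₀ hc]; exact hn.1
  rw [div_le_iff₀ hln]
  linarith

lemma continuous_exp (h : HypAngles l α φ σ υ c ρ) (hl : 0 < l) (hφ : Continuous φ) :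
    Continuous fun x => Circle.exp (2 * σ x) := by
  have hc := h.c_pos
  rw [Metric.continuous_iff']
  intro x ε hε
  obtain ⟨n, hn⟩ := ((tendsto_pow_atTop_atTop_of_one_lt h.one_lt).eventually_gt_atTop
    (2 * (c * (c + 1)) / ε) |>.and (Filter.eventually_ge_atTop 1)).exists
  have hρ1 : 1 ≤ ρ ^ n := one_le_pow₀ h.one_lt.le
  have hρn : 0 < ρ ^ n := by linarith
  have hΦ : ∀ k, Continuous fun y => site α φ y k := fun k => by simp only [site]; fun_prop
  have hent : ∀ t τ, Continuous fun y => ent l (site α φ y) n t τ := fun t τ =>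
    (continuous_rad_sites hl hΦ n t).mul
      (Real.continuous_cos.comp ((continuous_ang_sites hl hΦ n t).sub continuous_const))
  have hlim : Filter.Tendsto (fun y =>
      |ent l (site α φ x) n 0 0 - ent l (site α φ y) n 0 0| +
      |ent l (site α φ x) n (π / 2) 0 - ent l (site α φ y) n (π / 2) 0| +
      (|ent l (site α φ x) n 0 (π / 2) - ent l (site α φ y) n 0 (π / 2)| +
        |ent l (site α φ x) n (π / 2) (π / 2) - ent l (site α φ y) n (π / 2) (π / 2)|))
      (nhds x) (nhds 0) := by
    have hcont : Continuous (fun y =>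
      |ent l (site α φ x) n 0 0 - ent l (site α φ y) n 0 0| +
      |ent l (site α φ x) n (π / 2) 0 - ent l (site α φ y) n (π / 2) 0| +
      (|ent l (site α φ x) n 0 (π / 2) - ent l (site α φ y) n 0 (π / 2)| +
        |ent l (site α φ x) n (π / 2) (π / 2) - ent l (site α φ y) n (π / 2) (π / 2)|)) :=
      ((continuous_const.sub (hent _ _)).abs.add (continuous_const.sub (hent _ _)).abs).add
        ((continuous_const.sub (hent _ _)).abs.add (continuous_const.sub (hent _ _)).abs)
    have := hcont.tendsto x
    simpa using this
  filter_upwards [hlim.eventually_lt_const one_pos] with y hy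
  have h1 := rad_le_add_dist hl (site α φ x) (site α φ y) n (σ y)
  have h2 := h.contr y n hn.2
  have h3 := h.contr x n hn.2
  have h4 := rad_mul_sin_sub hl (site α φ x) n (σ x) (σ y)
  have h5 : c / ρ ^ n ≤ c := div_le_self hc.le hρ1
  have p1 := rad_pos hl (site α φ x) n (σ x)
  have p2 := rad_pos hl (site α φ x) n (σ y)
  have h6 : |Real.sin (σ y - σ x)| ≤ c / ρ ^ n * (c + 1) := by
    rw [← h4, abs_mul, abs_mul, abs_of_pos p1, abs_of_pos p2]
    refine (mul_le_of_le_one_right (by positivity) (Real.abs_sin_le_one _)).trans ?_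
    exact mul_le_mul h3.le (by linarith) p2.le (by positivity)
  have h7 : c / ρ ^ n * (c + 1) < ε / 2 := by
    have := hn.1
    rw [div_lt_iff₀ hε] at this
    rw [div_mul_eq_mul_div, div_lt_div_iff₀ hρn two_pos]
    linarith
  change dist (Circle.exp (2 * σ y) : ℂ) (Circle.exp (2 * σ x) : ℂ) < ε
  rw [Circle.coe_exp, Circle.coe_exp, Complex.dist_eq]
  push_cast
  rw [norm_exp_sub_exp]
  linarith

lemma exists_lift (h : HypAngles l α φ σ υ c ρ) (hl : 0 < l) (hφ : Continuous φ) :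
    ∃ S : ℝ → ℝ, Continuous S ∧ ∀ x, ∃ m : ℤ, S x = σ x + m * π := by
  obtain ⟨F, ⟨-, hF⟩, -⟩ := Circle.isCoveringMap_exp.existsUnique_continuousMap_lifts
    ⟨_, h.continuous_exp hl hφ⟩ (0 : ℝ) (2 * σ 0) rfl
  refine ⟨fun x => F x / 2, F.continuous.div_const 2, fun x => ?_⟩
  have := congrFun hF x
  obtain ⟨m, hm⟩ := Circle.exp_eq_exp.mp this
  exact ⟨m, by change F x / 2 = _; rw [hm]; ring⟩

end HypAngles

end

lemma abs_le_mul_abs_sin {ε d : ℝ} (hε : 0 < ε) (hε1 : ε ≤ 1) (hd : |d| ≤ π - ε) :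
    |d| ≤ π ^ 2 / (2 * ε) * |Real.sin d| := by
  have hπ := Real.pi_pos
  have h3 := Real.pi_gt_three
  have hs : |Real.sin d| = Real.sin |d| := by
    rcases le_total 0 d with h | h
    · rw [abs_of_nonneg h] at hd ⊢
      exact abs_of_nonneg (Real.sin_nonneg_of_nonneg_of_le_pi h (by linarith))
    · rw [abs_of_nonpos h] at hd ⊢
      rw [Real.sin_neg, abs_of_nonpos
        (Real.sin_nonpos_of_nonpos_of_neg_pi_le h (by linarith))]
  rw [hs]
  have h0 := abs_nonneg d
  generalize |d| = e at *
  rw [div_mul_eq_mul_div, le_div_iff₀ (by positivity)]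
  rcases le_total e (π / 2) with h | h
  · have h1 := Real.mul_le_sin h0 h
    have h2 : 2 * e ≤ π * Real.sin e := by
      have := mul_le_mul_of_nonneg_left h1 hπ.le
      field_simp at this
      linarith
    nlinarith
  · have h1 := Real.mul_le_sin (x := π - e) (by linarith) (by linarith)
    rw [Real.sin_pi_sub] at h1
    have h2 : 2 * ε ≤ π * Real.sin e := by
      have := mul_le_mul_of_nonneg_left h1 hπ.le
      field_simp at this
      linarith
    nlinarith

lemma exists_add_int_mul_pi_mem {s t : ℝ} (h : Real.sin (t - s) ≠ 0) :
    ∃ j : ℤ, s < t + j * π ∧ t + j * π < s + π := by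
  obtain ⟨j, hj, -⟩ := existsUnique_add_zsmul_mem_Ico Real.pi_pos t s
  simp only [zsmul_eq_mul] at hj
  refine ⟨j, lt_of_le_of_ne hj.1 fun e => h ?_, hj.2⟩
  rw [show t - s = (-j : ℤ) * π by push_cast; linarith]
  exact Real.sin_int_mul_pi _

lemma sin_eq_zero_of_add {s t : ℝ} (i j : ℤ) (h : Real.sin (t - s) = 0) :
    Real.sin (t + i * π - (s + j * π)) = 0 := by
  obtain ⟨k, hk⟩ := Real.sin_eq_zero_iff.mp h
  rw [show t + i * π - (s + j * π) = (k + i - j : ℤ) * π by push_cast; linarith]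
  exact Real.sin_int_mul_pi _

section
variable {l : ℝ}

lemma rad_add_int_mul_pi (hl : 1 ≤ l) (φ : ℕ → ℝ) (n : ℕ) (t : ℝ) (j : ℤ) :
    rad l φ n (t + j * π) = rad l φ n t := by
  apply le_antisymm
  · have h := rad_le_add_sin hl φ n t (t + j * π)
    rwa [add_sub_cancel_left, Real.sin_int_mul_pi, abs_zero, zero_mul, add_zero] at h
  · have h := rad_le_add_sin hl φ n (t + j * π) t
    rwa [sub_add_cancel_left, Real.sin_neg, Real.sin_int_mul_pi, neg_zero, abs_zero, zero_mul,
      add_zero] at h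

lemma sin_ang_sub_eq_zero {α : ℝ} {φ σ : ℝ → ℝ}
    (h : ∀ x, Real.sin (dl l (φ x + σ x) - σ (x + α)) = 0) (x : ℝ) (n : ℕ) :
    ∃ j : ℤ, ang l (site α φ x) n (σ x) = σ (x + n * α) + j * π := by
  induction n with
  | zero => exact ⟨0, by simp⟩
  | succ n ih =>
    obtain ⟨j, hj⟩ := ih
    obtain ⟨i, hi⟩ := Real.sin_eq_zero_iff.mp (h (x + n * α))
    refine ⟨i + j, ?_⟩
    rw [ang_succ, hj, site, ← add_assoc, dl_add_int_mul_pi]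
    push_cast
    rw [show x + (n + 1) * α = x + n * α + α by ring]
    linarith

namespace HypAngles
variable {α c ρ : ℝ} {φ σ υ : ℝ → ℝ}

/-- Replacing the stable angles by a continuous lift. -/
lemma exists_continuous (h : HypAngles l α φ σ υ c ρ) (hl : 1 ≤ l) (hφ : Continuous φ) :
    ∃ S : ℝ → ℝ, Continuous S ∧ HypAngles l α φ S υ c ρ := by
  obtain ⟨S, hS, hm⟩ := h.exists_lift (by linarith) hφ
  choose m hm using hm
  refine ⟨S, hS, h.c_pos, h.one_lt, fun x => ?_, fun x => ?_, h.inv_u, fun x n hn => ?_, h.expan⟩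
  · rw [hm, hm]
    exact sin_eq_zero_of_add _ _ (h.per x)
  · rw [hm, hm, ← add_assoc, dl_add_int_mul_pi]
    exact sin_eq_zero_of_add _ _ (h.inv_s x)
  · rw [hm, rad_add_int_mul_pi hl]
    exact h.contr x n hn

lemma tendsto_sub (h : HypAngles l α φ σ υ c ρ) (hl : 1 ≤ l) {x a u : ℝ} {j : ℤ}
    (hu : u = υ x + j * π) (hu1 : σ x < u) (hu2 : u < σ x + π) (ha1 : σ x < a)
    (ha2 : a < σ x + π) :
    Filter.Tendsto (fun n => ang l (site α φ x) n a - ang l (site α φ x) n u)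
      Filter.atTop (nhds 0) := by
  have hl0 : 0 < l := by linarith
  have hc := h.c_pos
  obtain ⟨ε, hε, hsin⟩ := h.exists_le_sin hl
  have hε1 : ε ≤ 1 := (hsin 0).trans (Real.abs_sin_le_one _)
  have hδ : 0 < Real.sin (a - σ x) := Real.sin_pos_of_pos_of_lt_pi (by linarith) (by linarith)
  set δ := Real.sin (a - σ x) with hδe
  have hbound : ∀ n : ℕ, 1 ≤ n → |ang l (site α φ x) n a - ang l (site α φ x) n u| ≤
      π ^ 2 / (2 * ε) * (c ^ 2 / δ) * (ρ⁻¹ ^ n) := by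
    intro n hn
    have hρn : 0 < ρ ^ n := pow_pos (by linarith [h.one_lt]) n
    have hρ1 : 1 ≤ ρ ^ n := one_le_pow₀ h.one_lt.le
    have mono := ang_strictMono hl0 (site α φ x) n
    have b1 := mono hu1
    have b2 := mono hu2
    have b3 := mono ha1
    have b4 := mono ha2
    rw [ang_add_pi] at b2 b4
    obtain ⟨j1, hj1⟩ := sin_ang_sub_eq_zero h.inv_s x n
    obtain ⟨j2, hj2⟩ := sin_ang_sub_eq_zero h.inv_u x n
    have hU : ε ≤ Real.sin (ang l (site α φ x) n u - ang l (site α φ x) n (σ x)) := by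
      have h0 : 0 ≤ Real.sin (ang l (site α φ x) n u - ang l (site α φ x) n (σ x)) :=
        Real.sin_nonneg_of_nonneg_of_le_pi (by linarith) (by linarith)
      rw [← abs_of_nonneg h0, hu, ang_add_int_mul_pi, hj1, hj2,
        show υ (x + n * α) + j2 * π + j * π - (σ (x + n * α) + j1 * π) =
          υ (x + n * α) - σ (x + n * α) + (j2 + j - j1 : ℤ) * π by push_cast; ring]
      rw [Real.sin_add_int_mul_pi, abs_mul, abs_neg_one_zpow, one_mul]
      exact hsin _
    have hU1 := hU.trans (Real.sin_le (by linarith))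
    have hU2 : ε ≤ π - (ang l (site α φ x) n u - ang l (site α φ x) n (σ x)) := by
      refine hU.trans ?_
      rw [← Real.sin_pi_sub]
      exact Real.sin_le (by linarith)
    have hD : |ang l (site α φ x) n a - ang l (site α φ x) n u| ≤ π - ε := by
      rw [abs_le]
      constructor <;> linarith
    refine (abs_le_mul_abs_sin hε hε1 hD).trans ?_
    rw [mul_assoc]
    refine mul_le_mul_of_nonneg_left ?_ (by positivity)
    have r1 := rad_mul_sin_sub hl0 (site α φ x) n (σ x) a
    have r2 := rad_mul_sin_sub hl0 (site α φ x) n u a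
    have c1 := h.contr x n hn
    have c2 := h.expan x n hn
    rw [← rad_add_int_mul_pi hl _ n (υ x) j, ← hu] at c2
    have p1 := rad_pos hl0 (site α φ x) n (σ x)
    have p2 := rad_pos hl0 (site α φ x) n u
    have p3 := rad_pos hl0 (site α φ x) n a
    have d1 : δ ≤ c / ρ ^ n * rad l (site α φ x) n a := by
      rw [hδe, ← r1]
      refine (mul_le_of_le_one_right (by positivity) (Real.sin_le_one _)).trans ?_
      gcongr
    rw [div_lt_iff₀ hc] at c2
    rw [div_mul_eq_mul_div, le_div_iff₀ hρn] at d1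
    have d2 : |Real.sin (ang l (site α φ x) n a - ang l (site α φ x) n u)| *
        (rad l (site α φ x) n u * rad l (site α φ x) n a) ≤ 1 := by
      rw [← abs_of_pos (mul_pos p2 p3), ← abs_mul, mul_comm, r2]
      exact Real.abs_sin_le_one _
    set s := |Real.sin (ang l (site α φ x) n a - ang l (site α φ x) n u)|
    have hs : 0 ≤ s := abs_nonneg _
    set R := rad l (site α φ x) n u
    set A := rad l (site α φ x) n a
    rw [inv_pow, ← div_eq_mul_inv, div_div, le_div_iff₀ (by positivity)]
    have d3 : δ * ρ ^ n ≤ c * A := d1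
    calc s * (δ * ρ ^ n) ≤ s * (c * A) := by gcongr
      _ ≤ s * (c * A) * (R * c) := le_mul_of_one_le_right (by positivity) (by linarith)
      _ = s * (R * A) * c ^ 2 := by ring
      _ ≤ 1 * c ^ 2 := by gcongr
      _ = c ^ 2 := one_mul _
  have hlim : Filter.Tendsto (fun n : ℕ => π ^ 2 / (2 * ε) * (c ^ 2 / δ) * (ρ⁻¹ ^ n))
      Filter.atTop (nhds 0) := by
    have hρ := h.one_lt
    have := (tendsto_pow_atTop_nhds_zero_of_lt_one (r := ρ⁻¹) (by positivity)
      (inv_lt_one_of_one_lt₀ hρ)).const_mul (π ^ 2 / (2 * ε) * (c ^ 2 / δ))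
    rwa [mul_zero] at this
  refine squeeze_zero_norm' ?_ hlim
  filter_upwards [Filter.eventually_ge_atTop 1] with n hn
  exact hbound n hn

/-- Continuous stable angles form an invariant section. -/
lemma exists_sec (h : HypAngles l α φ σ υ c ρ) (hl : 1 ≤ l) (hφ : Continuous φ) :
    ∃ m k S, Sec l α φ m k S := by
  have hl0 : 0 < l := by linarith
  obtain ⟨S, hS, H⟩ := h.exists_continuous hl hφ
  obtain ⟨m, hm⟩ := exists_int_mul_pi_of_continuous
    (f := fun x => S (x + 1) - S x) (by fun_prop) H.per
  obtain ⟨k, hk⟩ := exists_int_mul_pi_of_continuous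
    (f := fun x => dl l (φ x + S x) - S (x + α))
    (((continuous_dl hl0).comp (hφ.add hS)).sub (by fun_prop)) H.inv_s
  refine ⟨m, k, S, hS, fun x => by linarith [hm x], fun x => by linarith [hk x],
    fun x a b ha1 ha2 hb1 hb2 => ?_⟩
  obtain ⟨ε, hε, hsin⟩ := H.exists_le_sin hl
  obtain ⟨j, hj1, hj2⟩ := exists_add_int_mul_pi_mem (s := S x) (t := υ x)
    (abs_pos.mp (hε.trans_le (hsin x)))
  have t1 := H.tendsto_sub hl rfl hj1 hj2 ha1 ha2
  have t2 := H.tendsto_sub hl rfl hj1 hj2 hb1 hb2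
  simpa using t1.sub t2

end HypAngles

end

def dirVec (t : ℝ) : Fin 2 → ℝ := ![Real.cos t, Real.sin t]

lemma vnorm_smul_dirVec (r t : ℝ) : vnorm (r • dirVec t) = |r| := by
  have h : vnorm (r • dirVec t) ^ 2 = r ^ 2 := by
    rw [vnorm, EuclideanSpace.real_norm_sq_eq]
    simp [dirVec, Fin.sum_univ_two]
    linear_combination r ^ 2 * Real.sin_sq_add_cos_sq t
  rw [← abs_of_nonneg (show 0 ≤ vnorm (r • dirVec t) from norm_nonneg _)]
  exact abs_eq_abs.mpr (sq_eq_sq_iff_eq_or_eq_neg.mp h)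

lemma vnorm_dirVec (t : ℝ) : vnorm (dirVec t) = 1 := by
  simpa using vnorm_smul_dirVec 1 t

lemma dirVec_ne_zero (t : ℝ) : dirVec t ≠ 0 := by
  intro h
  have := vnorm_dirVec t
  rw [h] at this
  simp [vnorm] at this

lemma exists_smul_dirVec (v : Fin 2 → ℝ) : ∃ r t : ℝ, v = r • dirVec t := by
  refine ⟨‖(⟨v 0, v 1⟩ : ℂ)‖, Complex.arg ⟨v 0, v 1⟩, ?_⟩
  funext i
  fin_cases i
  · simp [dirVec]
  · simp [dirVec]

lemma exists_span_dirVec {p : Submodule ℝ (Fin 2 → ℝ)} (hp : Module.finrank ℝ p = 1) :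
    ∃ t, p = Submodule.span ℝ {dirVec t} := by
  obtain ⟨v, hv, hp'⟩ := finrank_eq_one_iff'.mp hp
  obtain ⟨r, t, hrt⟩ := exists_smul_dirVec v
  have hr : r ≠ 0 := by
    rintro rfl
    exact hv (Subtype.ext (by simpa using hrt))
  refine ⟨t, le_antisymm (fun w hw => ?_) ?_⟩
  · obtain ⟨c, hc⟩ := hp' ⟨w, hw⟩
    have : c • (v : Fin 2 → ℝ) = w := congrArg Subtype.val hc
    rw [Submodule.mem_span_singleton]
    exact ⟨c * r, by rw [← this, hrt, smul_smul]⟩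
  · rw [Submodule.span_singleton_le_iff_mem]
    have : dirVec t = r⁻¹ • (v : Fin 2 → ℝ) := by rw [hrt, smul_smul, inv_mul_cancel₀ hr, one_smul]
    rw [this]
    exact p.smul_mem _ v.2

lemma finrank_span_dirVec (t : ℝ) : Module.finrank ℝ (Submodule.span ℝ {dirVec t}) = 1 :=
  finrank_span_singleton (dirVec_ne_zero t)

lemma dirVec_mem_span_iff {s t : ℝ} :
    dirVec t ∈ Submodule.span ℝ {dirVec s} ↔ Real.sin (t - s) = 0 := by
  rw [Submodule.mem_span_singleton]
  constructor
  · rintro ⟨r, hr⟩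
    have h0 : r * Real.cos s = Real.cos t := congrFun hr 0
    have h1 : r * Real.sin s = Real.sin t := congrFun hr 1
    rw [Real.sin_sub, ← h0, ← h1]
    ring
  · intro h
    have hc : Real.cos (t - s) ^ 2 = 1 := by
      have := Real.sin_sq_add_cos_sq (t - s)
      rw [h] at this
      linarith
    refine ⟨Real.cos (t - s), ?_⟩
    have ec : Real.cos t = Real.cos (t - s) * Real.cos s - Real.sin (t - s) * Real.sin s := by
      rw [← Real.cos_add, sub_add_cancel]
    have es : Real.sin t = Real.sin (t - s) * Real.cos s + Real.cos (t - s) * Real.sin s := by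
      rw [← Real.sin_add, sub_add_cancel]
    funext i
    fin_cases i
    · simp [dirVec, ec, h]
    · simp [dirVec, es, h]

lemma span_dirVec_eq {s t : ℝ} (h : Real.sin (t - s) = 0) :
    Submodule.span ℝ {dirVec t} = Submodule.span ℝ {dirVec s} := by
  apply le_antisymm <;> rw [Submodule.span_singleton_le_iff_mem, dirVec_mem_span_iff]
  · exact h
  · rw [← neg_sub, Real.sin_neg, h, neg_zero]

section
variable {l : ℝ}

lemma rotFamily_mulVec_dirVec (hl : 0 < l) (θ : ℝ) (ψ : ℝ → ℝ) (x t : ℝ) :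
    rotFamily l θ ψ x *ᵥ dirVec t =
      dr l (ψ x + θ + t) • dirVec (dl l (ψ x + θ + t)) := by
  obtain ⟨h1, h2⟩ := dr_mul_trig hl (ψ x + θ + t)
  have hr : ∀ a b : ℝ, rot a *ᵥ dirVec b = dirVec (a + b) := fun a b => by
    funext i
    fin_cases i <;>
      simp [rot, dirVec, Matrix.mulVec, dotProduct, Fin.sum_univ_two, Real.cos_add, Real.sin_add]
    ring
  rw [rotFamily, ← Matrix.mulVec_mulVec, hr, ← Matrix.mulVec_mulVec, hr, ← add_assoc]
  funext i
  fin_cases i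
  · simpa [dirVec, Matrix.mulVec_diagonal] using h1.symm
  · simpa [dirVec, Matrix.mulVec_diagonal] using h2.symm

lemma fwdIter_mulVec_dirVec (hl : 0 < l) (α θ : ℝ) (ψ : ℝ → ℝ) (x : ℝ) (n : ℕ) (t : ℝ) :
    fwdIter α (rotFamily l θ ψ) n x *ᵥ dirVec t =
      rad l (site α (fun y => ψ y + θ) x) n t •
        dirVec (ang l (site α (fun y => ψ y + θ) x) n t) := by
  induction n with
  | zero => simp [fwdIter]
  | succ n ih =>
    rw [fwdIter, ← Matrix.mulVec_mulVec, ih, Matrix.mulVec_smul, rotFamily_mulVec_dirVec hl,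
      smul_smul, ang_succ, rad_succ, mul_comm]
    rfl

lemma isUnit_det_fwdIter (hl : 0 < l) (α θ : ℝ) (ψ : ℝ → ℝ) (x : ℝ) (n : ℕ) :
    IsUnit (fwdIter α (rotFamily l θ ψ) n x).det := by
  have hr : ∀ a : ℝ, (rot a).det = 1 := fun a => by
    rw [rot, Matrix.det_fin_two_of]
    linear_combination Real.sin_sq_add_cos_sq a
  induction n with
  | zero => simp [fwdIter]
  | succ n ih =>
    rw [fwdIter, Matrix.det_mul]
    refine IsUnit.mul ?_ ih
    rw [rotFamily, Matrix.det_mul, Matrix.det_mul, hr, hr, Matrix.det_diagonal]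
    simp [Fin.prod_univ_two, hl.ne']

lemma fwdIter_inv_mulVec_dirVec (hl : 0 < l) (α θ : ℝ) (ψ : ℝ → ℝ) (x : ℝ) (n : ℕ) (t : ℝ) :
    (fwdIter α (rotFamily l θ ψ) n x)⁻¹ *ᵥ
        dirVec (ang l (site α (fun y => ψ y + θ) x) n t) =
      (rad l (site α (fun y => ψ y + θ) x) n t)⁻¹ • dirVec t := by
  have h := fwdIter_mulVec_dirVec hl α θ ψ x n t
  have hr := (rad_pos hl (site α (fun y => ψ y + θ) x) n t).ne'
  have h' := congrArg
    (fun w => (rad l (site α (fun y => ψ y + θ) x) n t)⁻¹ •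
      ((fwdIter α (rotFamily l θ ψ) n x)⁻¹ *ᵥ w)) h
  simp only [Matrix.mulVec_mulVec, Matrix.nonsing_inv_mul _ (isUnit_det_fwdIter hl α θ ψ x n),
    Matrix.one_mulVec, Matrix.mulVec_smul, smul_smul, inv_mul_cancel₀ hr, one_smul] at h'
  exact h'.symm

lemma cocycleIter_natCast (α : ℝ) (B : ℝ → M2) (n : ℕ) (x : ℝ) :
    cocycleIter α B n x = fwdIter α B n x := by simp [cocycleIter]

lemma cocycleIter_neg_natCast (α : ℝ) (B : ℝ → M2) {n : ℕ} (hn : 1 ≤ n) (x : ℝ) :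
    cocycleIter α B (-(n : ℤ)) x = (fwdIter α B n (x - n * α))⁻¹ := by
  have : ¬ (0 : ℤ) ≤ -(n : ℤ) := by omega
  rw [cocycleIter, if_neg this]
  simp [sub_eq_add_neg]

lemma IsUH.exists_hypAngles (hl : 0 < l) {α θ : ℝ} {ψ : ℝ → ℝ}
    (h : IsUH α (rotFamily l θ ψ)) :
    ∃ σ υ c ρ, HypAngles l α (fun y => ψ y + θ) σ υ c ρ := by
  obtain ⟨s, u, c, ρ, hc, hρ, hrank, hper, hinv, hcon⟩ := h
  choose σ hσ using fun x => exists_span_dirVec (hrank x).1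
  choose υ hυ using fun x => exists_span_dirVec (hrank x).2
  have key : ∀ (p : ℝ → Submodule ℝ (Fin 2 → ℝ)) (a : ℝ → ℝ) (x : ℝ),
      (∀ x, p x = Submodule.span ℝ {dirVec (a x)}) →
      (p x).map (Matrix.toLin' (rotFamily l θ ψ x)) = p (x + α) →
      Real.sin (dl l (ψ x + θ + a x) - a (x + α)) = 0 := by
    intro p a x hp hx
    rw [← dirVec_mem_span_iff, ← hp, ← hx, hp, Submodule.map_span, Set.image_singleton,
      Matrix.toLin'_apply, rotFamily_mulVec_dirVec hl, Submodule.mem_span_singleton]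
    exact ⟨(dr l (ψ x + θ + a x))⁻¹,
      by rw [smul_smul, inv_mul_cancel₀ (dr_pos hl _).ne', one_smul]⟩
  have hinv_u : ∀ x, Real.sin (dl l ((fun y => ψ y + θ) x + υ x) - υ (x + α)) = 0 :=
    fun x => key u υ x hυ (hinv x).2
  refine ⟨σ, υ, c, ρ, hc, hρ, fun x => ?_, fun x => key s σ x hσ (hinv x).1, hinv_u,
    fun x n hn => ?_, fun x n hn => ?_⟩
  · rw [← dirVec_mem_span_iff, ← hσ, ← (hper x).1, hσ]
    exact Submodule.mem_span_singleton_self _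
  · have h1 := (hcon x n hn).1 (dirVec (σ x))
      (by rw [hσ]; exact Submodule.mem_span_singleton_self _) (vnorm_dirVec _)
    rwa [cocycleIter_natCast, fwdIter_mulVec_dirVec hl, vnorm_smul_dirVec,
      abs_of_pos (rad_pos hl _ _ _)] at h1
  · obtain ⟨j, hj⟩ := sin_ang_sub_eq_zero hinv_u x n
    have h1 := (hcon (x + n * α) n hn).2
      (dirVec (ang l (site α (fun y => ψ y + θ) x) n (υ x)))
      (by
        rw [hυ, dirVec_mem_span_iff, hj, add_sub_cancel_left]
        exact Real.sin_int_mul_pi j) (vnorm_dirVec _)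
    have p := rad_pos hl (site α (fun y => ψ y + θ) x) n (υ x)
    rw [cocycleIter_neg_natCast _ _ hn, add_sub_cancel_right, fwdIter_inv_mulVec_dirVec hl,
      vnorm_smul_dirVec, abs_of_pos (inv_pos.mpr p),
      inv_lt_comm₀ p (div_pos hc (by positivity)), inv_div] at h1
    exact h1

lemma HypAngles.isUH (hl : 0 < l) {α θ c ρ : ℝ} {ψ σ υ : ℝ → ℝ}
    (h : HypAngles l α (fun y => ψ y + θ) σ υ c ρ)
    (hper : ∀ x, Real.sin (υ (x + 1) - υ x) = 0) : IsUH α (rotFamily l θ ψ) := by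
  have key : ∀ (a : ℝ → ℝ) (x : ℝ),
      Real.sin (dl l (ψ x + θ + a x) - a (x + α)) = 0 →
      (Submodule.span ℝ {dirVec (a x)}).map (Matrix.toLin' (rotFamily l θ ψ x)) =
        Submodule.span ℝ {dirVec (a (x + α))} := by
    intro a x hx
    rw [Submodule.map_span, Set.image_singleton, Matrix.toLin'_apply,
      rotFamily_mulVec_dirVec hl, Submodule.span_singleton_smul_eq
        (isUnit_iff_ne_zero.mpr (dr_pos hl _).ne'), span_dirVec_eq hx]
  have unit : ∀ (w : Fin 2 → ℝ) (t : ℝ), w ∈ Submodule.span ℝ {dirVec t} → vnorm w = 1 →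
      ∃ r : ℝ, |r| = 1 ∧ w = r • dirVec t := by
    intro w t hw h1
    obtain ⟨r, rfl⟩ := Submodule.mem_span_singleton.mp hw
    exact ⟨r, by rwa [vnorm_smul_dirVec] at h1, rfl⟩
  refine ⟨fun x => Submodule.span ℝ {dirVec (σ x)}, fun x => Submodule.span ℝ {dirVec (υ x)},
    c, ρ, h.c_pos, h.one_lt, fun x => ⟨finrank_span_dirVec _, finrank_span_dirVec _⟩,
    fun x => ⟨span_dirVec_eq (h.per x), span_dirVec_eq (hper x)⟩,
    fun x => ⟨key σ x (h.inv_s x), key υ x (h.inv_u x)⟩, fun x n hn => ⟨?_, ?_⟩⟩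
  · intro w hw h1
    obtain ⟨r, hr, rfl⟩ := unit w _ hw h1
    rw [cocycleIter_natCast, Matrix.mulVec_smul, fwdIter_mulVec_dirVec hl, smul_smul,
      vnorm_smul_dirVec, abs_mul, hr, one_mul, abs_of_pos (rad_pos hl _ _ _)]
    exact h.contr x n hn
  · intro w hw h1
    obtain ⟨y, rfl⟩ : ∃ y, x = y + n * α := ⟨x - n * α, by ring⟩
    obtain ⟨j, hj⟩ := sin_ang_sub_eq_zero h.inv_u y n
    have e : Submodule.span ℝ {dirVec (υ (y + n * α))} = Submodule.span ℝ
        {dirVec (ang l (site α (fun y => ψ y + θ) y) n (υ y))} := by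
      refine (span_dirVec_eq ?_).symm
      rw [hj, add_sub_cancel_left]
      exact Real.sin_int_mul_pi j
    simp only [e] at hw
    obtain ⟨r, hr, rfl⟩ := unit w _ hw h1
    have p := rad_pos hl (site α (fun y => ψ y + θ) y) n (υ y)
    have hρ := h.one_lt
    rw [cocycleIter_neg_natCast _ _ hn, add_sub_cancel_right, Matrix.mulVec_smul,
      fwdIter_inv_mulVec_dirVec hl, smul_smul, vnorm_smul_dirVec, abs_mul, hr, one_mul,
      abs_of_pos (inv_pos.mpr p), inv_lt_comm₀ p (div_pos h.c_pos (by positivity)), inv_div]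
    exact h.expan y n hn

end

section
variable {l : ℝ}

lemma abs_dl_le (hl : 0 < l) {s t : ℝ} (h : |t| ≤ s) : |dl l t| ≤ dl l s := by
  rw [abs_le] at h ⊢
  rw [← dl_neg]
  exact ⟨(dl_strictMono hl).monotone h.1, (dl_strictMono hl).monotone h.2⟩

lemma dl_pi_div_two_sub_le {η : ℝ} (hη : 0 < η) (hη2 : η < π / 2) (hl : 2 / Real.sin η ≤ l) :
    dl l (π / 2 - η) ≤ η := by
  have hπ := Real.pi_pos
  have hs : 0 < Real.sin η := Real.sin_pos_of_pos_of_lt_pi hη (by linarith)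
  rw [div_le_iff₀ hs] at hl
  have hl0 : 0 < l := pos_of_mul_pos_left (by linarith) hs.le
  have hd := dr_pos hl0 (π / 2 - η)
  have h0 : 0 < dl l (π / 2 - η) := by
    rw [← dl_zero l]; exact dl_strictMono hl0 (by linarith)
  have h1 : dl l (π / 2 - η) < π / 2 := by
    conv_rhs => rw [← dl_pi_div_two l]
    exact dl_strictMono hl0 (by linarith)
  obtain ⟨e1, e2⟩ := dr_mul_trig hl0 (π / 2 - η)
  rw [Real.cos_pi_div_two_sub] at e1
  rw [Real.sin_pi_div_two_sub] at e2
  by_contra! hlt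
  have h2 : 0 < dr l (π / 2 - η) * Real.sin (dl l (π / 2 - η) - η) :=
    mul_pos hd (Real.sin_pos_of_pos_of_lt_pi (by linarith) (by linarith))
  have h3 : dr l (π / 2 - η) * Real.sin (dl l (π / 2 - η) - η) =
      l⁻¹ * Real.cos η ^ 2 - l * Real.sin η ^ 2 := by
    rw [Real.sin_sub]
    linear_combination Real.cos η * e2 - Real.sin η * e1
  rw [h3] at h2
  have h4 : l * (l⁻¹ * Real.cos η ^ 2 - l * Real.sin η ^ 2) =
      Real.cos η ^ 2 - (l * Real.sin η) ^ 2 := by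
    field_simp
  have h5 := mul_pos hl0 h2
  rw [h4] at h5
  nlinarith [Real.cos_sq_le_one η]

lemma two_le_dr {η q : ℝ} {j : ℤ} (hη : 0 < η) (hη2 : η < π / 2) (hl : 2 / Real.sin η ≤ l)
    (hq : |q - j * π| ≤ π / 2 - η) : 2 ≤ dr l q := by
  have hπ := Real.pi_pos
  have hs : 0 < Real.sin η := Real.sin_pos_of_pos_of_lt_pi hη (by linarith)
  rw [div_le_iff₀ hs] at hl
  have hl0 : 0 < l := pos_of_mul_pos_left (by linarith) hs.le
  have h1 : Real.sin η ≤ |Real.cos q| := by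
    have e : |Real.cos q| = |Real.cos (q - j * π)| := by
      rw [Real.cos_sub_int_mul_pi, abs_mul, abs_neg_one_zpow, one_mul]
    rw [e, ← Real.cos_pi_div_two_sub]
    refine le_trans ?_ (le_abs_self _)
    rw [← Real.cos_abs (q - j * π)]
    exact Real.cos_le_cos_of_nonneg_of_le_pi (abs_nonneg _) (by linarith) hq
  have h2 := (dr_mul_trig hl0 q).1
  have h3 : l * |Real.cos q| ≤ dr l q := by
    rw [← abs_of_pos hl0, ← abs_mul, abs_of_pos hl0, ← h2, abs_mul, abs_of_pos (dr_pos hl0 q)]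
    exact mul_le_of_le_one_right (dr_pos hl0 q).le (Real.abs_cos_le_one _)
  nlinarith

/-- The invariant graph contained in the attracting strip of width `η`. -/
lemma exists_invariant_angle (hl : 0 < l) {α η : ℝ} {φ : ℝ → ℝ} {j : ℤ}
    (hη : 0 < η) (hdl : dl l (π / 2 - η) ≤ η) (hφ : ∀ x, |φ x - j * π| ≤ π / 2 - 2 * η) :
    ∃ υ : ℝ → ℝ, (∀ x, |υ x| ≤ η) ∧ (∀ x, dl l (φ x + υ x) = υ (x + α) + j * π) ∧
      (Function.Periodic φ 1 → Function.Periodic υ 1) := by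
  let U : ℕ → ℝ → ℝ := fun n => Nat.rec (fun _ => -η)
    (fun _ V x => dl l (φ (x - α) - j * π + V (x - α))) n
  have U0 : ∀ x, U 0 x = -η := fun x => rfl
  have US : ∀ n x, U (n + 1) x = dl l (φ (x - α) - j * π + U n (x - α)) := fun n x => rfl
  clear_value U
  have hb : ∀ n x, |U n x| ≤ η := by
    intro n
    induction n with
    | zero => intro x; rw [U0, abs_neg, abs_of_pos hη]
    | succ n ih =>
      intro x
      rw [US]
      refine (abs_dl_le hl ?_).trans hdl
      exact (abs_add_le _ _).trans (by linarith [hφ (x - α), ih (x - α)])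
  have hm : ∀ n x, U n x ≤ U (n + 1) x := by
    intro n
    induction n with
    | zero => intro x; rw [U0]; exact (abs_le.mp (hb _ _)).1
    | succ n ih =>
      intro x
      rw [US, US (n + 1)]
      exact (dl_strictMono hl).monotone (by linarith [ih (x - α)])
  have hlim : ∀ x, Filter.Tendsto (fun n => U n x) Filter.atTop (nhds (⨆ n, U n x)) := fun x =>
    tendsto_atTop_ciSup (monotone_nat_of_le_succ fun n => hm n x)
      ⟨η, by rintro _ ⟨n, rfl⟩; exact (abs_le.mp (hb n x)).2⟩
  refine ⟨fun x => ⨆ n, U n x, fun x => ?_, fun x => ?_, fun hp x => ?_⟩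
  · exact le_of_tendsto (hlim x).abs (Filter.Eventually.of_forall fun n => hb n x)
  · have t1 : Filter.Tendsto (fun n => U (n + 1) (x + α)) Filter.atTop
        (nhds (⨆ n, U n (x + α))) := (hlim (x + α)).comp (Filter.tendsto_add_atTop_nat 1)
    have t2 : Filter.Tendsto (fun n => dl l (φ x - j * π + U n x)) Filter.atTop
        (nhds (dl l (φ x - j * π + ⨆ n, U n x))) :=
      ((continuous_dl hl).tendsto _).comp ((hlim x).const_add _)
    have e := tendsto_nhds_unique t1 (by simpa only [US, add_sub_cancel_right] using t2)
    have e2 := dl_add_int_mul_pi l (φ x - j * π + ⨆ n, U n x) j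
    rw [← e] at e2
    rw [← e2]
    congr 1
    ring
  · have : ∀ n x, U n (x + 1) = U n x := by
      intro n
      induction n with
      | zero => intro x; rw [U0, U0]
      | succ n ih =>
        intro x
        rw [US, US, show x + 1 - α = x - α + 1 by ring, hp, ih]
    simp only [this]

lemma dr_dl_add_pi_div_two (hl : 0 < l) (q : ℝ) :
    dr l (dl l q + π / 2) * dr l q = 1 := by
  obtain ⟨h1, h2⟩ := dr_mul_trig hl q
  have h3 := dr_sq (l := l) (dl l q + π / 2)
  have p1 := dr_pos hl q
  have p2 := dr_pos hl (dl l q + π / 2)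
  rw [Real.cos_add_pi_div_two, Real.sin_add_pi_div_two] at h3
  have h4 : (dr l (dl l q + π / 2) * dr l q) ^ 2 = 1 := by
    have e : (dr l (dl l q + π / 2) * dr l q) ^ 2 =
        l ^ 2 * (dr l q * Real.sin (dl l q)) ^ 2 + l⁻¹ ^ 2 * (dr l q * Real.cos (dl l q)) ^ 2 := by
      rw [mul_pow, h3]; ring
    rw [e, h1, h2]
    field_simp
    exact Real.sin_sq_add_cos_sq q
  nlinarith [mul_pos p2 p1]

lemma sin_dl_dl_add_pi_div_two (hl : 0 < l) (q : ℝ) :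
    Real.sin (dl l (dl l q + π / 2) - (q + π / 2)) = 0 := by
  obtain ⟨h1, h2⟩ := dr_mul_trig hl q
  obtain ⟨h3, h4⟩ := dr_mul_trig hl (dl l q + π / 2)
  have p1 := dr_pos hl q
  have p2 := dr_pos hl (dl l q + π / 2)
  rw [Real.cos_add_pi_div_two] at h3
  rw [Real.sin_add_pi_div_two] at h4
  have e : dr l q * (dr l (dl l q + π / 2) *
      Real.sin (dl l (dl l q + π / 2) - (q + π / 2))) = 0 := by
    rw [Real.sin_sub, Real.cos_add_pi_div_two, Real.sin_add_pi_div_two]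
    have hli : l⁻¹ * l = 1 := inv_mul_cancel₀ hl.ne'
    linear_combination (-Real.sin q * dr l q) * h4 - Real.cos q * dr l q * h3 +
      (-Real.sin q * l⁻¹) * h1 + l * Real.cos q * h2
  simpa [p1.ne', p2.ne'] using e

/-- Uniform hyperbolicity when the rotation angles stay away from `π / 2` modulo `π`. -/
lemma isUH_of_abs_sub_le {α θ η : ℝ} {ψ : ℝ → ℝ} {j : ℤ} (hper : Function.Periodic ψ 1)
    (hη : 0 < η) (hη2 : η < π / 2) (hl : 2 / Real.sin η ≤ l)
    (h : ∀ x, |ψ x + θ - j * π| ≤ π / 2 - 2 * η) : IsUH α (rotFamily l θ ψ) := by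
  have hπ := Real.pi_pos
  have hs : 0 < Real.sin η := Real.sin_pos_of_pos_of_lt_pi hη (by linarith)
  have hl0 : 0 < l := lt_of_lt_of_le (by positivity) hl
  have hdl := dl_pi_div_two_sub_le hη hη2 hl
  have h' : ∀ x, |-(ψ x + θ) - (-j : ℤ) * π| ≤ π / 2 - 2 * η := fun x => by
    rw [← abs_neg]
    convert h x using 2
    push_cast
    ring
  obtain ⟨υ, hυ, hυi, hυp⟩ := exists_invariant_angle (α := α) (φ := fun x => ψ x + θ)
    hl0 hη hdl h
  obtain ⟨p, hp, hpi, hpp⟩ := exists_invariant_angle (α := -α) (φ := fun x => -(ψ x + θ))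
    hl0 hη hdl h'
  have hφp : ∀ x, ψ (x + 1) = ψ x := hper
  have hpp' : ∀ x, p (x + 1) = p x := hpp fun x => by simp only [hφp]
  have hpe : ∀ x, p x = dl l (-(ψ (x + α) + θ) + p (x + α)) + j * π := fun x => by
    rw [hpi]
    push_cast
    rw [add_neg_cancel_right]
    ring
  have hq : ∀ x, |-(ψ (x + α) + θ) + p (x + α) - (-j : ℤ) * π| ≤ π / 2 - η := fun x => by
    have := abs_add_le (-(ψ (x + α) + θ) - (-j : ℤ) * π) (p (x + α))
    have e : -(ψ (x + α) + θ) + p (x + α) - (-j : ℤ) * π =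
      -(ψ (x + α) + θ) - (-j : ℤ) * π + p (x + α) := by ring
    rw [e]
    linarith [h' (x + α), hp (x + α)]
  let σ : ℝ → ℝ := fun x => p x - (ψ x + θ) + π / 2
  have hinv_s : ∀ x, Real.sin (dl l ((fun y => ψ y + θ) x + σ x) - σ (x + α)) = 0 := fun x => by
    have e1 : (fun y => ψ y + θ) x + σ x =
        dl l (-(ψ (x + α) + θ) + p (x + α)) + π / 2 + j * π := by
      simp only [σ]
      rw [hpe x]
      ring
    have e2 : σ (x + α) = -(ψ (x + α) + θ) + p (x + α) + π / 2 + (0 : ℤ) * π := by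
      simp only [σ]
      push_cast
      ring
    rw [e1, e2, dl_add_int_mul_pi]
    exact sin_eq_zero_of_add _ _ (sin_dl_dl_add_pi_div_two hl0 _)
  have hinv_u : ∀ x, Real.sin (dl l ((fun y => ψ y + θ) x + υ x) - υ (x + α)) = 0 := fun x => by
    rw [hυi, add_sub_cancel_left]
    exact Real.sin_int_mul_pi j
  have dr_shift : ∀ t (i : ℤ), dr l (t + i * π) = dr l t := fun t i => by
    have e : dr l (t + i * π) ^ 2 = dr l t ^ 2 := by
      rw [dr_sq, dr_sq, Real.cos_add_int_mul_pi, Real.sin_add_int_mul_pi]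
      have : ((-1 : ℝ) ^ i) ^ 2 = 1 := by rw [← sq_abs, abs_neg_one_zpow, one_pow]
      linear_combination ((l * Real.cos t) ^ 2 + (l⁻¹ * Real.sin t) ^ 2) * this
    exact (pow_left_inj₀ (dr_pos hl0 _).le (dr_pos hl0 _).le two_ne_zero).mp e
  have H : HypAngles l α (fun y => ψ y + θ) σ υ 2 2 := by
    refine ⟨two_pos, one_lt_two, fun x => ?_, hinv_s, hinv_u, fun x n hn => ?_, fun x n hn => ?_⟩
    · simp only [σ, hφp, hpp', sub_self, Real.sin_zero]
    · clear hn
      have : rad l (site α (fun y => ψ y + θ) x) n (σ x) ≤ 1 / 2 ^ n := by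
        induction n with
        | zero => simp
        | succ n ih =>
          obtain ⟨i, hi⟩ := sin_ang_sub_eq_zero hinv_s x n
          rw [rad_succ, hi, site, ← add_assoc, dr_shift]
          have e1 : (fun y => ψ y + θ) (x + n * α) + σ (x + n * α) =
              dl l (-(ψ (x + n * α + α) + θ) + p (x + n * α + α)) + π / 2 + j * π := by
            simp only [σ]
            rw [hpe (x + n * α)]
            ring
          rw [e1, dr_shift]
          have d1 := dr_dl_add_pi_div_two hl0 (-(ψ (x + n * α + α) + θ) + p (x + n * α + α))
          have d2 := two_le_dr hη hη2 hl (hq (x + n * α))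
          have d3 := dr_pos hl0 (dl l (-(ψ (x + n * α + α) + θ) + p (x + n * α + α)) + π / 2)
          rw [show (1 : ℝ) / 2 ^ (n + 1) = 1 / 2 * (1 / 2 ^ n) by rw [pow_succ']; field_simp]
          have d4 : dr l (dl l (-(ψ (x + n * α + α) + θ) + p (x + n * α + α)) + π / 2) ≤ 1 / 2 := by
            nlinarith
          exact mul_le_mul d4 ih (rad_pos hl0 _ _ _).le (by norm_num)
      refine this.trans_lt ?_
      gcongr
      norm_num
    · clear hn
      have : 2 ^ n ≤ rad l (site α (fun y => ψ y + θ) x) n (υ x) := by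
        induction n with
        | zero => simp
        | succ n ih =>
          obtain ⟨i, hi⟩ := sin_ang_sub_eq_zero hinv_u x n
          rw [rad_succ, hi, site, ← add_assoc, dr_shift, pow_succ']
          refine mul_le_mul (two_le_dr (j := j) hη hη2 hl ?_) ih (by positivity)
            (dr_pos hl0 _).le
          have := abs_add_le (ψ (x + n * α) + θ - j * π) (υ (x + n * α))
          rw [show ψ (x + n * α) + θ + υ (x + n * α) - j * π =
            ψ (x + n * α) + θ - j * π + υ (x + n * α) by ring]
          linarith [h (x + n * α), hυ (x + n * α)]
      refine lt_of_lt_of_le ?_ this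
      have : (0 : ℝ) < 2 ^ n := by positivity
      linarith
  exact H.isUH hl0 fun x => by rw [hυp (fun x => by simp only [hφp]) x, sub_self, Real.sin_zero]

end

section

open MeasureTheory Set
open scoped Pointwise

/-- The saturation of a set of angles modulo `π`. -/
def satPi (E : Set ℝ) : Set ℝ := {θ | ∃ j : ℤ, θ + j * π ∈ E}

lemma satPi_eq_iUnion (E : Set ℝ) :
    satPi E = ⋃ g : AddSubgroup.zmultiples π, (g +ᵥ E) := by
  ext θ
  simp only [satPi, mem_ofPred_eq, mem_iUnion, Set.mem_vadd_set_iff_neg_vadd_mem]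
  constructor
  · rintro ⟨j, hj⟩
    refine ⟨⟨(-j) • π, AddSubgroup.zsmul_mem_zmultiples π (-j)⟩, ?_⟩
    rw [AddSubgroup.vadd_def]
    simpa [add_comm] using hj
  · rintro ⟨⟨g, hg⟩, h⟩
    obtain ⟨j, rfl⟩ := AddSubgroup.mem_zmultiples_iff.mp hg
    refine ⟨-j, ?_⟩
    rw [AddSubgroup.vadd_def] at h
    simpa [add_comm] using h

lemma volume_satPi_inter_le (E : Set ℝ) : volume (satPi E ∩ Ico 0 π) ≤ volume E := by
  have hd := isAddFundamentalDomain_Ioc Real.pi_pos 0 volume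
  rw [zero_add] at hd
  rw [measure_congr ((Filter.EventuallyEq.refl _ (satPi E)).inter Ico_ae_eq_Ioc),
    hd.measure_eq_tsum E, satPi_eq_iUnion, iUnion_inter]
  exact measure_iUnion_le _

lemma volume_le_satPi_inter {E : Set ℝ} (hE : MeasurableSet E) {t : ℝ}
    (ht : E ⊆ Ioc t (t + π)) : volume E ≤ volume (satPi E ∩ Ico 0 π) := by
  have hd := isAddFundamentalDomain_Ioc Real.pi_pos 0 volume
  rw [measure_congr ((Filter.EventuallyEq.refl _ (satPi E)).inter Ico_ae_eq_Ioc)]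
  have e := hd.measure_set_eq (isAddFundamentalDomain_Ioc Real.pi_pos t volume) (A := satPi E)
    ?_ ?_
  · rw [zero_add] at e
    rw [e]
    exact measure_mono fun x hx => ⟨⟨0, by simpa using hx⟩, ht hx⟩
  · rw [satPi_eq_iUnion]
    exact MeasurableSet.iUnion fun g => hE.const_vadd g
  · rintro ⟨g, hg⟩
    obtain ⟨i, rfl⟩ := AddSubgroup.mem_zmultiples_iff.mp hg
    ext x
    simp only [mem_preimage, satPi, mem_ofPred_eq]
    change (∃ j : ℤ, i • π + x + j * π ∈ E) ↔ _
    constructor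
    · rintro ⟨j, hj⟩
      refine ⟨i + j, ?_⟩
      convert hj using 1
      push_cast
      rw [zsmul_eq_mul]
      ring
    · rintro ⟨j, hj⟩
      refine ⟨j - i, ?_⟩
      convert hj using 1
      push_cast
      rw [zsmul_eq_mul]
      ring

lemma ang_add_int_mul_pi_sites (l : ℝ) (φ : ℕ → ℝ) (j : ℤ) (n : ℕ) (t : ℝ) :
    ang l (fun i => φ i + j * π) n t = ang l φ n t + n * j * π := by
  induction n with
  | zero => simp
  | succ n ih =>
    rw [ang_succ, ang_succ, ih]
    have e := dl_add_int_mul_pi l (φ n + ang l φ n t) (j + n * j)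
    push_cast at e ⊢
    rw [show φ n + j * π + (ang l φ n t + n * j * π) =
      φ n + ang l φ n t + (j + n * j) * π by ring, e]
    ring

lemma Sec.add_int_mul_pi {l α : ℝ} {φ S : ℝ → ℝ} {m k : ℤ} (h : Sec l α φ m k S) (j : ℤ) :
    Sec l α (fun x => φ x + j * π) m (k + j) S where
  cont := h.cont
  per := h.per
  inv x := by
    rw [add_right_comm, dl_add_int_mul_pi, h.inv]
    push_cast
    ring
  conv x a b h1 h2 h3 h4 := by
    have e : site α (fun x => φ x + j * π) x = fun i => site α φ x i + j * π := rfl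
    simp only [e, ang_add_int_mul_pi_sites, add_sub_add_right_eq_sub]
    exact h.conv x a b h1 h2 h3 h4

lemma not_isUH_inter_subset {l α a b δ : ℝ} {ψ : ℝ → ℝ} (hper : Function.Periodic ψ 1)
    (ha : ∀ x, ψ x + a ≤ π / 2) (hb : ∀ x, π / 2 ≤ ψ x + b) (hδ : 0 < δ) (hδ2 : δ < π)
    (hl : 2 / Real.sin (δ / 2) ≤ l) :
    {θ ∈ Ico (0 : ℝ) π | ¬ IsUH α (rotFamily l θ ψ)} ⊆
      satPi (Ioo (a - δ) (b + δ)) ∩ Ico 0 π := by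
  rintro θ ⟨hθ, hn⟩
  refine ⟨?_, hθ⟩
  by_contra hs
  refine hn ?_
  obtain ⟨j, hj, -⟩ := existsUnique_add_zsmul_mem_Ico Real.pi_pos θ (b + δ - π)
  rw [zsmul_eq_mul, sub_add_cancel] at hj
  have h1 : θ + j * π ≤ a - δ := by
    by_contra! h
    exact hs ⟨j, h, hj.2⟩
  refine isUH_of_abs_sub_le (j := -j) hper (half_pos hδ) (by linarith) hl fun x => ?_
  rw [abs_le]
  push_cast
  constructor
  · linarith [hb x, hj.1]
  · linarith [ha x]

lemma satPi_inter_subset {l α a b : ℝ} {ψ : ℝ → ℝ} (hψ : Continuous ψ) (hl : 1 ≤ l) :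
    satPi (Ioc a b) ∩ Ico 0 π ⊆ {θ ∈ Ico (0 : ℝ) π | ¬ IsUH α (rotFamily l θ ψ)} ∪
      (satPi (secSet l α ψ a b) ∩ Ico 0 π) := by
  rintro θ ⟨⟨j, hj⟩, hθ⟩
  by_cases h : IsUH α (rotFamily l θ ψ)
  · right
    refine ⟨⟨j, Ioc_subset_Icc_self hj, ?_⟩, hθ⟩
    obtain ⟨σ, υ, c, ρ, H⟩ := h.exists_hypAngles (by linarith)
    obtain ⟨m, k, S, hS⟩ := H.exists_sec hl (by fun_prop)
    refine ⟨m, k + j, S, ?_⟩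
    simpa only [add_assoc] using hS.add_int_mul_pi j
  · exact Or.inl ⟨hθ, h⟩

lemma exists_lipschitz_of_periodic {ψ : ℝ → ℝ} (hψ : ContDiff ℝ 1 ψ)
    (hper : Function.Periodic ψ 1) :
    ∃ Λ > 0, ∀ x y, |ψ x - ψ y| ≤ Λ * |x - y| := by
  have hp : Function.Periodic (deriv ψ) 1 := fun x => by
    rw [← deriv_comp_add_const]
    congr 1
    exact funext hper
  obtain ⟨C, hC⟩ := exists_abs_le_of_periodic (hψ.continuous_deriv le_rfl) hp
  refine ⟨|C| + 1, by positivity, fun x y => ?_⟩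
  exact convex_univ.norm_image_sub_le_of_norm_deriv_le
    (fun z _ => (hψ.differentiable one_ne_zero).differentiableAt)
    (fun z _ => (hC z).trans ((le_abs_self C).trans (by linarith))) (mem_univ y) (mem_univ x)

lemma exists_iSup_iInf {ψ : ℝ → ℝ} (hV : ConditionV ψ) :
    ∃ z₁ z₂, (⨅ x, ψ x) = ψ z₁ ∧ (⨆ x, ψ x) = ψ z₂ ∧ (∀ x, ψ z₁ ≤ ψ x) ∧ ∀ x, ψ x ≤ ψ z₂ := by
  obtain ⟨-, z₁, z₂, -, -, -, -, h1, h2, -, -⟩ := hV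
  refine ⟨z₁, z₂, le_antisymm (ciInf_le ⟨ψ z₁, ?_⟩ z₁) (le_ciInf h1),
    le_antisymm (ciSup_le h2) (le_ciSup ⟨ψ z₂, ?_⟩ z₂), h1, h2⟩
  · rintro _ ⟨x, rfl⟩; exact h1 x
  · rintro _ ⟨x, rfl⟩; exact h2 x

open Filter in
lemma tendsto_volume_not_isUH {τ α a b : ℝ} (hτ : 2 < τ) (hα : DC τ α) {ψ : ℝ → ℝ}
    (hper : Function.Periodic ψ 1) (hψ : ContDiff ℝ 1 ψ)
    (ha : ∀ x, ψ x + a ≤ π / 2) (ha' : ∃ x, ψ x + a = π / 2)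
    (hb : ∀ x, π / 2 ≤ ψ x + b) (hb' : ∃ x, ψ x + b = π / 2) (hab : a ≤ b) (hba : b < a + π) :
    Tendsto (fun l => (volume {θ ∈ Ico (0 : ℝ) π | ¬ IsUH α (rotFamily l θ ψ)}).toReal)
      atTop (nhds (b - a)) := by
  have hfin : ∀ l, volume {θ ∈ Ico (0 : ℝ) π | ¬ IsUH α (rotFamily l θ ψ)} ≠ ⊤ := fun l =>
    ((measure_mono fun θ hθ => hθ.1).trans_lt measure_Ico_lt_top).ne
  obtain ⟨Λ, hΛ, hL⟩ := exists_lipschitz_of_periodic hψ hper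
  have hbound : ∀ x, ∀ θ ∈ Icc a b, |ψ x + θ| ≤ 2 * π := fun x θ hθ => by
    rw [abs_le]
    constructor <;> linarith [ha x, hb x, hθ.1, hθ.2]
  have hsec := tendsto_volume_secSet hψ.continuous hper hτ hα hΛ hL hba.le ha' hb'
    (by positivity) hbound
  refine tendsto_order.mpr ⟨fun c hc => ?_, fun c hc => ?_⟩
  · have hε : (0 : ENNReal) < ENNReal.ofReal (b - a - c) := by
      rw [ENNReal.ofReal_pos]; linarith
    filter_upwards [hsec.eventually_lt_const hε, eventually_ge_atTop 1] with l hl hl1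
    have h1 : volume (Ioc a b) ≤ _ := (volume_le_satPi_inter measurableSet_Ioc
      (Ioc_subset_Ioc_right hba.le)).trans ((measure_mono (satPi_inter_subset (α := α)
        hψ.continuous hl1)).trans ((measure_union_le _ _).trans
          (add_le_add_right (volume_satPi_inter_le _) _)))
    have h2 := ENNReal.toReal_mono (ENNReal.add_ne_top.mpr ⟨hfin l, hl.ne_top⟩) h1
    rw [ENNReal.toReal_add (hfin l) hl.ne_top, Real.volume_Ioc,
      ENNReal.toReal_ofReal (by linarith)] at h2
    have h3 := (ENNReal.lt_ofReal_iff_toReal_lt hl.ne_top).mp hl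
    linarith
  · set δ : ℝ := min ((c - (b - a)) / 4) (π / 2) with hδ
    have hδ0 : 0 < δ := lt_min (by linarith) (by positivity)
    have hδ1 : δ ≤ (c - (b - a)) / 4 := min_le_left _ _
    have hδ2 : δ ≤ π / 2 := min_le_right _ _
    filter_upwards [eventually_ge_atTop (2 / Real.sin (δ / 2))] with l hl
    have h1 := (measure_mono (not_isUH_inter_subset (α := α) hper ha hb hδ0
      (by linarith [Real.pi_pos]) hl)).trans (volume_satPi_inter_le _)
    rw [Real.volume_Ioo] at h1
    have h2 := ENNReal.toReal_mono ENNReal.ofReal_ne_top h1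
    rw [ENNReal.toReal_ofReal (by linarith)] at h2
    linarith

end

/-- The Lebesgue measure of the set of non-uniformly hyperbolic parameters θ ∈ [0,π)
converges, as λ → ∞, to Leb(ψ(ℝ/ℤ)) = sup ψ - inf ψ. -/
theorem measure_not_uh_tendsto (τ α : ℝ) (hτ : 2 < τ) (hα : DC τ α)
    (ψ : ℝ → ℝ) (hper : Function.Periodic ψ 1) (hV : ConditionV ψ)
    (hosc : (⨆ x, ψ x) - (⨅ x, ψ x) < π) :
    (MeasureTheory.volume (Set.range ψ)).toReal = (⨆ x, ψ x) - (⨅ x, ψ x) ∧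
    Filter.Tendsto
      (fun lam : ℝ =>
        (MeasureTheory.volume {θ ∈ Set.Ico (0 : ℝ) π | ¬ IsUH α (rotFamily lam θ ψ)}).toReal)
      Filter.atTop (nhds ((⨆ x, ψ x) - (⨅ x, ψ x))) := by
  obtain ⟨z₁, z₂, e1, e2, h1, h2⟩ := exists_iSup_iInf hV
  have hψ : ContDiff ℝ 1 ψ := hV.1.of_le one_le_two
  rw [e1, e2] at hosc ⊢
  have hle := h1 z₂
  refine ⟨?_, ?_⟩
  · have hr : Set.range ψ = Set.Icc (ψ z₁) (ψ z₂) := by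
      apply Set.Subset.antisymm
      · rintro _ ⟨x, rfl⟩
        exact ⟨h1 x, h2 x⟩
      · rintro y ⟨hy1, hy2⟩
        exact mem_range_of_exists_le_of_exists_ge hψ.continuous ⟨z₁, hy1⟩ ⟨z₂, hy2⟩
    rw [hr, Real.volume_Icc, ENNReal.toReal_ofReal (by linarith)]
  · have h := tendsto_volume_not_isUH (a := π / 2 - ψ z₂) (b := π / 2 - ψ z₁) hτ hα hper hψ
      (fun x => by linarith [h2 x]) ⟨z₂, by ring⟩ (fun x => by linarith [h1 x]) ⟨z₁, by ring⟩
      (by linarith) (by linarith)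
    rwa [sub_sub_sub_cancel_left] at h
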